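/- Assume additionally that α < 1/2. Then for every t > 0 and every ρ > 0, with T_δ := t δ^{-2}, the weighted Cesàro limit diverges: lim_{δ→0+} δ^{-ρ} · Y_δ(T_δ)/T_δ = +∞. -/

import Mathlib

open MeasureTheory ProbabilityTheory Filter Set
open scoped RealInnerProductSpace

/-- The covariance matrix entries `R_{ij}(x) = ∫_{ℝᵈ} cos(k·x) R̂_{ij}(k) dk`, where
`R̂_{ij}(k) = a(|k|)|k|^{-(2α+d-2)} (δ_{ij} - k_i k_j/|k|²)`. -/
noncomputable def covEntry (d : ℕ) (α : ℝ) (a : ℝ → ℝ)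
    (x : EuclideanSpace ℝ (Fin d)) (i j : Fin d) : ℝ :=
  ∫ k : EuclideanSpace ℝ (Fin d),
    Real.cos ⟪k, x⟫ *
      (a ‖k‖ * ‖k‖ ^ (-(2 * α + (d : ℝ) - 2)) *
        ((if i = j then (1:ℝ) else 0) - k i * k j / ‖k‖ ^ 2))


namespace KP

/-- Euclidean space. -/
abbrev Eu (d : ℕ) := EuclideanSpace ℝ (Fin d)

section Det
variable {d : ℕ} {ι : Type*}

/-- Iterated time-ordered integrals along the moving frame. -/
noncomputable def Jw (G : ι → Eu d → ℝ) (v : Eu d) (s0 : ℝ) : List ι → ℝ → Eu d → ℝ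
  | [], _, _ => 1
  | p :: w, s, z => ∫ r in s0..s, G p (z + r • v) * Jw G v s0 w r z

/-- Formal derivative of a word. -/
def dW (D : Fin d → ι → ι) (l : Fin d) : List ι → List (List ι)
  | [] => []
  | p :: w => (D l p :: w) :: (dW D l w).map (fun u => p :: u)

/-- Sum of iterated integrals over a list of words. -/
noncomputable def Jsum (G : ι → Eu d → ℝ) (v : Eu d) (s0 : ℝ) (W : List (List ι))
    (s : ℝ) (z : Eu d) : ℝ :=
  (W.map (fun w => Jw G v s0 w s z)).sum

theorem Jsum_nil (G : ι → Eu d → ℝ) (v : Eu d) (s0 : ℝ) (s : ℝ) (z : Eu d) :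
    Jsum G v s0 [] s z = 0 := by simp [Jsum]

theorem Jsum_cons (G : ι → Eu d → ℝ) (v : Eu d) (s0 : ℝ) (w : List ι) (W : List (List ι))
    (s : ℝ) (z : Eu d) :
    Jsum G v s0 (w :: W) s z = Jw G v s0 w s z + Jsum G v s0 W s z := by simp [Jsum]

theorem Jsum_append (G : ι → Eu d → ℝ) (v : Eu d) (s0 : ℝ) (W W' : List (List ι))
    (s : ℝ) (z : Eu d) :
    Jsum G v s0 (W ++ W') s z = Jsum G v s0 W s z + Jsum G v s0 W' s z := by simp [Jsum]

theorem Jw_cont (G : ι → Eu d → ℝ) (v : Eu d) (s0 : ℝ) (hG : ∀ p, Continuous (G p))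
    (w : List ι) : Continuous (fun q : ℝ × Eu d => Jw G v s0 w q.1 q.2) := by
  induction w with
  | nil => simp only [Jw]; exact continuous_const
  | cons p w ih =>
    simp only [Jw]
    apply intervalIntegral.continuous_parametric_intervalIntegral_of_continuous
      (f := fun (q : ℝ × Eu d) r => G p (q.2 + r • v) * Jw G v s0 w r q.2)
    · have h1 : Continuous fun x : (ℝ × Eu d) × ℝ => G p (x.1.2 + x.2 • v) :=
        (hG p).comp (by fun_prop)
      have h2 : Continuous fun x : (ℝ × Eu d) × ℝ => Jw G v s0 w x.2 x.1.2 :=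
        ih.comp (f := fun x : (ℝ × Eu d) × ℝ => (x.2, x.1.2)) (by fun_prop)
      exact h1.mul h2
    · fun_prop

theorem Jsum_cont (G : ι → Eu d → ℝ) (v : Eu d) (s0 : ℝ) (hG : ∀ p, Continuous (G p))
    (W : List (List ι)) : Continuous (fun q : ℝ × Eu d => Jsum G v s0 W q.1 q.2) := by
  induction W with
  | nil => simp only [Jsum_nil]; exact continuous_const
  | cons w W ih => simp only [Jsum_cons]; exact (Jw_cont G v s0 hG w).add ih

/-- Differentiation under a compact interval integral, for a continuous derivative. -/
theorem hasFDerivAt_param (h : ℝ → Eu d → ℝ) (h' : ℝ → Eu d → (Eu d →L[ℝ] ℝ))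
    (hc : Continuous (fun q : ℝ × Eu d => h q.1 q.2))
    (hc' : Continuous (fun q : ℝ × Eu d => h' q.1 q.2))
    (hd : ∀ r z, HasFDerivAt (h r) (h' r z) z) (a b : ℝ) (z : Eu d) :
    HasFDerivAt (fun z => ∫ r in a..b, h r z) (∫ r in a..b, h' r z) z := by
  have hK : IsCompact (uIcc a b ×ˢ Metric.closedBall z 1) :=
    isCompact_uIcc.prod (isCompact_closedBall z 1)
  obtain ⟨C, hC⟩ := hK.exists_bound_of_continuousOn hc'.continuousOn
  have m1 : ∀ x : Eu d, Continuous (fun r => h r x) := fun x =>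
    hc.comp (f := fun r : ℝ => (r, x)) (by fun_prop)
  have m2 : ∀ x : Eu d, Continuous (fun r => h' r x) := fun x =>
    hc'.comp (f := fun r : ℝ => (r, x)) (by fun_prop)
  refine intervalIntegral.hasFDerivAt_integral_of_dominated_of_fderiv_le
    (F := fun z r => h r z) (F' := fun z r => h' r z) (bound := fun _ => C)
    (s := Metric.ball z 1) (Metric.ball_mem_nhds z one_pos) ?_ ?_ ?_ ?_ ?_ ?_
  · exact Eventually.of_forall fun x => (m1 x).aestronglyMeasurable
  · exact (m1 z).intervalIntegrable _ _
  · exact (m2 z).aestronglyMeasurable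
  · refine Eventually.of_forall fun r hr x hx => ?_
    exact hC (r, x) ⟨uIoc_subset_uIcc hr, Metric.ball_subset_closedBall hx⟩
  · exact intervalIntegrable_const
  · exact Eventually.of_forall fun r _ x _ => hd r x

theorem Jsum_map_cons (G : ι → Eu d → ℝ) (v : Eu d) (s0 : ℝ) (hG : ∀ p, Continuous (G p))
    (p : ι) (W : List (List ι)) (s : ℝ) (z : Eu d) :
    Jsum G v s0 (W.map (fun u => p :: u)) s z
      = ∫ r in s0..s, G p (z + r • v) * Jsum G v s0 W r z := by
  have cG : Continuous fun r : ℝ => G p (z + r • v) := (hG p).comp (by fun_prop)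
  induction W with
  | nil => simp [Jsum_nil]
  | cons w W ih =>
    have c1 : Continuous fun r : ℝ => Jw G v s0 w r z :=
      (Jw_cont G v s0 hG w).comp (f := fun r : ℝ => (r, z)) (by fun_prop)
    have c2 : Continuous fun r : ℝ => Jsum G v s0 W r z :=
      (Jsum_cont G v s0 hG W).comp (f := fun r : ℝ => (r, z)) (by fun_prop)
    simp only [List.map_cons, Jsum_cons, ih, Jw, mul_add]
    rw [intervalIntegral.integral_add]
    · exact (cG.mul c1).intervalIntegrable _ _
    · exact (cG.mul c2).intervalIntegrable _ _

variable (G : ι → Eu d → ℝ) (D : Fin d → ι → ι) (v : Eu d) (s0 : ℝ)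

theorem G_cont (hG : ∀ p x, HasFDerivAt (G p)
      (∑ l, G (D l p) x • (EuclideanSpace.proj l : Eu d →L[ℝ] ℝ)) x) (p : ι) :
    Continuous (G p) :=
  continuous_iff_continuousAt.2 fun x => (hG p x).continuousAt

theorem Jw_hasFDerivAt (hG : ∀ p x, HasFDerivAt (G p)
      (∑ l, G (D l p) x • (EuclideanSpace.proj l : Eu d →L[ℝ] ℝ)) x)
    (w : List ι) (s : ℝ) (z : Eu d) :
    HasFDerivAt (Jw G v s0 w s)
      (∑ l, Jsum G v s0 (dW D l w) s z • (EuclideanSpace.proj l : Eu d →L[ℝ] ℝ)) z := by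
  have cG := G_cont G D hG
  induction w generalizing s z with
  | nil =>
    simp only [dW, Jsum_nil, zero_smul, Finset.sum_const_zero]
    exact hasFDerivAt_const (1:ℝ) z
  | cons p w ih =>
    have key := hasFDerivAt_param
      (h := fun r z => G p (z + r • v) * Jw G v s0 w r z)
      (h' := fun r z => ∑ l, (G (D l p) (z + r • v) * Jw G v s0 w r z
        + G p (z + r • v) * Jsum G v s0 (dW D l w) r z) •
          (EuclideanSpace.proj l : Eu d →L[ℝ] ℝ)) ?_ ?_ ?_ s0 s z
    · have e : (∑ l, Jsum G v s0 (dW D l (p :: w)) s z • (EuclideanSpace.proj l : Eu d →L[ℝ] ℝ))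
        = ∫ r in s0..s, ∑ l, (G (D l p) (z + r • v) * Jw G v s0 w r z
        + G p (z + r • v) * Jsum G v s0 (dW D l w) r z) •
          (EuclideanSpace.proj l : Eu d →L[ℝ] ℝ) := by
        have cGz : ∀ q, Continuous fun r : ℝ => G q (z + r • v) := fun q =>
          (cG q).comp (by fun_prop)
        have c1 : Continuous fun r : ℝ => Jw G v s0 w r z :=
          (Jw_cont G v s0 cG w).comp (f := fun r : ℝ => (r, z)) (by fun_prop)
        have c2 : ∀ W, Continuous fun r : ℝ => Jsum G v s0 W r z := fun W =>
          (Jsum_cont G v s0 cG W).comp (f := fun r : ℝ => (r, z)) (by fun_prop)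
        rw [intervalIntegral.integral_finsetSum]
        · refine Finset.sum_congr rfl fun l _ => ?_
          rw [intervalIntegral.integral_smul_const, intervalIntegral.integral_add]
          · congr 1
            simp only [dW, Jsum_cons, Jsum_map_cons G v s0 cG]
            rfl
          · exact ((cGz _).mul c1).intervalIntegrable _ _
          · exact ((cGz _).mul (c2 _)).intervalIntegrable _ _
        · intro l _
          exact ((((cGz _).mul c1).add ((cGz _).mul (c2 _))).smul
            continuous_const).intervalIntegrable _ _
      rw [e]
      exact key
    · have h1 : Continuous fun x : ℝ × Eu d => G p (x.2 + x.1 • v) :=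
        (cG p).comp (by fun_prop)
      exact h1.mul (Jw_cont G v s0 cG w)
    · have h1 : ∀ q, Continuous fun x : ℝ × Eu d => G q (x.2 + x.1 • v) := fun q =>
        (cG q).comp (by fun_prop)
      refine continuous_finsetSum _ fun l _ => ?_
      have h3 : Continuous fun x : ℝ × Eu d => G (D l p) (x.2 + x.1 • v) * Jw G v s0 w x.1 x.2
        + G p (x.2 + x.1 • v) * Jsum G v s0 (dW D l w) x.1 x.2 :=
        ((h1 _).mul (Jw_cont G v s0 cG w)).add ((h1 _).mul (Jsum_cont G v s0 cG _))
      exact h3.smul continuous_const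
    · intro r z
      have h1 : HasFDerivAt (fun z => G p (z + r • v))
          (∑ l, G (D l p) (z + r • v) • (EuclideanSpace.proj l : Eu d →L[ℝ] ℝ)) z := by
        have := (hG p (z + r • v)).comp z ((hasFDerivAt_id z).add_const (r • v))
        exact this
      have h2 := h1.mul (ih r z)
      refine h2.congr_fderiv ?_
      simp only [Finset.smul_sum, ← Finset.sum_add_distrib]
      refine Finset.sum_congr rfl fun l _ => ?_
      rw [smul_smul, smul_smul, ← add_smul]
      congr 1
      ring

/-- Chain rule for iterated integrals along a curve. -/
theorem Jw_chain (hG : ∀ p x, HasFDerivAt (G p)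
      (∑ l, G (D l p) x • (EuclideanSpace.proj l : Eu d →L[ℝ] ℝ)) x)
    (p : ι) (w : List ι) (y : ℝ → Eu d) (y' : Eu d) (s : ℝ) (hy : HasDerivAt y y' s) :
    HasDerivAt (fun s => Jw G v s0 (p :: w) s (y s))
      (G p (y s + s • v) * Jw G v s0 w s (y s)
        + ∑ l, Jsum G v s0 (dW D l (p :: w)) s (y s) * y' l) s := by
  have cG := G_cont G D hG
  have hc : Continuous fun x : ℝ × Eu d => G p (x.2 + x.1 • v) * Jw G v s0 w x.1 x.2 := by
    have h1 : Continuous fun x : ℝ × Eu d => G p (x.2 + x.1 • v) :=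
      (cG p).comp (by fun_prop)
    exact h1.mul (Jw_cont G v s0 cG w)
  have key := hasStrictFDerivAt_uncurry_coprod (𝕜 := ℝ) (u := (s, y s))
    (f := fun s z => Jw G v s0 (p :: w) s z)
    (f₁ := fun s z => (ContinuousLinearMap.toSpanSingleton ℝ
      (G p (z + s • v) * Jw G v s0 w s z)))
    (f₂ := fun s z => ∑ l, Jsum G v s0 (dW D l (p :: w)) s z •
      (EuclideanSpace.proj l : Eu d →L[ℝ] ℝ)) ?_ ?_ ?_ ?_
  · have h2 := key.hasFDerivAt.comp_hasDerivAt s ((hasDerivAt_id s).prodMk hy)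
    refine h2.congr_deriv ?_
    simp [Function.HasUncurry.uncurry]
  · refine Eventually.of_forall fun q => ?_
    have hcq : Continuous fun r : ℝ => G p (q.2 + r • v) * Jw G v s0 w r q.2 :=
      hc.comp (f := fun r : ℝ => (r, q.2)) (by fun_prop)
    have := (hcq.integral_hasStrictDerivAt s0 q.1).hasDerivAt.hasFDerivAt
    exact this
  · exact Eventually.of_forall fun q => Jw_hasFDerivAt G D v s0 hG (p :: w) q.1 q.2
  · have : Continuous fun x : ℝ × Eu d => ContinuousLinearMap.toSpanSingleton ℝ
      (G p (x.2 + x.1 • v) * Jw G v s0 w x.1 x.2) := by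
      exact (ContinuousLinearMap.toSpanSingletonCLE (𝕜 := ℝ) (E := ℝ)).continuous.comp hc
    exact this.continuousAt
  · have : Continuous fun x : ℝ × Eu d => ∑ l, Jsum G v s0 (dW D l (p :: w)) x.1 x.2 •
      (EuclideanSpace.proj l : Eu d →L[ℝ] ℝ) :=
      continuous_finsetSum _ fun l _ => (Jsum_cont G v s0 cG _).smul continuous_const
    exact this.continuousAt

end Det
end KP


namespace KP

section Det2
variable {d : ℕ} {ι : Type*}

/-- Derivative of a list of words. -/
def dL (D : Fin d → ι → ι) (l : Fin d) (W : List (List ι)) : List (List ι) :=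
  W.flatMap (dW D l)

/-- All derivatives of a list of words. -/
def dAll (D : Fin d → ι → ι) (W : List (List ι)) : List (List ι) :=
  (List.finRange d).flatMap fun l => dL D l W

/-- Sum of absolute values. -/
noncomputable def absJ (G : ι → Eu d → ℝ) (v : Eu d) (s0 : ℝ) (W : List (List ι))
    (s : ℝ) (z : Eu d) : ℝ :=
  (W.map (fun w => |Jw G v s0 w s z|)).sum

/-- Next words in the expansion. -/
def stepW (D : Fin d → ι → ι) (e : Fin d → ι) (W : List (List ι)) : List (List ι) :=
  (List.finRange d).flatMap fun l => (dL D l W).map (fun u => e l :: u)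

/-- Words of the expansion. -/
def Uw (D : Fin d → ι → ι) (e : Fin d → ι) (c : Fin d) : ℕ → List (List ι)
  | 0 => [[e c]]
  | n + 1 => stepW D e (Uw D e c n)

/-- Error term. -/
noncomputable def Ef (G : ι → Eu d → ℝ) (D : Fin d → ι → ι) (e : Fin d → ι) (v : Eu d) (s0 : ℝ)
    (W : List (List ι)) (s : ℝ) (z : Eu d) : ℝ :=
  ∑ l, G (e l) (z + s • v) * Jsum G v s0 (dL D l W) s z

theorem dW_length (D : Fin d → ι → ι) (l : Fin d) (w : List ι) :
    ∀ u ∈ dW D l w, u.length = w.length := by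
  induction w with
  | nil => simp [dW]
  | cons p w ih =>
    intro u hu
    simp only [dW, List.mem_cons, List.mem_map] at hu
    rcases hu with rfl | ⟨u', hu', rfl⟩
    · simp
    · simp [ih u' hu']

theorem dL_length (D : Fin d → ι → ι) (l : Fin d) (W : List (List ι)) (n : ℕ)
    (h : ∀ u ∈ W, u.length = n) : ∀ u ∈ dL D l W, u.length = n := by
  intro u hu
  simp only [dL, List.mem_flatMap] at hu
  obtain ⟨w, hw, hu⟩ := hu
  rw [dW_length D l w u hu, h w hw]

theorem dAll_length (D : Fin d → ι → ι) (W : List (List ι)) (n : ℕ)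
    (h : ∀ u ∈ W, u.length = n) : ∀ u ∈ dAll D W, u.length = n := by
  intro u hu
  simp only [dAll, List.mem_flatMap] at hu
  obtain ⟨l, _, hu⟩ := hu
  exact dL_length D l W n h u hu

theorem dAll_iter_length (D : Fin d → ι → ι) (W : List (List ι)) (n : ℕ)
    (h : ∀ u ∈ W, u.length = n) (j : ℕ) : ∀ u ∈ (dAll D)^[j] W, u.length = n := by
  induction j with
  | zero => simpa using h
  | succ j ih =>
    rw [Function.iterate_succ_apply']
    exact dAll_length D _ n ih

theorem Uw_length (D : Fin d → ι → ι) (e : Fin d → ι) (c : Fin d) (n : ℕ) :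
    ∀ u ∈ Uw D e c n, u.length = n + 1 := by
  induction n with
  | zero => simp [Uw]
  | succ n ih =>
    intro u hu
    simp only [Uw, stepW, List.mem_flatMap, List.mem_map] at hu
    obtain ⟨l, _, w, hw, rfl⟩ := hu
    simp [dL_length D l _ _ ih w hw]

variable (G : ι → Eu d → ℝ) (D : Fin d → ι → ι) (e : Fin d → ι) (v : Eu d) (s0 : ℝ)

theorem absJ_nil (s z) : absJ G v s0 [] s z = 0 := by simp [absJ]
theorem absJ_cons (w W s z) : absJ G v s0 (w :: W) s z = |Jw G v s0 w s z| + absJ G v s0 W s z := by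
  simp [absJ]
theorem absJ_append (W W' s z) :
    absJ G v s0 (W ++ W') s z = absJ G v s0 W s z + absJ G v s0 W' s z := by
  simp [absJ]

theorem absJ_nonneg (W s z) : 0 ≤ absJ G v s0 W s z := by
  induction W with
  | nil => simp [absJ_nil]
  | cons w W ih => rw [absJ_cons]; positivity

theorem abs_Jsum_le (W s z) : |Jsum G v s0 W s z| ≤ absJ G v s0 W s z := by
  induction W with
  | nil => simp [absJ_nil, Jsum_nil]
  | cons w W ih => rw [absJ_cons, Jsum_cons]; exact (abs_add_le _ _).trans (by gcongr)

theorem absJ_dAll (W s z) : absJ G v s0 (dAll D W) s z = ∑ l, absJ G v s0 (dL D l W) s z := by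
  have : ∀ L : List (Fin d), absJ G v s0 (L.flatMap fun l => dL D l W) s z
      = (L.map fun l => absJ G v s0 (dL D l W) s z).sum := by
    intro L
    induction L with
    | nil => simp [absJ_nil]
    | cons l L ih => simp only [List.flatMap_cons, absJ_append, ih, List.map_cons, List.sum_cons]
  rw [dAll, this, ← List.ofFn_eq_map, List.sum_ofFn]

theorem absJ_dAll_cons (w W s z) : absJ G v s0 (dAll D (w :: W)) s z
    = absJ G v s0 (dAll D [w]) s z + absJ G v s0 (dAll D W) s z := by
  simp only [absJ_dAll, ← Finset.sum_add_distrib]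
  refine Finset.sum_congr rfl fun l _ => ?_
  rw [← absJ_append]; simp [dL]

/-- One step of the mean value inequality. -/
theorem Jw_mvt (hG : ∀ p x, HasFDerivAt (G p)
      (∑ l, G (D l p) x • (EuclideanSpace.proj l : Eu d →L[ℝ] ℝ)) x)
    (w : List ι) (s : ℝ) (m z : Eu d) (r B : ℝ) (hz : ‖z - m‖ ≤ r)
    (hB : ∀ z' ∈ Metric.closedBall m r, absJ G v s0 (dAll D [w]) s z' ≤ B) :
    |Jw G v s0 w s z - Jw G v s0 w s m| ≤ r * B := by
  have hr : 0 ≤ r := (norm_nonneg _).trans hz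
  have hB0 : 0 ≤ B := (absJ_nonneg G v s0 _ s m).trans (hB m (Metric.mem_closedBall_self hr))
  have key := (convex_closedBall m r).norm_image_sub_le_of_norm_hasFDerivWithin_le
    (f := Jw G v s0 w s) (C := B)
    (fun x hx => (Jw_hasFDerivAt G D v s0 hG w s x).hasFDerivWithinAt) (fun x hx => ?_)
    (Metric.mem_closedBall_self hr) (y := z) (by simpa [dist_eq_norm] using hz)
  · rw [Real.norm_eq_abs] at key
    calc _ ≤ B * ‖z - m‖ := key
      _ ≤ B * r := by gcongr
      _ = r * B := mul_comm _ _
  · refine le_trans ?_ (hB x hx)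
    rw [absJ_dAll]
    refine (norm_sum_le _ _).trans (Finset.sum_le_sum fun l _ => ?_)
    have hp : ‖(EuclideanSpace.proj l : Eu d →L[ℝ] ℝ)‖ ≤ 1 :=
      ContinuousLinearMap.opNorm_le_bound _ zero_le_one fun x => by
        simpa using PiLp.norm_apply_le x l
    rw [norm_smul, Real.norm_eq_abs]
    calc _ ≤ |Jsum G v s0 (dW D l w) s x| * 1 := by gcongr
      _ ≤ absJ G v s0 (dW D l w) s x := by rw [mul_one]; exact abs_Jsum_le _ _ _ _ _ _
      _ = _ := by simp [dL]

theorem absJ_mvt (hG : ∀ p x, HasFDerivAt (G p)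
      (∑ l, G (D l p) x • (EuclideanSpace.proj l : Eu d →L[ℝ] ℝ)) x)
    (W : List (List ι)) (s : ℝ) (m z : Eu d) (r B : ℝ) (hz : ‖z - m‖ ≤ r)
    (hB : ∀ z' ∈ Metric.closedBall m r, absJ G v s0 (dAll D W) s z' ≤ B) :
    absJ G v s0 W s z ≤ absJ G v s0 W s m + W.length * (r * B) := by
  induction W with
  | nil => simp [absJ_nil]
  | cons w W ih =>
    have h1 := Jw_mvt G D v s0 hG w s m z r B hz (fun z' hz' => by
      have := hB z' hz'
      rw [absJ_dAll_cons] at this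
      linarith [absJ_nonneg G v s0 (dAll D W) s z'])
    have h2 := ih (fun z' hz' => by
      have := hB z' hz'
      rw [absJ_dAll_cons] at this
      linarith [absJ_nonneg G v s0 (dAll D [w]) s z'])
    rw [absJ_cons, absJ_cons]
    have h3 : |Jw G v s0 w s z| ≤ |Jw G v s0 w s m| + r * B := by
      have := abs_sub_abs_le_abs_sub (Jw G v s0 w s z) (Jw G v s0 w s m)
      linarith
    push_cast [List.length_cons]
    linarith

/-- Constant in the iterated mean value inequality. -/
def cW (D : Fin d → ι → ι) : ℕ → List (List ι) → ℕ
  | 0, _ => 1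
  | L + 1, W => 1 + W.length * cW D L (dAll D W)

theorem one_le_cW (D : Fin d → ι → ι) (L : ℕ) (W : List (List ι)) : 1 ≤ cW D L W := by
  cases L <;> simp [cW]

theorem absJ_taylor (hG : ∀ p x, HasFDerivAt (G p)
      (∑ l, G (D l p) x • (EuclideanSpace.proj l : Eu d →L[ℝ] ℝ)) x)
    (L : ℕ) (W : List (List ι)) (s : ℝ) (m z : Eu d) (r B : ℝ) (hz : ‖z - m‖ ≤ r)
    (hB : ∀ z' ∈ Metric.closedBall m r, absJ G v s0 ((dAll D)^[L] W) s z' ≤ B) :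
    absJ G v s0 W s z ≤ cW D L W *
      (∑ j ∈ Finset.range L, r ^ j * absJ G v s0 ((dAll D)^[j] W) s m + r ^ L * B) := by
  have hr : 0 ≤ r := (norm_nonneg _).trans hz
  induction L generalizing W z with
  | zero =>
    simp only [cW, Finset.range_zero, Finset.sum_empty, pow_zero, one_mul, zero_add,
      Nat.cast_one]
    exact hB z (by simpa [dist_eq_norm] using hz)
  | succ L ih =>
    have hB0 : 0 ≤ B :=
      (absJ_nonneg G v s0 _ s m).trans (hB m (Metric.mem_closedBall_self hr))
    set Q := ∑ j ∈ Finset.range L, r ^ j * absJ G v s0 ((dAll D)^[j] (dAll D W)) s m + r ^ L * B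
      with hQ
    have hQ0 : 0 ≤ Q := by
      have := fun j => absJ_nonneg G v s0 ((dAll D)^[j] (dAll D W)) s m
      exact add_nonneg (Finset.sum_nonneg fun j _ => mul_nonneg (pow_nonneg hr j) (this j))
        (by positivity)
    have h1 := absJ_mvt G D v s0 hG W s m z r (cW D L (dAll D W) * Q) hz (fun z' hz' =>
      ih (dAll D W) z' (by simpa [dist_eq_norm] using hz') (by simpa using hB))
    have h2 : ∑ j ∈ Finset.range (L + 1), r ^ j * absJ G v s0 ((dAll D)^[j] W) s m
        + r ^ (L + 1) * B = absJ G v s0 W s m + r * Q := by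
      rw [Finset.sum_range_succ', hQ, mul_add, Finset.mul_sum]
      simp only [Function.iterate_succ_apply, pow_succ]
      simp only [Function.iterate_zero, id, pow_zero, one_mul]
      have : ∑ x ∈ Finset.range L, r ^ x * r * absJ G v s0 ((dAll D)^[x] (dAll D W)) s m
        = ∑ i ∈ Finset.range L, r * (r ^ i * absJ G v s0 ((dAll D)^[i] (dAll D W)) s m) :=
        Finset.sum_congr rfl fun i _ => by ring
      rw [this]; ring
    rw [h2]
    have h3 := absJ_nonneg G v s0 W s m
    have h4 : (0:ℝ) ≤ W.length * cW D L (dAll D W) := by positivity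
    simp only [cW]
    push_cast
    nlinarith [mul_nonneg hr hQ0, mul_nonneg h4 h3]

/-- Crude bound. -/
theorem Jw_crude (w : List ι) (C : ι → ℝ) (Γ : ℝ) (hC : ∀ p, 0 ≤ C p) (hΓ : 0 ≤ Γ) (s1 : ℝ)
    (h01 : s0 ≤ s1) (z : Eu d)
    (hb : ∀ p, ∀ r ∈ Icc s0 s1, |G p (z + r • v)| ≤ C p * Γ) (s : ℝ) (hs : s ∈ Icc s0 s1) :
    |Jw G v s0 w s z| ≤ (w.map C).prod * ((s1 - s0) * Γ) ^ w.length := by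
  induction w generalizing s with
  | nil => simp [Jw]
  | cons p w ih =>
    have hp : 0 ≤ (w.map C).prod := List.prod_nonneg (by simpa using fun a _ => hC a)
    have := intervalIntegral.norm_integral_le_of_norm_le_const (a := s0) (b := s)
      (f := fun r => G p (z + r • v) * Jw G v s0 w r z)
      (C := (C p * Γ) * ((w.map C).prod * ((s1 - s0) * Γ) ^ w.length)) (fun r hr => by
        rw [uIoc_of_le hs.1] at hr
        have hr' : r ∈ Icc s0 s1 := ⟨hr.1.le, hr.2.trans hs.2⟩
        rw [norm_mul]
        gcongr
        · exact mul_nonneg (hC p) hΓ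
        · exact hb p r hr'
        · exact ih r hr')
    simp only [Jw, List.map_cons, List.prod_cons, List.length_cons]
    rw [Real.norm_eq_abs] at this
    refine this.trans ?_
    rw [abs_of_nonneg (by linarith [hs.1])]
    have h5 : s - s0 ≤ s1 - s0 := by linarith [hs.2]
    have h6 : 0 ≤ s1 - s0 := by linarith
    have h7 : 0 ≤ C p * Γ * ((w.map C).prod * ((s1 - s0) * Γ) ^ w.length) := by
      have := hC p
      positivity
    calc _ ≤ C p * Γ * ((w.map C).prod * ((s1 - s0) * Γ) ^ w.length) * (s1 - s0) := by gcongr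
      _ = _ := by ring

theorem absJ_crude (W : List (List ι)) (n : ℕ) (hW : ∀ w ∈ W, w.length = n)
    (C : ι → ℝ) (Γ : ℝ) (hC : ∀ p, 0 ≤ C p) (hΓ : 0 ≤ Γ) (s1 : ℝ)
    (h01 : s0 ≤ s1) (z : Eu d)
    (hb : ∀ p, ∀ r ∈ Icc s0 s1, |G p (z + r • v)| ≤ C p * Γ) (s : ℝ) (hs : s ∈ Icc s0 s1) :
    absJ G v s0 W s z ≤ (W.map (fun w => (w.map C).prod)).sum * ((s1 - s0) * Γ) ^ n := by
  induction W with
  | nil => simp [absJ_nil]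
  | cons w W ih =>
    rw [absJ_cons]
    have h1 := Jw_crude G v s0 w C Γ hC hΓ s1 h01 z hb s hs
    rw [hW w (by simp)] at h1
    have h2 := ih (fun u hu => hW u (by simp [hu]))
    simp only [List.map_cons, List.sum_cons, add_mul]
    linarith

theorem Jsum_flatMap {κ : Type*} (L : List κ) (f : κ → List (List ι)) (s z) :
    Jsum G v s0 (L.flatMap f) s z = (L.map fun l => Jsum G v s0 (f l) s z).sum := by
  induction L with
  | nil => simp [Jsum_nil]
  | cons l L ih => simp only [List.flatMap_cons, Jsum_append, ih, List.map_cons, List.sum_cons]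

/-- head part of derivative -/
noncomputable def hdJ (s : ℝ) (z : Eu d) : List (List ι) → ℝ
  | [] => 0
  | [] :: W => hdJ s z W
  | (p :: w) :: W => G p (z + s • v) * Jw G v s0 w s z + hdJ s z W

theorem Jsum_chain (hG : ∀ p x, HasFDerivAt (G p)
      (∑ l, G (D l p) x • (EuclideanSpace.proj l : Eu d →L[ℝ] ℝ)) x)
    (W : List (List ι)) (y : ℝ → Eu d) (y' : Eu d) (s : ℝ) (hy : HasDerivAt y y' s) :
    HasDerivAt (fun s => Jsum G v s0 W s (y s))
      (hdJ G v s0 s (y s) W + ∑ l, Jsum G v s0 (dL D l W) s (y s) * y' l) s := by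
  induction W with
  | nil => simp only [Jsum_nil, hdJ, dL, List.flatMap_nil, zero_mul, Finset.sum_const_zero,
      add_zero]; exact hasDerivAt_const _ _
  | cons w W ih =>
    simp only [Jsum_cons]
    cases w with
    | nil =>
      refine ((hasDerivAt_const s (1:ℝ)).add ih).congr_deriv ?_
      simp [hdJ, dL, dW]
    | cons p w =>
      refine ((Jw_chain G D v s0 hG p w y y' s hy).add ih).congr_deriv ?_
      simp only [hdJ, dL, List.flatMap_cons, Jsum_append, add_mul, Finset.sum_add_distrib]
      ring

theorem hdJ_append (s z) (W W' : List (List ι)) :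
    hdJ G v s0 s z (W ++ W') = hdJ G v s0 s z W + hdJ G v s0 s z W' := by
  induction W with
  | nil => simp [hdJ]
  | cons w W ih => cases w <;> simp [hdJ, ih, add_assoc]

theorem hdJ_map (s z) (p : ι) (W : List (List ι)) :
    hdJ G v s0 s z (W.map (fun u => p :: u)) = G p (z + s • v) * Jsum G v s0 W s z := by
  induction W with
  | nil => simp [hdJ, Jsum_nil]
  | cons w W ih => simp [hdJ, ih, Jsum_cons, mul_add]

theorem hdJ_stepW (s z) (W : List (List ι)) :
    hdJ G v s0 s z (stepW D e W) = Ef G D e v s0 W s z := by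
  have : ∀ L : List (Fin d), hdJ G v s0 s z (L.flatMap fun l => (dL D l W).map (fun u => e l :: u))
      = (L.map fun l => G (e l) (z + s • v) * Jsum G v s0 (dL D l W) s z).sum := by
    intro L
    induction L with
    | nil => simp [hdJ]
    | cons l L ih => simp only [List.flatMap_cons, hdJ_append, ih, hdJ_map, List.map_cons,
        List.sum_cons]
  rw [stepW, this, ← List.ofFn_eq_map, List.sum_ofFn, Ef]

theorem Jw_s0 (w : List ι) (hw : w ≠ []) (z) : Jw G v s0 w s0 z = 0 := by
  cases w with
  | nil => exact absurd rfl hw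
  | cons p w => simp [Jw]

theorem Jsum_s0 (W : List (List ι)) (hW : ∀ w ∈ W, w ≠ []) (z) : Jsum G v s0 W s0 z = 0 := by
  induction W with
  | nil => simp [Jsum_nil]
  | cons w W ih => rw [Jsum_cons, Jw_s0 G v s0 w (hW w (by simp)),
      ih fun u hu => hW u (by simp [hu]), zero_add]

/-- The expansion. -/
theorem expansion (hG : ∀ p x, HasFDerivAt (G p)
      (∑ l, G (D l p) x • (EuclideanSpace.proj l : Eu d →L[ℝ] ℝ)) x)
    (F : Eu d → Eu d) (hF : ∀ x l, F x l = G (e l) x) (δ : ℝ) (hδ : 0 < δ)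
    (y : ℝ → Eu d) (s1 : ℝ) (h01 : s0 ≤ s1)
    (hy : ∀ s ∈ Icc s0 s1, HasDerivAt y (δ • F (y s + s • v)) s) (c : Fin d) (N : ℕ) :
    |y s1 c - y s0 c - δ * ∑ n ∈ Finset.range (N + 1), (-δ) ^ n *
        Jsum G v s0 (Uw D e c n) s1 (y s1)|
      ≤ δ ^ (N + 2) * ∫ s in s0..s1, |Ef G D e v s0 (Uw D e c N) s (y s)| := by
  have cG := G_cont G D hG
  have hUd : ∀ n, ∀ s ∈ Icc s0 s1, HasDerivAt (fun s => Jsum G v s0 (Uw D e c n) s (y s))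
      (hdJ G v s0 s (y s) (Uw D e c n) + δ * Ef G D e v s0 (Uw D e c n) s (y s)) s := by
    intro n s hs
    refine (Jsum_chain G D v s0 hG _ y _ s (hy s hs)).congr_deriv ?_
    congr 1
    rw [Ef, Finset.mul_sum]
    refine Finset.sum_congr rfl fun l _ => ?_
    simp only [PiLp.smul_apply, smul_eq_mul, hF]
    ring
  have hyc : ∀ s ∈ Icc s0 s1, HasDerivAt (fun s => y s c) (δ * G (e c) (y s + s • v)) s := by
    intro s hs
    have := (EuclideanSpace.proj c : Eu d →L[ℝ] ℝ).hasFDerivAt.comp_hasDerivAt s (hy s hs)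
    refine (this.congr_deriv ?_)
    simp [hF]
  have htel : ∀ s ∈ Icc s0 s1, HasDerivAt (fun s => ∑ n ∈ Finset.range (N + 1), (-δ) ^ n *
        Jsum G v s0 (Uw D e c n) s (y s))
      (G (e c) (y s + s • v) - (-δ) ^ (N + 1) * Ef G D e v s0 (Uw D e c N) s (y s)) s := by
    intro s hs
    induction N with
    | zero =>
      simp only [zero_add, Finset.range_one, Finset.sum_singleton, pow_zero, one_mul]
      refine (hUd 0 s hs).congr_deriv ?_
      simp [Uw, hdJ, Jw]
    | succ N ih =>
      simp only [Finset.sum_range_succ _ (N + 1)]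
      refine (ih.add ((hUd (N + 1) s hs).const_mul ((-δ) ^ (N + 1)))).congr_deriv ?_
      have : hdJ G v s0 s (y s) (Uw D e c (N + 1)) = Ef G D e v s0 (Uw D e c N) s (y s) := by
        simp only [Uw, hdJ_stepW]
      rw [this]; ring
  have hΦ : ∀ s ∈ uIcc s0 s1, HasDerivAt (fun s => y s c - δ * ∑ n ∈ Finset.range (N + 1),
        (-δ) ^ n * Jsum G v s0 (Uw D e c n) s (y s))
        (δ * (-δ) ^ (N + 1) * Ef G D e v s0 (Uw D e c N) s (y s)) s := by
    intro s hs
    rw [uIcc_of_le h01] at hs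
    refine ((hyc s hs).sub ((htel s hs).const_mul δ)).congr_deriv ?_
    ring
  have yc : ContinuousOn y (uIcc s0 s1) := fun s hs => by
    rw [uIcc_of_le h01] at hs; exact (hy s hs).continuousAt.continuousWithinAt
  have cE : Continuous fun q : ℝ × Eu d => Ef G D e v s0 (Uw D e c N) q.1 q.2 := by
    simp only [Ef]
    refine continuous_finsetSum _ fun l _ => ?_
    have h1 : Continuous fun x : ℝ × Eu d => G (e l) (x.2 + x.1 • v) := (cG _).comp (by fun_prop)
    exact h1.mul (Jsum_cont G v s0 cG _)
  have cEy : ContinuousOn (fun s => Ef G D e v s0 (Uw D e c N) s (y s)) (uIcc s0 s1) :=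
    cE.comp_continuousOn (f := fun s => (s, y s)) (continuousOn_id.prodMk yc)
  have ftc := intervalIntegral.integral_eq_sub_of_hasDerivAt hΦ
    (continuousOn_const.mul cEy).intervalIntegrable
  have hz : ∑ n ∈ Finset.range (N + 1), (-δ) ^ n * Jsum G v s0 (Uw D e c n) s0 (y s0) = 0 := by
    refine Finset.sum_eq_zero fun n _ => ?_
    rw [Jsum_s0, mul_zero]
    intro w hw hw0
    have := Uw_length D e c n w hw
    simp [hw0] at this
  have e1 : y s1 c - y s0 c - δ * ∑ n ∈ Finset.range (N + 1), (-δ) ^ n *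
        Jsum G v s0 (Uw D e c n) s1 (y s1)
      = ∫ s in s0..s1, δ * (-δ) ^ (N + 1) * Ef G D e v s0 (Uw D e c N) s (y s) := by
    rw [ftc, hz]; ring
  rw [e1, intervalIntegral.integral_const_mul, abs_mul]
  have e2 : |δ * (-δ) ^ (N + 1)| = δ ^ (N + 2) := by
    rw [abs_mul, abs_pow, abs_neg, abs_of_pos hδ]; ring
  rw [e2]
  gcongr
  exact intervalIntegral.abs_integral_le_integral_abs h01

end Det2
end KP


namespace KP

section Gauss
open Polynomial in
theorem integrable_poly_gaussian (v : NNReal) (p : ℝ[X]) :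
    Integrable (fun x => p.eval x) (gaussianReal 0 v) := by
  have hm : ∀ n : ℕ, Integrable (fun x : ℝ => x ^ n) (gaussianReal 0 v) := by
    intro n
    have h := (memLp_id_gaussianReal (μ := 0) (v := v) (n : NNReal))
    rcases Nat.eq_zero_or_pos n with rfl | hn
    · simp
    · have := h.integrable_norm_pow (by exact_mod_cast hn.ne')
      refine this.mono' (by fun_prop) (ae_of_all _ fun x => by simp)
  simp only [Polynomial.eval_eq_sum_range]
  exact integrable_finsetSum _ fun i _ => (hm i).const_mul _

open Polynomial in
theorem stein_poly (v : NNReal) (hv : v ≠ 0) (p : ℝ[X]) :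
    ∫ x, x * p.eval x ∂(gaussianReal 0 v) = v * ∫ x, p.derivative.eval x ∂(gaussianReal 0 v) := by
  have hintg : ∀ q : ℝ[X], Integrable (fun x => gaussianPDFReal 0 v x * q.eval x) := by
    intro q
    have := integrable_poly_gaussian v q
    rw [gaussianReal_of_var_ne_zero _ hv, integrable_withDensity_iff_integrable_smul'
      (measurable_gaussianPDF _ _) (ae_of_all _ fun _ => gaussianPDF_lt_top)] at this
    simpa [toReal_gaussianPDF] using this
  rw [integral_gaussianReal_eq_integral_smul hv, integral_gaussianReal_eq_integral_smul hv]
  simp only [smul_eq_mul]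
  have hv' : (v : ℝ) ≠ 0 := by exact_mod_cast hv
  have hd : ∀ x, HasDerivAt (gaussianPDFReal 0 v) (-(x / v) * gaussianPDFReal 0 v x) x := by
    intro x
    simp only [gaussianPDFReal_def]
    have h1 : HasDerivAt (fun x : ℝ => -(x - 0) ^ 2 / (2 * v)) (-(2 * x) / (2 * v)) x := by
      have := ((((hasDerivAt_id x).sub_const 0).pow 2).neg).div_const (2 * (v:ℝ))
      refine this.congr_deriv ?_
      simp
    refine ((h1.exp).const_mul _).congr_deriv ?_
    field_simp
  have := integral_mul_deriv_eq_deriv_mul_of_integrable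
    (u := gaussianPDFReal 0 v) (u' := fun x => -(x / v) * gaussianPDFReal 0 v x)
    (v := fun x => p.eval x) (v' := fun x => p.derivative.eval x)
    (fun x _ => hd x) (fun x _ => p.hasDerivAt x) (hintg _) ?_ (hintg _)
  · rw [this, ← integral_neg, ← integral_const_mul]
    congr 1; ext x; field_simp
  · have := (hintg (X * p)).const_mul (-(1 / (v:ℝ)))
    refine this.congr (ae_of_all _ fun x => ?_)
    simp; ring

theorem stein_prod {n : ℕ} (v : NNReal) (hv : v ≠ 0) (c b : Fin (n + 1) → ℝ) :
    ∫ x, x * ∏ j, (c j + b j * x) ∂(gaussianReal 0 v)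
      = v * ∑ j, b j * ∫ x, ∏ i, (c (j.succAbove i) + b (j.succAbove i) * x)
          ∂(gaussianReal 0 v) := by
  classical
  have h := stein_poly v hv (∏ j, (Polynomial.C (c j) + Polynomial.C (b j) * Polynomial.X))
  simp only [Polynomial.eval_prod, Polynomial.eval_add, Polynomial.eval_C, Polynomial.eval_mul,
    Polynomial.eval_X] at h
  rw [h, Polynomial.derivative_prod_finset]
  simp only [Polynomial.eval_finsetSum, Polynomial.eval_mul, Polynomial.eval_prod,
    Polynomial.eval_add, Polynomial.eval_C, Polynomial.eval_X, Polynomial.derivative_add,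
    Polynomial.derivative_C, Polynomial.derivative_mul, Polynomial.derivative_X, zero_mul, mul_one,
    zero_add]
  have e : ∀ (j : Fin (n + 1)) (f : Fin (n + 1) → ℝ),
      ∏ i ∈ Finset.univ.erase j, f i = ∏ i, f (j.succAbove i) := by
    intro j f
    have : Finset.univ.erase j = (Finset.univ : Finset (Fin n)).map (Fin.succAboveEmb j) := by
      ext x
      simp only [Finset.mem_erase, Finset.mem_univ, and_true, Finset.mem_map, true_and]
      constructor
      · intro hx
        obtain ⟨y, hy⟩ := Fin.exists_succAbove_eq hx
        exact ⟨y, hy⟩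
      · rintro ⟨y, rfl⟩
        exact Fin.succAbove_ne j y
    rw [this, Finset.prod_map]; rfl
  simp only [e]
  rw [integral_finsetSum]
  · congr 1
    refine Finset.sum_congr rfl fun j _ => ?_
    rw [integral_mul_const, mul_comm]
  · intro j _
    have := integrable_poly_gaussian v
      (∏ i, (Polynomial.C (c (j.succAbove i)) + Polynomial.C (b (j.succAbove i)) * Polynomial.X))
    simp only [Polynomial.eval_prod, Polynomial.eval_add, Polynomial.eval_C, Polynomial.eval_mul,
      Polynomial.eval_X] at this
    exact this.mul_const _

theorem abs_prod_le {n : ℕ} (x : Fin n → ℝ) : |∏ i, x i| ≤ 1 + ∑ i, |x i| ^ n := by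
  rw [Finset.abs_prod]
  rcases Nat.eq_zero_or_pos n with rfl | hn
  · simp
  · have : Nonempty (Fin n) := ⟨⟨0, hn⟩⟩
    obtain ⟨j, -, hj⟩ := Finset.exists_max_image Finset.univ (fun i => |x i|)
      Finset.univ_nonempty
    calc ∏ i, |x i| ≤ ∏ _i : Fin n, |x j| :=
          Finset.prod_le_prod (fun i _ => abs_nonneg _) fun i _ => hj i (Finset.mem_univ _)
      _ = |x j| ^ n := by simp
      _ ≤ ∑ i, |x i| ^ n :=
          Finset.single_le_sum (f := fun i => |x i| ^ n) (fun i _ => by positivity)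
            (Finset.mem_univ j)
      _ ≤ _ := by linarith

variable {Ω : Type*} [MeasurableSpace Ω] {P : Measure Ω} [IsProbabilityMeasure P]

theorem gauss_pow_integrable {f : Ω → ℝ} (h : HasGaussianLaw f P) (n : ℕ) :
    Integrable (fun ω => |f ω| ^ n) P := by
  have := h.memLp (p := (n : ENNReal)) (by simp)
  rcases Nat.eq_zero_or_pos n with rfl | hn
  · simp
  · simpa using this.integrable_norm_pow (by exact_mod_cast hn.ne')

theorem gauss_prod_integrable {n : ℕ} {f : Fin n → Ω → ℝ} (h : ∀ i, HasGaussianLaw (f i) P) :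
    Integrable (fun ω => ∏ i, f i ω) P := by
  refine Integrable.mono' (g := fun ω => 1 + ∑ i, |f i ω| ^ n) ?_ ?_ (ae_of_all _ fun ω => ?_)
  · exact (integrable_const _).add (integrable_finsetSum _ fun i _ => gauss_pow_integrable (h i) n)
  · exact (Finset.aemeasurable_fun_prod _ fun i _ => (h i).aemeasurable).aestronglyMeasurable
  · exact abs_prod_le _

theorem isserlis {n : ℕ} (ξ : Fin (n + 2) → Ω → ℝ) (hξ : HasGaussianLaw (fun ω i => ξ i ω) P)
    (h0 : ∀ i, ∫ ω, ξ i ω ∂P = 0) :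
    ∫ ω, ∏ i, ξ i ω ∂P = ∑ j : Fin (n + 1), (∫ ω, ξ 0 ω * ξ j.succ ω ∂P) *
      ∫ ω, ∏ i, ξ (j.succAbove i).succ ω ∂P := by
  have hg : ∀ i, HasGaussianLaw (ξ i) P := fun i => hξ.eval i
  set σ : ℝ := ∫ ω, ξ 0 ω ^ 2 ∂P with hσ
  have hi2 : ∀ i, MemLp (ξ i) 2 P := fun i => (hg i).memLp_two
  by_cases hs : σ = 0
  · have hz : ξ 0 =ᵐ[P] 0 := by
      rw [hσ, integral_eq_zero_iff_of_nonneg (fun ω => sq_nonneg _) (hi2 0).integrable_sq] at hs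
      filter_upwards [hs] with ω h
      simpa using h
    have e1 : ∀ j : Fin (n + 1), ∫ ω, ξ 0 ω * ξ j.succ ω ∂P = 0 := fun j => by
      rw [integral_congr_ae (g := fun _ => 0)]
      · simp
      · filter_upwards [hz] with ω h; simp [h]
    simp only [e1, zero_mul, Finset.sum_const_zero]
    rw [integral_congr_ae (g := fun _ => 0)]
    · simp
    · filter_upwards [hz] with ω h; simp [Fin.prod_univ_succ, h]
  · set b : Fin (n + 1) → ℝ := fun j => (∫ ω, ξ 0 ω * ξ j.succ ω ∂P) / σ with hb
    set η : Fin (n + 1) → Ω → ℝ := fun j ω => ξ j.succ ω - b j * ξ 0 ω with hη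
    have hmul : ∀ i j, Integrable (fun ω => ξ i ω * ξ j ω) P := fun i j =>
      (hi2 i).integrable_mul (hi2 j)
    have hJ : HasGaussianLaw (fun ω => ((fun _ : Fin 1 => ξ 0 ω), fun j => η j ω)) P := by
      let L : (Fin (n + 2) → ℝ) →L[ℝ] (Fin 1 → ℝ) × (Fin (n + 1) → ℝ) :=
        (ContinuousLinearMap.pi fun _ => ContinuousLinearMap.proj 0).prod
          (ContinuousLinearMap.pi fun j => ContinuousLinearMap.proj j.succ -
            b j • ContinuousLinearMap.proj 0)
      exact hξ.map_fun L
    have hind : IndepFun (fun ω (_ : Fin 1) => ξ 0 ω) (fun ω j => η j ω) P := by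
      refine HasGaussianLaw.indepFun_of_covariance_eval (X := fun _ => ξ 0) (Y := η) hJ ?_
      intro _ j
      have mj : MemLp (η j) 2 P := (hi2 j.succ).sub ((hi2 0).const_mul _)
      rw [covariance_eq_sub (hi2 0) mj, h0 0, zero_mul,
        sub_zero]
      have : ∀ ω, (ξ 0 * η j) ω = ξ 0 ω * ξ j.succ ω - b j * (ξ 0 ω ^ 2) := fun ω => by
        simp [hη]; ring
      rw [integral_congr_ae (ae_of_all _ this), integral_sub (hmul _ _)
        ((hi2 0).integrable_sq.const_mul _), integral_const_mul, ← hσ, hb]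
      field_simp; ring
    have hind' : IndepFun (ξ 0) (fun ω j => η j ω) P :=
      hind.comp (φ := fun f : Fin 1 → ℝ => f 0) (ψ := id) (by fun_prop) measurable_id
    have mη : AEMeasurable (fun ω j => η j ω) P := hJ.snd.aemeasurable
    have m0 : AEMeasurable (ξ 0) P := (hg 0).aemeasurable
    have hmap := (indepFun_iff_map_prod_eq_prod_map_map m0 mη).1 hind'
    have hlaw : P.map (ξ 0) = gaussianReal 0 σ.toNNReal := by
      rw [(hg 0).map_eq_gaussianReal, h0 0, variance_eq_sub (hi2 0), h0 0]
      congr 2; simp [hσ]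
    have hσ0 : 0 ≤ σ := integral_nonneg fun ω => sq_nonneg _
    have hσn : σ.toNNReal ≠ 0 := by
      simpa using lt_of_le_of_ne hσ0 (Ne.symm hs)
    have : IsProbabilityMeasure (P.map (fun ω j => η j ω)) := Measure.isProbabilityMeasure_map mη
    have : IsProbabilityMeasure (P.map (ξ 0)) := Measure.isProbabilityMeasure_map m0
    have key : ∀ h : ℝ × (Fin (n + 1) → ℝ) → ℝ, Continuous h →
        Integrable (fun ω => h (ξ 0 ω, fun j => η j ω)) P →
        Integrable (fun y => ∫ x, h (x, y) ∂(gaussianReal 0 σ.toNNReal))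
          (P.map (fun ω j => η j ω)) ∧
        ∫ ω, h (ξ 0 ω, fun j => η j ω) ∂P =
          ∫ y, ∫ x, h (x, y) ∂(gaussianReal 0 σ.toNNReal) ∂(P.map (fun ω j => η j ω)) := by
      intro h hc hi
      have hi' : Integrable h ((P.map (ξ 0)).prod (P.map (fun ω j => η j ω))) := by
        rw [← hmap, integrable_map_measure hc.aestronglyMeasurable (m0.prodMk mη)]
        exact hi
      have e1 : ∫ ω, h (ξ 0 ω, fun j => η j ω) ∂P
          = ∫ q, h q ∂((P.map (ξ 0)).prod (P.map (fun ω j => η j ω))) := by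
        rw [← hmap, integral_map (m0.prodMk mη) hc.aestronglyMeasurable]
      rw [hlaw] at hi' e1
      exact ⟨hi'.integral_prod_right, by rw [e1, integral_prod_symm _ hi']⟩
    have hξη : ∀ j ω, ξ (Fin.succ j) ω = η j ω + b j * ξ 0 ω := fun j ω => by simp [hη]
    have hA := (key (fun q => q.1 * ∏ j, (q.2 j + b j * q.1)) (by fun_prop) (by
      have := gauss_prod_integrable (f := ξ) hg
      refine this.congr (ae_of_all _ fun ω => ?_)
      simp [Fin.prod_univ_succ _, hξη])).2
    have hB := fun j : Fin (n + 1) => key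
      (fun q => ∏ i, (q.2 (j.succAbove i) + b (j.succAbove i) * q.1)) (by fun_prop) (by
      have := gauss_prod_integrable (f := fun i => ξ (j.succAbove i).succ) (fun i => hg _)
      refine this.congr (ae_of_all _ fun ω => ?_)
      simp [hξη])
    have eL : ∫ ω, ∏ i, ξ i ω ∂P = ∫ ω, ξ 0 ω * ∏ j, (η j ω + b j * ξ 0 ω) ∂P := by
      congr 1; ext ω; simp [Fin.prod_univ_succ, hξη]
    rw [eL, hA]
    simp only [stein_prod _ hσn]
    rw [integral_const_mul, integral_finsetSum _ (fun j _ => ((hB j).1.const_mul _)),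
      Finset.mul_sum]
    refine Finset.sum_congr rfl fun j _ => ?_
    rw [integral_const_mul, ← (hB j).2, Real.coe_toNNReal _ hσ0]
    simp only [← hξη]
    simp only [hb]
    field_simp

end Gauss
end KP


namespace KP
section Wick
variable {A ι : Type*} [MeasurableSpace A] (ν : Measure A) [SigmaFinite ν]

theorem wick_step (h : ι → A → ENNReal) (Rk : ι → ι → A → A → ENNReal)
    (M : (n : ℕ) → (Fin n → ι) → (Fin n → A) → ENNReal)
    (hh : ∀ p, Measurable (h p)) (hR : ∀ p q, Measurable (Function.uncurry (Rk p q)))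
    (hM : ∀ n p, Measurable (M n p))
    (hrec : ∀ n (p : Fin (n + 2) → ι) (a : Fin (n + 2) → A), M (n + 2) p a ≤
      ∑ j : Fin (n + 1), Rk (p 0) (p j.succ) (a 0) (a j.succ) *
        M n (fun i => p (j.succAbove i).succ) (fun i => a (j.succAbove i).succ))
    (B Bn : ENNReal) (n : ℕ) (p : Fin (n + 2) → ι)
    (hB : ∀ i j, ∫⁻ x, ∫⁻ y, h (p i) x * h (p j) y * Rk (p i) (p j) x y ∂ν ∂ν ≤ B)
    (ih : ∀ j : Fin (n + 1), ∫⁻ a, (∏ i, h (p (j.succAbove i).succ) (a i)) *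
      M n (fun i => p (j.succAbove i).succ) a ∂(Measure.pi fun _ => ν) ≤ Bn) :
    ∫⁻ a, (∏ i, h (p i) (a i)) * M (n + 2) p a ∂(Measure.pi fun _ => ν)
      ≤ (n + 1) * (B * Bn) := by
  have e1 : ∀ a : Fin (n + 2) → A, (∏ i, h (p i) (a i)) * M (n + 2) p a ≤
      ∑ j : Fin (n + 1), (h (p 0) (a 0) * h (p j.succ) (a j.succ) *
        Rk (p 0) (p j.succ) (a 0) (a j.succ)) *
        ((∏ i : Fin n, h (p (j.succAbove i).succ) (a (j.succAbove i).succ)) *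
        M n (fun i => p (j.succAbove i).succ) (fun i => a (j.succAbove i).succ)) := by
    intro a
    refine (mul_le_mul_right (hrec _ p a) _).trans ?_
    rw [Finset.mul_sum]
    refine Finset.sum_le_sum fun j _ => le_of_eq ?_
    rw [Fin.prod_univ_succ, Fin.prod_univ_succAbove _ j]
    ring
  have mf : ∀ j : Fin (n + 1), Measurable fun q : A × A => h (p 0) q.1 * h (p j.succ) q.2 *
        Rk (p 0) (p j.succ) q.1 q.2 := fun j =>
    (((hh _).comp measurable_fst).mul ((hh _).comp measurable_snd)).mul (hR _ _)
  have mg : ∀ j : Fin (n + 1), Measurable fun r : Fin n → A =>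
        (∏ i : Fin n, h (p (j.succAbove i).succ) (r i)) *
        M n (fun i => p (j.succAbove i).succ) r := fun j =>
    (Finset.measurable_fun_prod _ fun i _ => (hh _).comp (measurable_pi_apply i)).mul (hM _ _)
  have mall : ∀ j : Fin (n + 1), Measurable fun a : Fin (n + 2) → A =>
      (h (p 0) (a 0) * h (p j.succ) (a j.succ) *
        Rk (p 0) (p j.succ) (a 0) (a j.succ)) *
        ((∏ i : Fin n, h (p (j.succAbove i).succ) (a (j.succAbove i).succ)) *
        M n (fun i => p (j.succAbove i).succ) (fun i => a (j.succAbove i).succ)) := by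
    intro j
    have h1 := (mf j).comp (f := fun a : Fin (n + 2) → A => (a 0, a j.succ))
      ((measurable_pi_apply 0).prodMk (measurable_pi_apply j.succ))
    have h2 := (mg j).comp (f := fun (a : Fin (n + 2) → A) i => a (j.succAbove i).succ)
      (measurable_pi_lambda _ fun i => measurable_pi_apply _)
    exact h1.mul h2
  have e2 : ∀ j : Fin (n + 1), ∫⁻ a : Fin (n + 2) → A,
      (h (p 0) (a 0) * h (p j.succ) (a j.succ) *
        Rk (p 0) (p j.succ) (a 0) (a j.succ)) *
        ((∏ i : Fin n, h (p (j.succAbove i).succ) (a (j.succAbove i).succ)) *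
        M n (fun i => p (j.succAbove i).succ) (fun i => a (j.succAbove i).succ))
        ∂(Measure.pi fun _ => ν) ≤ B * Bn := by
    intro j
    have mp1 := (measurePreserving_piFinSuccAbove (fun _ : Fin (n + 2) => ν) 0).symm
    have mp2 := (measurePreserving_piFinSuccAbove (fun _ : Fin (n + 1) => ν) j).symm
    have mp := mp1.comp ((MeasurePreserving.id ν).prod mp2)
    refine (mp.lintegral_comp (mall j)).symm.le.trans ?_
    refine (lintegral_prod _ ((mall j).comp mp.measurable).aemeasurable).le.trans ?_
    have e3 : ∀ x, ∫⁻ q, (fun a : Fin (n + 2) → A =>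
        (h (p 0) (a 0) * h (p j.succ) (a j.succ) *
        Rk (p 0) (p j.succ) (a 0) (a j.succ)) *
        ((∏ i : Fin n, h (p (j.succAbove i).succ) (a (j.succAbove i).succ)) *
        M n (fun i => p (j.succAbove i).succ) (fun i => a (j.succAbove i).succ)))
        (((MeasurableEquiv.piFinSuccAbove (fun _ : Fin (n + 2) => A) 0).symm ∘
          Prod.map id (MeasurableEquiv.piFinSuccAbove (fun _ : Fin (n + 1) => A) j).symm)
            (x, q)) ∂(ν.prod (Measure.pi fun _ => ν))
        = (∫⁻ y, h (p 0) x * h (p j.succ) y * Rk (p 0) (p j.succ) x y ∂ν) *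
          ∫⁻ r, (∏ i : Fin n, h (p (j.succAbove i).succ) (r i)) *
        M n (fun i => p (j.succAbove i).succ) r ∂(Measure.pi fun _ => ν) := by
      intro x
      refine Eq.trans ?_ (lintegral_prod_mul (μ := ν) (ν := Measure.pi fun _ => ν)
        ((mf j).comp (measurable_prodMk_left (x := x))).aemeasurable (mg j).aemeasurable)
      refine lintegral_congr fun q => ?_
      simp [MeasurableEquiv.piFinSuccAbove, Fin.insertNthEquiv, Fin.insertNth_zero]
    refine (lintegral_congr e3).le.trans ?_
    rw [lintegral_mul_const _ (by exact Measurable.lintegral_prod_right' (mf j))]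
    exact mul_le_mul' (hB 0 j.succ) (ih j)
  calc _ ≤ ∑ j : Fin (n + 1), ∫⁻ a : Fin (n + 2) → A,
      (h (p 0) (a 0) * h (p j.succ) (a j.succ) *
        Rk (p 0) (p j.succ) (a 0) (a j.succ)) *
        ((∏ i : Fin n, h (p (j.succAbove i).succ) (a (j.succAbove i).succ)) *
        M n (fun i => p (j.succAbove i).succ) (fun i => a (j.succAbove i).succ))
        ∂(Measure.pi fun _ => ν) := by
        rw [← lintegral_finsetSum _ (fun j _ => mall j)]
        exact lintegral_mono e1
    _ ≤ ∑ j : Fin (n + 1), B * Bn := Finset.sum_le_sum fun j _ => e2 j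
    _ = _ := by simp

theorem wick_bound (h : ι → A → ENNReal) (Rk : ι → ι → A → A → ENNReal)
    (M : (n : ℕ) → (Fin n → ι) → (Fin n → A) → ENNReal)
    (hh : ∀ p, Measurable (h p)) (hR : ∀ p q, Measurable (Function.uncurry (Rk p q)))
    (hM : ∀ n p, Measurable (M n p)) (hM0 : ∀ p a, M 0 p a ≤ 1)
    (hrec : ∀ n (p : Fin (n + 2) → ι) (a : Fin (n + 2) → A), M (n + 2) p a ≤
      ∑ j : Fin (n + 1), Rk (p 0) (p j.succ) (a 0) (a j.succ) *
        M n (fun i => p (j.succAbove i).succ) (fun i => a (j.succAbove i).succ))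
    (B : ENNReal) (m : ℕ) (p : Fin (2 * m) → ι)
    (hB : ∀ i j, ∫⁻ x, ∫⁻ y, h (p i) x * h (p j) y * Rk (p i) (p j) x y ∂ν ∂ν ≤ B) :
    ∫⁻ a, (∏ i, h (p i) (a i)) * M (2 * m) p a ∂(Measure.pi fun _ => ν)
      ≤ (2 * m).factorial * B ^ m := by
  induction m with
  | zero =>
    have : IsEmpty (Fin (2 * 0)) := by simp; infer_instance
    calc _ ≤ ∫⁻ _a : Fin (2 * 0) → A, 1 ∂(Measure.pi fun _ => ν) := by
          refine lintegral_mono fun a => ?_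
          simp only [Finset.univ_eq_empty, Finset.prod_empty, one_mul]
          exact hM0 _ _
      _ ≤ _ := by simp
  | succ m ih =>
    have key := wick_step ν h Rk M hh hR hM hrec B ((2 * m).factorial * B ^ m) (2 * m) p hB
      (fun j => ih _ fun i k => hB _ _)
    refine key.trans ?_
    calc _ = ((2 * m + 1 : ℕ) * (2 * m).factorial : ENNReal) * B ^ (m + 1) := by
          push_cast; ring
      _ ≤ _ := by
        gcongr
        have : (2 * m + 1) * (2 * m).factorial ≤ (2 * (m + 1)).factorial := by
          rw [show 2 * (m + 1) = 2 * m + 2 by ring, Nat.factorial_succ, Nat.factorial_succ]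
          nlinarith [Nat.zero_le ((2 * m + 1) * (2 * m).factorial)]
        exact_mod_cast this

end Wick
end KP


namespace KP

/-- Index of smoothed components: a Schwartz function and a component. -/
abbrev Ix (d : ℕ) := SchwartzMap (Eu d) ℝ × Fin d

/-- Centered Gaussian field with stationary covariance `R`. -/
structure GF {d : ℕ} {Ω : Type*} [MeasurableSpace Ω] (P : Measure Ω)
    (F : Ω → Eu d → Eu d) (R : Eu d → Fin d → Fin d → ℝ) : Prop where
  meas : Measurable (Function.uncurry F)
  gauss : ∀ n (x : Fin n → Eu d) (c : Fin n → Fin d),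
    HasGaussianLaw (fun ω i => F ω (x i) (c i)) P
  mean : ∀ x c, ∫ ω, F ω x c ∂P = 0
  cov : ∀ x y i j, ∫ ω, F ω x i * F ω y j ∂P = R (x - y) i j

section
variable {d : ℕ} {Ω : Type*} [MeasurableSpace Ω] {P : Measure Ω} [IsProbabilityMeasure P]
  {F : Ω → Eu d → Eu d} {R : Eu d → Fin d → Fin d → ℝ}

theorem GF.gauss1 (h : GF P F R) (x : Eu d) (c : Fin d) :
    HasGaussianLaw (fun ω => F ω x c) P :=
  (h.gauss 1 (fun _ => x) (fun _ => c)).eval 0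

theorem GF.meas_comp (h : GF P F R) (x : Eu d) (c : Fin d) :
    Measurable (fun ω => F ω x c) := by
  have := h.meas.comp (measurable_id.prodMk (measurable_const (a := x)))
  exact (EuclideanSpace.proj c : Eu d →L[ℝ] ℝ).continuous.measurable.comp this

theorem GF.law (h : GF P F R) (x : Eu d) (c : Fin d) :
    P.map (fun ω => F ω x c) = gaussianReal 0 (R 0 c c).toNNReal := by
  rw [(h.gauss1 x c).map_eq_gaussianReal, h.mean x c,
    variance_eq_sub (h.gauss1 x c).memLp_two, h.mean x c]
  congr 2
  have := h.cov x x c c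
  rw [sub_self] at this
  rw [← this]
  simp [pow_two]

theorem GF.mom (h : GF P F R) (n : ℕ) : ∃ C : ℝ, 0 ≤ C ∧ ∀ x c, ∫ ω, |F ω x c| ^ n ∂P ≤ C := by
  refine ⟨∑ c, ∫ y, |y| ^ n ∂(gaussianReal 0 (R 0 c c).toNNReal),
    Finset.sum_nonneg fun c _ => integral_nonneg fun y => by positivity, fun x c => ?_⟩
  have e : ∫ ω, |F ω x c| ^ n ∂P = ∫ y, |y| ^ n ∂(gaussianReal 0 (R 0 c c).toNNReal) := by
    rw [← h.law x c, integral_map (h.meas_comp x c).aemeasurable]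
    exact (by fun_prop : Continuous fun y : ℝ => |y| ^ n).aestronglyMeasurable
  rw [e]
  exact Finset.single_le_sum (f := fun c => ∫ y, |y| ^ n ∂(gaussianReal 0 (R 0 c c).toNNReal))
    (fun c _ => integral_nonneg fun y => by positivity) (Finset.mem_univ c)

theorem GF.prod_integrable (h : GF P F R) {n : ℕ} (x : Fin n → Eu d) (c : Fin n → Fin d) :
    Integrable (fun ω => ∏ i, F ω (x i) (c i)) P :=
  gauss_prod_integrable fun i => h.gauss1 (x i) (c i)

theorem GF.prod_mom (h : GF P F R) (n : ℕ) : ∃ C : ℝ, 0 ≤ C ∧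
    ∀ (x : Fin n → Eu d) (c : Fin n → Fin d), ∫ ω, |∏ i, F ω (x i) (c i)| ∂P ≤ C := by
  obtain ⟨C, hC0, hC⟩ := h.mom n
  refine ⟨1 + n * C, by positivity, fun x c => ?_⟩
  calc _ ≤ ∫ ω, (1 + ∑ i, |F ω (x i) (c i)| ^ n) ∂P := by
        refine integral_mono (h.prod_integrable x c).abs ?_ fun ω => abs_prod_le _
        exact (integrable_const _).add
          (integrable_finsetSum _ fun i _ => gauss_pow_integrable (h.gauss1 _ _) n)
    _ = 1 + ∑ i, ∫ ω, |F ω (x i) (c i)| ^ n ∂P := by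
        rw [integral_add (integrable_const _)
          (integrable_finsetSum _ fun i _ => gauss_pow_integrable (h.gauss1 _ _) n),
          integral_finsetSum _ fun i _ => gauss_pow_integrable (h.gauss1 _ _) n]
        simp
    _ ≤ 1 + ∑ _i : Fin n, C := by gcongr with i; exact hC _ _
    _ = _ := by simp

theorem GF.R_bdd (h : GF P F R) : ∃ C : ℝ, 0 ≤ C ∧ ∀ x i j, |R x i j| ≤ C := by
  obtain ⟨C, hC0, hC⟩ := h.prod_mom 2
  refine ⟨C, hC0, fun x i j => ?_⟩
  have e := h.cov x 0 i j
  rw [sub_zero] at e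
  rw [← e]
  refine (abs_integral_le_integral_abs).trans ?_
  simpa [Fin.prod_univ_two] using hC ![x, 0] ![i, j]

theorem GF.joint (h : GF P F R) {A : Type*} [MeasurableSpace A] {g : A → Eu d} (hg : Measurable g)
    (c : Fin d) : Measurable fun q : Ω × A => F q.1 (g q.2) c := by
  have := h.meas.comp (measurable_fst.prodMk (hg.comp measurable_snd) :
    Measurable fun q : Ω × A => (q.1, g q.2))
  exact (EuclideanSpace.proj c : Eu d →L[ℝ] ℝ).continuous.measurable.comp this

theorem GF.R_meas (h : GF P F R) (i j : Fin d) : Measurable fun x => R x i j := by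
  have e : (fun x => R x i j) = fun x => ∫ ω, F ω x i * F ω 0 j ∂P := by
    ext x; rw [h.cov, sub_zero]
  rw [e]
  have h1 : Measurable fun q : Eu d × Ω => F q.2 q.1 i * F q.2 0 j :=
    ((h.joint measurable_id i).comp measurable_swap).mul ((h.meas_comp 0 j).comp measurable_snd)
  exact (h1.stronglyMeasurable.integral_prod_right').measurable

end
end KP


namespace KP

section
variable {d : ℕ}

/-- Reference measure for times and smoothing positions. -/
noncomputable def nu (d : ℕ) (s0 s1 : ℝ) : Measure (ℝ × Eu d) :=
  (volume.restrict (Ioc s0 s1)).prod volume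

noncomputable instance (s0 s1 : ℝ) : SigmaFinite (nu d s0 s1) := by
  unfold nu; infer_instance

/-- Simplex indicator. -/
noncomputable def kn (d : ℕ) : (n : ℕ) → ℝ → (Fin n → ℝ × Eu d) → ℝ
  | 0, _, _ => 1
  | n + 1, s, a => if (a 0).1 ≤ s then kn d n (a 0).1 (fun i => a i.succ) else 0

theorem kn_abs_le (n : ℕ) (s : ℝ) (a : Fin n → ℝ × Eu d) : |kn d n s a| ≤ 1 := by
  induction n generalizing s with
  | zero => simp [kn]
  | succ n ih => simp only [kn]; split_ifs; exacts [ih _ _, by simp]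

theorem kn_meas (n : ℕ) :
    Measurable (fun q : ℝ × (Fin n → ℝ × Eu d) => kn d n q.1 q.2) := by
  induction n with
  | zero => simp only [kn]; exact measurable_const
  | succ n ih =>
    simp only [kn]
    refine Measurable.ite ?_ ?_ measurable_const
    · exact measurableSet_le (by fun_prop) measurable_fst
    · exact ih.comp (f := fun q : ℝ × (Fin (n+1) → ℝ × Eu d) =>
        ((q.2 0).1, fun i : Fin n => q.2 i.succ)) (by fun_prop)

/-- Integrand. -/
noncomputable def Ph (v : Eu d) (f : Eu d → Eu d) {n : ℕ} (p : Fin n → Ix d) (z : Eu d)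
    (a : Fin n → ℝ × Eu d) : ℝ :=
  ∏ i, ((p i).1 (a i).2 * f (z + (a i).1 • v - (a i).2) (p i).2)

/-- Kernel representation of the iterated integrals. -/
noncomputable def Jr (v : Eu d) (s0 s1 : ℝ) (f : Eu d → Eu d) {n : ℕ} (p : Fin n → Ix d)
    (s : ℝ) (z : Eu d) : ℝ :=
  ∫ a, kn d n s a * Ph v f p z a ∂(Measure.pi fun _ => nu d s0 s1)

/-- Smoothed components. -/
noncomputable def Gs (f : Eu d → Eu d) (p : Ix d) (x : Eu d) : ℝ :=
  ∫ u, p.1 u * f (x - u) p.2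

theorem Ph_integrable (v : Eu d) (s0 s1 : ℝ) (f : Eu d → Eu d)
    (hf : ∀ (p : Ix d) z, Integrable (fun a : ℝ × Eu d => p.1 a.2 * f (z + a.1 • v - a.2) p.2)
      (nu d s0 s1)) {n : ℕ} (p : Fin n → Ix d) (z : Eu d) :
    Integrable (Ph v f p z) (Measure.pi fun _ => nu d s0 s1) := by
  unfold Ph
  exact Integrable.fintype_prod (f := fun i (a : ℝ × Eu d) =>
    (p i).1 a.2 * f (z + a.1 • v - a.2) (p i).2) fun i => hf (p i) z

theorem kPh_integrable (v : Eu d) (s0 s1 : ℝ) (f : Eu d → Eu d)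
    (hf : ∀ (p : Ix d) z, Integrable (fun a : ℝ × Eu d => p.1 a.2 * f (z + a.1 • v - a.2) p.2)
      (nu d s0 s1)) {n : ℕ} (p : Fin n → Ix d) (s : ℝ) (z : Eu d) :
    Integrable (fun a => kn d n s a * Ph v f p z a) (Measure.pi fun _ => nu d s0 s1) := by
  refine (Ph_integrable v s0 s1 f hf p z).bdd_mul (c := 1) ?_ (ae_of_all _ fun a => ?_)
  · exact ((kn_meas n).comp (f := fun a => (s, a)) (by fun_prop)).aestronglyMeasurable
  · exact kn_abs_le _ _ _

theorem Jw_eq_Jr (v : Eu d) (s0 s1 : ℝ) (f : Eu d → Eu d)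
    (hf : ∀ (p : Ix d) z, Integrable (fun a : ℝ × Eu d => p.1 a.2 * f (z + a.1 • v - a.2) p.2)
      (nu d s0 s1)) {n : ℕ} (p : Fin n → Ix d) (s : ℝ) (hs : s ∈ Icc s0 s1) (z : Eu d) :
    Jw (Gs f) v s0 (List.ofFn p) s z = Jr v s0 s1 f p s z := by
  induction n generalizing s with
  | zero =>
    have : (Measure.pi fun _ : Fin 0 => nu d s0 s1).real univ = 1 := by
      simp [Measure.real, Measure.pi_univ]
    simp [Jr, Jw, kn, Ph, this]
  | succ n ih =>
    rw [List.ofFn_succ, Jw, intervalIntegral.integral_of_le hs.1]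
    have e1 : ∫ r in Ioc s0 s, Gs f (p 0) (z + r • v) * Jw (Gs f) v s0
        (List.ofFn fun i => p i.succ) r z
        = ∫ r in Ioc s0 s1, (Iic s).indicator (fun r => Gs f (p 0) (z + r • v) *
          Jr v s0 s1 f (fun i => p i.succ) r z) r := by
      rw [setIntegral_indicator measurableSet_Iic]
      have : Ioc s0 s1 ∩ Iic s = Ioc s0 s := by
        ext r; simp only [mem_inter_iff, mem_Ioc, mem_Iic]
        constructor
        · rintro ⟨⟨h1, h2⟩, h3⟩; exact ⟨h1, h3⟩
        · rintro ⟨h1, h2⟩; exact ⟨⟨h1, h2.trans hs.2⟩, h2⟩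
      rw [this]
      refine setIntegral_congr_fun measurableSet_Ioc fun r hr => ?_
      rw [ih (fun i => p i.succ) r ⟨hr.1.le, hr.2.trans hs.2⟩]
    rw [e1]
    have mp := (measurePreserving_piFinSuccAbove (fun _ : Fin (n + 1) => nu d s0 s1) 0).symm
    have hi := kPh_integrable v s0 s1 f hf p s z
    have e2 : Jr v s0 s1 f p s z = ∫ q, kn d (n + 1) s
        ((MeasurableEquiv.piFinSuccAbove (fun _ : Fin (n + 1) => ℝ × Eu d) 0).symm q) *
        Ph v f p z ((MeasurableEquiv.piFinSuccAbove (fun _ : Fin (n + 1) => ℝ × Eu d) 0).symm q)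
        ∂((nu d s0 s1).prod (Measure.pi fun _ => nu d s0 s1)) := by
      rw [Jr]
      exact (mp.integral_comp (MeasurableEquiv.measurableEmbedding _)
        (fun a => kn d (n + 1) s a * Ph v f p z a)).symm
    have hi2 := (mp.integrable_comp_of_integrable hi)
    have e3 : ∀ (x : ℝ × Eu d) (r : Fin n → ℝ × Eu d), kn d (n + 1) s
        ((MeasurableEquiv.piFinSuccAbove (fun _ : Fin (n + 1) => ℝ × Eu d) 0).symm (x, r)) *
        Ph v f p z
          ((MeasurableEquiv.piFinSuccAbove (fun _ : Fin (n + 1) => ℝ × Eu d) 0).symm (x, r))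
        = ((Iic s).indicator (fun _ => 1) x.1 * ((p 0).1 x.2 * f (z + x.1 • v - x.2) (p 0).2)) *
          (kn d n x.1 r * Ph v f (fun i => p i.succ) z r) := by
      intro x r
      simp only [MeasurableEquiv.piFinSuccAbove, kn, Ph, Fin.prod_univ_succ, Fin.insertNthEquiv,
        indicator, mem_Iic]
      simp
      split_ifs
      · ring
      · rfl
    rw [e2]
    refine Eq.trans ?_ (integral_prod _ hi2).symm
    have e4 : ∀ x : ℝ × Eu d, ∫ r, kn d (n + 1) s
        ((MeasurableEquiv.piFinSuccAbove (fun _ : Fin (n + 1) => ℝ × Eu d) 0).symm (x, r)) *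
        Ph v f p z
          ((MeasurableEquiv.piFinSuccAbove (fun _ : Fin (n + 1) => ℝ × Eu d) 0).symm (x, r))
          ∂(Measure.pi fun _ => nu d s0 s1)
        = ((Iic s).indicator (fun _ => 1) x.1 * ((p 0).1 x.2 * f (z + x.1 • v - x.2) (p 0).2)) *
          Jr v s0 s1 f (fun i => p i.succ) x.1 z := by
      intro x
      simp only [e3]
      rw [integral_const_mul]; rfl
    have hi3 := hi2.integral_prod_left
    simp only [Function.comp, e4] at hi3 ⊢
    unfold nu at hi3
    conv_rhs => unfold nu
    rw [integral_prod _ hi3]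
    refine integral_congr_ae (ae_of_all _ fun r => ?_)
    simp only
    rw [integral_mul_const, integral_const_mul]
    by_cases h : r ∈ Iic s
    · simp [indicator_of_mem h, Gs, nu]
    · simp [indicator_of_notMem h]

end
end KP


namespace KP

section
variable {d : ℕ} {Ω : Type*} [MeasurableSpace Ω] {P : Measure Ω} [IsProbabilityMeasure P]
  {F : Ω → Eu d → Eu d} {R : Eu d → Fin d → Fin d → ℝ}

theorem psi_integrable (s0 s1 : ℝ) (p : Ix d) :
    Integrable (fun a : ℝ × Eu d => p.1 a.2) (nu d s0 s1) := by
  unfold nu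
  have h := (integrable_const (1:ℝ) (μ := volume.restrict (Ioc s0 s1))).mul_prod
    (p.1.integrable (μ := volume))
  simpa using h

theorem Ph_split (v : Eu d) (f : Eu d → Eu d) {n : ℕ} (p : Fin n → Ix d) (z : Eu d)
    (a : Fin n → ℝ × Eu d) : Ph v f p z a = (∏ i, (p i).1 (a i).2) *
      ∏ i, f (z + (a i).1 • v - (a i).2) (p i).2 := Finset.prod_mul_distrib

theorem GF.Fprod_meas (h : GF P F R) (v : Eu d) {m : ℕ} (q : Fin m → Ix d) :
    Measurable fun x : Ω × (Eu d × (Fin m → ℝ × Eu d)) =>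
      ∏ i, F x.1 (x.2.1 + (x.2.2 i).1 • v - (x.2.2 i).2) (q i).2 := by
  refine Finset.measurable_fun_prod _ fun i _ => ?_
  exact h.joint (g := fun y : Eu d × (Fin m → ℝ × Eu d) => y.1 + (y.2 i).1 • v - (y.2 i).2)
    (by fun_prop) _

theorem psi_prod_meas {m : ℕ} (q : Fin m → Ix d) :
    Measurable fun a : Fin m → ℝ × Eu d => ∏ i, (q i).1 (a i).2 :=
  Finset.measurable_fun_prod _ fun i _ => (q i).1.continuous.measurable.comp (by fun_prop)

theorem GF.Ph_meas (h : GF P F R) (v : Eu d) {m : ℕ} (q : Fin m → Ix d) :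
    Measurable fun x : Ω × (Eu d × (Fin m → ℝ × Eu d)) => Ph v (F x.1) q x.2.1 x.2.2 := by
  simp only [Ph_split]
  exact ((psi_prod_meas q).comp (f := fun x : Ω × (Eu d × (Fin m → ℝ × Eu d)) => x.2.2)
    (by fun_prop)).mul (h.Fprod_meas v q)

theorem GF.Ph_joint (h : GF P F R) (v : Eu d) (s0 s1 : ℝ) {m : ℕ} (q : Fin m → Ix d)
    (z : Eu d) (K : (Fin m → ℝ × Eu d) → ℝ) (hK : Measurable K) (hK1 : ∀ a, |K a| ≤ 1) :
    Integrable (fun x : Ω × (Fin m → ℝ × Eu d) => K x.2 * Ph v (F x.1) q z x.2)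
      (P.prod (Measure.pi fun _ => nu d s0 s1)) := by
  obtain ⟨C, hC0, hC⟩ := h.prod_mom m
  have hm : Measurable (fun x : Ω × (Fin m → ℝ × Eu d) => K x.2 * Ph v (F x.1) q z x.2) :=
    (hK.comp measurable_snd).mul ((h.Ph_meas v q).comp
      (f := fun x : Ω × (Fin m → ℝ × Eu d) => (x.1, z, x.2)) (by fun_prop))
  rw [integrable_prod_iff' hm.aestronglyMeasurable]
  have hi : ∀ a : Fin m → ℝ × Eu d, Integrable (fun ω => K a * Ph v (F ω) q z a) P := by
    intro a
    simp only [Ph_split]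
    exact ((h.prod_integrable _ _).const_mul _).const_mul _
  refine ⟨ae_of_all _ hi, ?_⟩
  have hg : Integrable (fun a : Fin m → ℝ × Eu d => C * ∏ i, ‖(q i).1 (a i).2‖)
      (Measure.pi fun _ => nu d s0 s1) :=
    (Integrable.fintype_prod (f := fun i (a : ℝ × Eu d) => ‖(q i).1 a.2‖)
      fun i => (psi_integrable s0 s1 (q i)).norm).const_mul C
  refine hg.mono' ?_ (ae_of_all _ fun a => ?_)
  · exact ((hm.comp measurable_swap).norm.stronglyMeasurable.integral_prod_right').aestronglyMeasurable
  · rw [Real.norm_eq_abs, abs_of_nonneg (integral_nonneg fun ω => norm_nonneg _)]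
    calc _ ≤ ∫ ω, (∏ i, ‖(q i).1 (a i).2‖) *
          |∏ i, F ω (z + (a i).1 • v - (a i).2) (q i).2| ∂P := by
          refine integral_mono (hi a).norm ((h.prod_integrable _ _).abs.const_mul _) fun ω => ?_
          simp only [norm_mul, Ph_split, norm_prod, Finset.abs_prod, Real.norm_eq_abs]
          refine mul_le_of_le_one_left (by positivity) (hK1 a)
      _ ≤ _ := by
          rw [integral_const_mul, mul_comm]
          gcongr
          exact hC _ _

theorem GF.E_bound (h : GF P F R) (v : Eu d) (s0 s1 : ℝ) {m : ℕ} (q : Fin (2 * m) → Ix d)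
    (z : Eu d) (K : (Fin (2 * m) → ℝ × Eu d) → ℝ) (hK : Measurable K) (hK1 : ∀ a, |K a| ≤ 1)
    (B : ENNReal) (hB : ∀ i j, ∫⁻ x, ∫⁻ y, ‖(q i).1 x.2‖ₑ * ‖(q j).1 y.2‖ₑ *
      ‖R (x.1 • v - x.2 - (y.1 • v - y.2)) (q i).2 (q j).2‖ₑ ∂(nu d s0 s1) ∂(nu d s0 s1) ≤ B) :
    ‖∫ ω, ∫ a, K a * Ph v (F ω) q z a ∂(Measure.pi fun _ => nu d s0 s1) ∂P‖ₑ
      ≤ (2 * m).factorial * B ^ m := by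
  rw [integral_integral_swap (h.Ph_joint v s0 s1 q z K hK hK1)]
  refine (enorm_integral_le_lintegral_enorm _).trans ?_
  have key := wick_bound (nu d s0 s1) (ι := Ix d) (fun p a => ‖p.1 a.2‖ₑ)
    (fun p p' x y => ‖R (x.1 • v - x.2 - (y.1 • v - y.2)) p.2 p'.2‖ₑ)
    (fun n p a => ‖∫ ω, ∏ i, F ω (z + (a i).1 • v - (a i).2) (p i).2 ∂P‖ₑ)
    (fun p => (p.1.continuous.measurable.comp measurable_snd).enorm)
    (fun p p' => ((h.R_meas p.2 p'.2).comp (f := fun x : (ℝ × Eu d) × (ℝ × Eu d) =>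
      (x.1.1 • v - x.1.2 - (x.2.1 • v - x.2.2))) (by fun_prop)).enorm)
    (fun n p => by
      have := (h.Fprod_meas v p).comp (f := fun x : (Fin n → ℝ × Eu d) × Ω =>
        (x.2, z, x.1)) (by fun_prop)
      exact (this.stronglyMeasurable.integral_prod_right').measurable.enorm)
    (fun p a => by simp)
    (fun n p a => by
      rw [isserlis (fun i ω => F ω (z + (a i).1 • v - (a i).2) (p i).2) (h.gauss _ _ _)
        (fun i => h.mean _ _)]
      refine (enorm_sum_le _ _).trans (Finset.sum_le_sum fun j _ => ?_)
      rw [enorm_mul, h.cov]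
      have e : z + (a 0).1 • v - (a 0).2 - (z + (a j.succ).1 • v - (a j.succ).2)
        = (a 0).1 • v - (a 0).2 - ((a j.succ).1 • v - (a j.succ).2) := by abel
      rw [e]) B m q hB
  refine le_trans (lintegral_mono fun a => ?_) key
  simp only [Ph_split]
  rw [integral_const_mul, integral_const_mul, enorm_mul, enorm_mul]
  have h1 : ‖K a‖ₑ ≤ 1 := by
    rw [← ofReal_norm, Real.norm_eq_abs]
    exact ENNReal.ofReal_le_one.2 (hK1 a)
  have h2 : ‖∏ i, (q i).1 (a i).2‖ₑ = ∏ i, ‖(q i).1 (a i).2‖ₑ := by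
    rw [← ofReal_norm, norm_prod, ENNReal.ofReal_prod_of_nonneg fun i _ => norm_nonneg _]
    simp only [ofReal_norm]
  rw [h2]
  exact mul_le_of_le_one_left (by positivity) h1

/-- Joining two index blocks. -/
def ee (n : ℕ) : Fin n ⊕ Fin n ≃ Fin (2 * n) := finSumFinEquiv.trans (finCongr (two_mul n).symm)

theorem mp_ee (ν : Measure (ℝ × Eu d)) [SigmaFinite ν] (n : ℕ) :
    MeasurePreserving (fun c : Fin (2 * n) → ℝ × Eu d =>
      ((fun i => c (ee n (Sum.inl i))), (fun i => c (ee n (Sum.inr i)))))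
      (Measure.pi fun _ => ν) ((Measure.pi fun _ => ν).prod (Measure.pi fun _ => ν)) := by
  have h1 := (measurePreserving_piCongrLeft (fun _ : Fin (2 * n) => ν) (ee n)).symm
  have h2 := measurePreserving_sumPiEquivProdPi (fun _ : Fin n ⊕ Fin n => ν)
  exact h2.comp h1

theorem GF.Jr_sq (h : GF P F R) (v : Eu d) (s0 s1 : ℝ) {n : ℕ} (p : Fin n → Ix d)
    (s : ℝ) (z : Eu d) (B : ENNReal)
    (hB : ∀ i j, ∫⁻ x, ∫⁻ y, ‖(p i).1 x.2‖ₑ * ‖(p j).1 y.2‖ₑ *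
      ‖R (x.1 • v - x.2 - (y.1 • v - y.2)) (p i).2 (p j).2‖ₑ ∂(nu d s0 s1) ∂(nu d s0 s1) ≤ B) :
    ∫⁻ ω, ENNReal.ofReal (Jr v s0 s1 (F ω) p s z ^ 2) ∂P ≤ (2 * n).factorial * B ^ n := by
  set q : Fin (2 * n) → Ix d := fun i => Sum.elim p p ((ee n).symm i) with hq
  set K : (Fin (2 * n) → ℝ × Eu d) → ℝ := fun c =>
    kn d n s (fun i => c (ee n (Sum.inl i))) * kn d n s (fun i => c (ee n (Sum.inr i))) with hK
  have hKm : Measurable K :=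
    ((kn_meas n).comp (f := fun c : Fin (2 * n) → ℝ × Eu d =>
      (s, fun i => c (ee n (Sum.inl i)))) (by fun_prop)).mul
    ((kn_meas n).comp (f := fun c : Fin (2 * n) → ℝ × Eu d =>
      (s, fun i => c (ee n (Sum.inr i)))) (by fun_prop))
  have hK1 : ∀ c, |K c| ≤ 1 := fun c => by
    rw [hK]; simp only [abs_mul]
    exact mul_le_one₀ (kn_abs_le _ _ _) (abs_nonneg _) (kn_abs_le _ _ _)
  have hPh : ∀ f c, Ph v f q z c = Ph v f p z (fun i => c (ee n (Sum.inl i))) *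
      Ph v f p z (fun i => c (ee n (Sum.inr i))) := by
    intro f c
    unfold Ph
    rw [← Equiv.prod_comp (ee n), Fintype.prod_sum_type]
    simp [hq]
  have hJ : ∀ ω, Jr v s0 s1 (F ω) p s z ^ 2 =
      ∫ c, K c * Ph v (F ω) q z c ∂(Measure.pi fun _ => nu d s0 s1) := by
    intro ω
    rw [pow_two, Jr, ← integral_prod_mul, ← (mp_ee (nu d s0 s1) n).map_eq,
      integral_map (mp_ee (nu d s0 s1) n).measurable.aemeasurable]
    · refine integral_congr_ae (ae_of_all _ fun c => ?_)
      simp only [hPh, hK]; ring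
    · have m1 : Measurable fun a : Fin n → ℝ × Eu d => kn d n s a * Ph v (F ω) p z a :=
        ((kn_meas n).comp (f := fun a => (s, a)) (by fun_prop)).mul
          ((h.Ph_meas v p).comp (f := fun a => (ω, z, a)) (by fun_prop))
      exact ((m1.comp measurable_fst).mul (m1.comp measurable_snd)).aestronglyMeasurable
  have hintg := (h.Ph_joint v s0 s1 q z K hKm hK1).integral_prod_left
  simp only [hJ]
  rw [← ofReal_integral_eq_lintegral_ofReal hintg
    (ae_of_all _ fun ω => by simp only [← hJ]; exact sq_nonneg _)]
  refine le_trans ?_ (h.E_bound v s0 s1 q z K hKm hK1 B ?_)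
  · rw [← ofReal_norm]
    exact ENNReal.ofReal_le_ofReal (le_abs_self _)
  · intro i j
    have : ∀ i, ∃ i', q i = p i' := by
      intro i
      rcases hh : (ee n).symm i with k | k <;> exact ⟨k, by simp [hq, hh]⟩
    obtain ⟨i', hi'⟩ := this i
    obtain ⟨j', hj'⟩ := this j
    rw [hi', hj']
    exact hB i' j'

theorem GF.Jr_meas (h : GF P F R) (v : Eu d) (s0 s1 : ℝ) {n : ℕ} (p : Fin n → Ix d) (z : Eu d) :
    Measurable fun x : Ω × ℝ => Jr v s0 s1 (F x.1) p x.2 z := by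
  have m1 : Measurable fun y : (Ω × ℝ) × (Fin n → ℝ × Eu d) =>
      kn d n y.1.2 y.2 * Ph v (F y.1.1) p z y.2 :=
    ((kn_meas n).comp (f := fun y : (Ω × ℝ) × (Fin n → ℝ × Eu d) => (y.1.2, y.2))
      (by fun_prop)).mul ((h.Ph_meas v p).comp
      (f := fun y : (Ω × ℝ) × (Fin n → ℝ × Eu d) => (y.1.1, z, y.2)) (by fun_prop))
  exact (m1.stronglyMeasurable.integral_prod_right').measurable

end
end KP


namespace KP

/-- Logarithmic bound for line integrals of the covariance. -/
def LineBound {d : ℕ} (R : Eu d → Fin d → Fin d → ℝ) (v : Eu d) (C : ℝ) : Prop :=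
  ∀ (w : Eu d) (i j : Fin d) (p q τ : ℝ), 1 ≤ τ → q - p ≤ τ →
    ∫⁻ r in Ioc p q, ‖R (r • v + w) i j‖ₑ ≤ ENNReal.ofReal (C * (1 + Real.log τ))

section
variable {d : ℕ} {Ω : Type*} [MeasurableSpace Ω] {P : Measure Ω} [IsProbabilityMeasure P]
  {F : Ω → Eu d → Eu d} {R : Eu d → Fin d → Fin d → ℝ}

theorem GF.R_neg (h : GF P F R) (x : Eu d) (i j : Fin d) : R (-x) i j = R x j i := by
  have h1 := h.cov 0 x i j
  have h2 := h.cov x 0 j i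
  rw [zero_sub] at h1; rw [sub_zero] at h2
  rw [← h1, ← h2]; simp only [mul_comm]

theorem GF.B_bound (h : GF P F R) (v : Eu d) (C : ℝ) (hL : LineBound R v C) (s0 s1 : ℝ)
    (hs : 1 ≤ s1 - s0) (p p' : Ix d) :
    ∫⁻ x, ∫⁻ y, ‖p.1 x.2‖ₑ * ‖p'.1 y.2‖ₑ *
      ‖R (x.1 • v - x.2 - (y.1 • v - y.2)) p.2 p'.2‖ₑ ∂(nu d s0 s1) ∂(nu d s0 s1) ≤
      (∫⁻ u, ‖p.1 u‖ₑ) * (∫⁻ u, ‖p'.1 u‖ₑ) * (ENNReal.ofReal (s1 - s0) *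
        ENNReal.ofReal (C * (1 + Real.log (s1 - s0)))) := by
  set Λ := ENNReal.ofReal (C * (1 + Real.log (s1 - s0)))
  have mψ : ∀ p : Ix d, Measurable fun u => ‖p.1 u‖ₑ := fun p => p.1.continuous.measurable.enorm
  have inner : ∀ x : ℝ × Eu d, ∫⁻ y, ‖p.1 x.2‖ₑ * ‖p'.1 y.2‖ₑ *
      ‖R (x.1 • v - x.2 - (y.1 • v - y.2)) p.2 p'.2‖ₑ ∂(nu d s0 s1)
      ≤ ‖p.1 x.2‖ₑ * ((∫⁻ u, ‖p'.1 u‖ₑ) * Λ) := by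
    intro x
    have mm : Measurable fun y : ℝ × Eu d => ‖p.1 x.2‖ₑ * ‖p'.1 y.2‖ₑ *
      ‖R (x.1 • v - x.2 - (y.1 • v - y.2)) p.2 p'.2‖ₑ :=
      (((mψ p').comp measurable_snd).const_mul _).mul
        ((h.R_meas p.2 p'.2).comp (f := fun y : ℝ × Eu d => (x.1 • v - x.2 - (y.1 • v - y.2)))
          (by fun_prop)).enorm
    unfold nu
    rw [lintegral_prod_symm _ mm.aemeasurable]
    calc _ ≤ ∫⁻ u, ‖p.1 x.2‖ₑ * ‖p'.1 u‖ₑ * Λ := by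
          refine lintegral_mono fun u => ?_
          simp only
          rw [lintegral_const_mul]
          · gcongr
            refine le_trans (le_of_eq ?_) (hL (-(x.1 • v) + x.2 - u) p'.2 p.2 s0 s1 (s1 - s0) hs
              le_rfl)
            refine lintegral_congr fun r => ?_
            rw [← h.R_neg]
            congr 3
            abel
          · exact ((h.R_meas p.2 p'.2).comp (f := fun r : ℝ => (x.1 • v - x.2 - (r • v - u)))
              (by fun_prop)).enorm
      _ = _ := by
          rw [lintegral_mul_const _ ((mψ p').const_mul _), lintegral_const_mul _ (mψ p')]
          ring
  refine (lintegral_mono inner).trans ?_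
  rw [lintegral_mul_const _ (f := fun x : ℝ × Eu d => ‖p.1 x.2‖ₑ) ((mψ p).comp measurable_snd)]
  have e : ∫⁻ x, ‖p.1 x.2‖ₑ ∂(nu d s0 s1) = ENNReal.ofReal (s1 - s0) * ∫⁻ u, ‖p.1 u‖ₑ := by
    unfold nu
    rw [lintegral_prod (fun x : ℝ × Eu d => ‖p.1 x.2‖ₑ) ((mψ p).comp measurable_snd).aemeasurable]
    simp [mul_comm]
  rw [e]
  refine le_of_eq ?_
  ring

theorem psi_lint_lt_top (p : Ix d) : ∫⁻ u, ‖p.1 u‖ₑ < ⊤ := (p.1.integrable (μ := volume)).2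

theorem GF.Jr_sq_bound (h : GF P F R) (v : Eu d) (C : ℝ) (hC : 0 ≤ C) (hL : LineBound R v C)
    {n : ℕ} (p : Fin n → Ix d) : ∃ Cw : ℝ, 0 ≤ Cw ∧ ∀ s0 s1 : ℝ, 1 ≤ s1 - s0 → ∀ s z,
      ∫⁻ ω, ENNReal.ofReal (Jr v s0 s1 (F ω) p s z ^ 2) ∂P ≤
        ENNReal.ofReal (Cw * ((s1 - s0) * (1 + Real.log (s1 - s0))) ^ n) := by
  set N : ℝ := ∑ i, (∫⁻ u, ‖(p i).1 u‖ₑ).toReal with hN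
  have hN0 : 0 ≤ N := Finset.sum_nonneg fun i _ => ENNReal.toReal_nonneg
  refine ⟨(2 * n).factorial * (N * N * C) ^ n, by positivity, fun s0 s1 hs s z => ?_⟩
  have hlog : 0 ≤ Real.log (s1 - s0) := Real.log_nonneg hs
  have hNi : ∀ i, ∫⁻ u, ‖(p i).1 u‖ₑ ≤ ENNReal.ofReal N := by
    intro i
    rw [← ENNReal.ofReal_toReal (psi_lint_lt_top (p i)).ne]
    exact ENNReal.ofReal_le_ofReal (Finset.single_le_sum
      (f := fun i => (∫⁻ u, ‖(p i).1 u‖ₑ).toReal) (fun i _ => ENNReal.toReal_nonneg)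
      (Finset.mem_univ i))
  refine (h.Jr_sq v s0 s1 p s z (ENNReal.ofReal (N * N * ((s1 - s0) *
    (C * (1 + Real.log (s1 - s0)))))) fun i j => ?_).trans ?_
  · refine (h.B_bound v C hL s0 s1 hs (p i) (p j)).trans ?_
    rw [ENNReal.ofReal_mul (p := N * N) (by positivity), ENNReal.ofReal_mul (p := N) hN0,
      ENNReal.ofReal_mul (p := s1 - s0) (by linarith)]
    gcongr <;> apply hNi
  · rw [← ENNReal.ofReal_pow (by positivity), ← ENNReal.ofReal_natCast,
      ← ENNReal.ofReal_mul (by positivity)]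
    refine ENNReal.ofReal_le_ofReal (le_of_eq ?_)
    rw [mul_assoc (((2 * n).factorial : ℕ) : ℝ), ← mul_pow]
    ring_nf

end
end KP


namespace KP

section
variable {d : ℕ}

/-- Integrable polynomial weight. -/
noncomputable def wt (u : Eu d) : ℝ := ((1 + ‖u‖) ^ (d + 1))⁻¹

theorem wt_pos (u : Eu d) : 0 < wt u := by unfold wt; positivity

theorem wt_cont : Continuous (wt (d := d)) := by
  unfold wt
  exact Continuous.inv₀ (by fun_prop) fun u => by positivity

theorem wt_integrable : Integrable (wt (d := d)) := by
  have h := integrable_one_add_norm (E := Eu d) (μ := volume) (r := (d : ℝ) + 1) (by simp)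
  refine h.congr (ae_of_all _ fun u => ?_)
  simp only [wt]
  rw [Real.rpow_neg (by positivity)]
  norm_cast

/-- Weighted moment functional of a field. -/
noncomputable def Aw (k : ℕ) (f : Eu d → Eu d) : ENNReal :=
  ∫⁻ u, ‖f u‖ₑ ^ k * ENNReal.ofReal (wt u)

theorem wt_shift (x u : Eu d) : wt u ≤ (1 + ‖x‖) ^ (d + 1) * wt (x - u) := by
  unfold wt
  rw [← div_eq_mul_inv, inv_eq_one_div, div_le_div_iff₀ (by positivity) (by positivity), one_mul,
    ← mul_pow]
  gcongr
  have := norm_sub_le x u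
  nlinarith [norm_nonneg x, norm_nonneg u]

theorem schwartz_wt (ψ : SchwartzMap (Eu d) ℝ) : ∃ C : ℝ, 0 ≤ C ∧ ∀ u, |ψ u| ≤ C * wt u := by
  refine ⟨2 ^ (d + 1) * (Finset.Iic (d + 1, 0)).sup
    (fun m => SchwartzMap.seminorm ℝ m.1 m.2) ψ, by positivity, fun u => ?_⟩
  have := SchwartzMap.one_add_le_sup_seminorm_apply (𝕜 := ℝ) (m := (d + 1, 0)) (k := d + 1) (n := 0)
    le_rfl le_rfl ψ u
  rw [norm_iteratedFDeriv_zero, Real.norm_eq_abs] at this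
  unfold wt
  rw [← div_eq_mul_inv, le_div_iff₀ (by positivity), mul_comm]
  exact this

theorem conv_bound (ψ : SchwartzMap (Eu d) ℝ) : ∃ C : ℝ, 0 ≤ C ∧ ∀ (k : ℕ) (f : Eu d → Eu d)
    (_ : Measurable f) (x : Eu d), ∫⁻ u, ‖ψ u‖ₑ * ‖f (x - u)‖ₑ ^ k ≤
      ENNReal.ofReal (C * (1 + ‖x‖) ^ (d + 1)) * Aw k f := by
  obtain ⟨C, hC0, hC⟩ := schwartz_wt ψ
  refine ⟨C, hC0, fun k f hf x => ?_⟩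
  have e : Aw k f = ∫⁻ u, ‖f (x - u)‖ₑ ^ k * ENNReal.ofReal (wt (x - u)) := by
    rw [Aw, ← (Measure.measurePreserving_sub_left volume x).lintegral_comp]
    exact (hf.enorm.pow_const k).mul (wt_cont.measurable.ennreal_ofReal)
  rw [e, ← lintegral_const_mul']
  · refine lintegral_mono fun u => ?_
    calc _ ≤ ENNReal.ofReal (C * ((1 + ‖x‖) ^ (d + 1) * wt (x - u))) * ‖f (x - u)‖ₑ ^ k := by
          gcongr
          rw [← ofReal_norm, Real.norm_eq_abs]
          refine ENNReal.ofReal_le_ofReal ((hC u).trans ?_)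
          gcongr
          exact wt_shift x u
      _ = _ := by
          rw [← mul_assoc, ENNReal.ofReal_mul (by positivity)]
          ring
  · simp

theorem Gs_integrable (f : Eu d → Eu d) (hf : Measurable f) (hA : Aw 1 f < ⊤) (p : Ix d)
    (x : Eu d) : Integrable (fun u => p.1 u * f (x - u) p.2) := by
  obtain ⟨C, hC0, hC⟩ := conv_bound p.1
  refine ⟨?_, ?_⟩
  · exact (p.1.continuous.measurable.mul
      ((EuclideanSpace.proj p.2 : Eu d →L[ℝ] ℝ).continuous.measurable.comp
        (hf.comp (by fun_prop)))).aestronglyMeasurable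
  · refine lt_of_le_of_lt ?_ (ENNReal.mul_lt_top
      (ENNReal.ofReal_lt_top (r := C * (1 + ‖x‖) ^ (d + 1))) hA)
    · refine le_trans (lintegral_mono fun u => ?_) (hC 1 f hf x)
      rw [enorm_mul, pow_one]
      gcongr
      exact enorm_le_iff_norm_le.2 (PiLp.norm_apply_le _ _)

theorem Gs_bound (p : Ix d) : ∃ C : ℝ, 0 ≤ C ∧ ∀ (f : Eu d → Eu d) (_ : Measurable f) (Γ : ℝ)
    (_ : 0 ≤ Γ) (_ : Aw 1 f ≤ ENNReal.ofReal Γ) (x : Eu d),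
    |Gs f p x| ≤ C * (1 + ‖x‖) ^ (d + 1) * Γ := by
  obtain ⟨C, hC0, hC⟩ := conv_bound p.1
  refine ⟨C, hC0, fun f hf Γ hΓ hA x => ?_⟩
  have h1 : ‖Gs f p x‖ₑ ≤ ENNReal.ofReal (C * (1 + ‖x‖) ^ (d + 1) * Γ) := by
    refine (enorm_integral_le_lintegral_enorm _).trans ?_
    rw [ENNReal.ofReal_mul (by positivity)]
    refine le_trans (le_trans (lintegral_mono fun u => ?_) (hC 1 f hf x)) (mul_le_mul_right hA _)
    rw [enorm_mul, pow_one]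
    gcongr
    exact enorm_le_iff_norm_le.2 (PiLp.norm_apply_le _ _)
  rw [← ofReal_norm, ENNReal.ofReal_le_ofReal_iff (by positivity)] at h1
  exact h1

/-- Truncated bound with a high moment. -/
theorem Gs_bound_high (p : Ix d) : ∃ C : ℝ, 0 ≤ C ∧ ∀ (k : ℕ) (f : Eu d → Eu d) (_ : Measurable f)
    (Γ : ℝ) (_ : 0 ≤ Γ) (_ : Aw (k + 1) f ≤ ENNReal.ofReal Γ) (lam : ℝ) (_ : 0 < lam) (x : Eu d),
    |Gs f p x| ≤ C * (lam + (lam ^ k)⁻¹ * (1 + ‖x‖) ^ (d + 1) * Γ) := by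
  obtain ⟨C, hC0, hC⟩ := conv_bound p.1
  set C1 := (∫⁻ u, ‖p.1 u‖ₑ).toReal with hC1
  refine ⟨C + C1, by positivity, fun k f hf Γ hΓ hA lam hlam x => ?_⟩
  have e1 : (∫⁻ u, ‖p.1 u‖ₑ) = ENNReal.ofReal C1 :=
    (ENNReal.ofReal_toReal (psi_lint_lt_top p).ne).symm
  have hpt : ∀ y : ℝ, 0 ≤ y → y ≤ lam + (lam ^ k)⁻¹ * y ^ (k + 1) := by
    intro y hy
    rcases le_total y lam with h | h
    · have : 0 ≤ (lam ^ k)⁻¹ * y ^ (k + 1) := by positivity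
      linarith
    · have : lam ^ k ≤ y ^ k := by gcongr
      have h2 : y ≤ (lam ^ k)⁻¹ * y ^ (k + 1) := by
        rw [pow_succ, ← mul_assoc]
        refine le_mul_of_one_le_left hy ?_
        rw [inv_mul_eq_div, one_le_div (by positivity)]
        exact this
      linarith
  have h1 : ‖Gs f p x‖ₑ ≤ ENNReal.ofReal (C1 * lam +
      (lam ^ k)⁻¹ * (C * (1 + ‖x‖) ^ (d + 1) * Γ)) := by
    refine (enorm_integral_le_lintegral_enorm _).trans ?_
    calc _ ≤ ∫⁻ u, (‖p.1 u‖ₑ * ENNReal.ofReal lam + ENNReal.ofReal ((lam ^ k)⁻¹) *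
          (‖p.1 u‖ₑ * ‖f (x - u)‖ₑ ^ (k + 1))) := by
          refine lintegral_mono fun u => ?_
          rw [enorm_mul]
          calc _ ≤ ‖p.1 u‖ₑ * (ENNReal.ofReal lam + ENNReal.ofReal ((lam ^ k)⁻¹) *
                ‖f (x - u)‖ₑ ^ (k + 1)) := by
                gcongr
                rw [← ofReal_norm, ← ofReal_norm, ← ENNReal.ofReal_pow (norm_nonneg _),
                  ← ENNReal.ofReal_mul (by positivity), ← ENNReal.ofReal_add hlam.le (by positivity)]
                exact ENNReal.ofReal_le_ofReal ((PiLp.norm_apply_le _ _).trans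
                  (hpt _ (norm_nonneg _)))
            _ = _ := by ring
      _ = (∫⁻ u, ‖p.1 u‖ₑ) * ENNReal.ofReal lam + ENNReal.ofReal ((lam ^ k)⁻¹) *
          ∫⁻ u, (‖p.1 u‖ₑ * ‖f (x - u)‖ₑ ^ (k + 1)) := by
          have m1 : Measurable fun u => ‖p.1 u‖ₑ := p.1.continuous.measurable.enorm
          rw [lintegral_add_left (m1.mul_const _), lintegral_mul_const _ m1,
            lintegral_const_mul' _ _ (by simp)]
      _ ≤ ENNReal.ofReal C1 * ENNReal.ofReal lam + ENNReal.ofReal ((lam ^ k)⁻¹) *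
          (ENNReal.ofReal (C * (1 + ‖x‖) ^ (d + 1)) * ENNReal.ofReal Γ) := by
          rw [e1]
          gcongr
          exact (hC (k + 1) f hf x).trans (mul_le_mul_right hA _)
      _ = _ := by
          have hp : 0 ≤ C1 := ENNReal.toReal_nonneg
          rw [← ENNReal.ofReal_mul hp, ← ENNReal.ofReal_mul (by positivity),
            ← ENNReal.ofReal_mul (by positivity), ← ENNReal.ofReal_add (by positivity)
              (by positivity)]
  have hp : 0 ≤ C1 := ENNReal.toReal_nonneg
  rw [← ofReal_norm, ENNReal.ofReal_le_ofReal_iff (by positivity)] at h1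
  refine h1.trans ?_
  have a1 : 0 ≤ (lam ^ k)⁻¹ * (1 + ‖x‖) ^ (d + 1) * Γ := by positivity
  nlinarith [mul_nonneg hp a1, mul_nonneg hC0 hlam.le]

theorem hf_nu (v : Eu d) (s0 s1 : ℝ) (f : Eu d → Eu d) (hf : Measurable f) (hA : Aw 1 f < ⊤)
    (p : Ix d) (z : Eu d) :
    Integrable (fun a : ℝ × Eu d => p.1 a.2 * f (z + a.1 • v - a.2) p.2) (nu d s0 s1) := by
  obtain ⟨C, hC0, hC⟩ := conv_bound p.1
  have hm : Measurable fun a : ℝ × Eu d => p.1 a.2 * f (z + a.1 • v - a.2) p.2 :=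
    (p.1.continuous.measurable.comp measurable_snd).mul
      ((EuclideanSpace.proj p.2 : Eu d →L[ℝ] ℝ).continuous.measurable.comp
        (hf.comp (by fun_prop)))
  refine ⟨hm.aestronglyMeasurable, ?_⟩
  unfold HasFiniteIntegral nu
  rw [lintegral_prod _ hm.enorm.aemeasurable]
  have hcont : Continuous fun r : ℝ => C * (1 + ‖z + r • v‖) ^ (d + 1) := by fun_prop
  obtain ⟨M, hM⟩ := (isCompact_Icc (a := s0) (b := s1)).exists_bound_of_continuousOn
    hcont.continuousOn
  calc _ ≤ ∫⁻ _r in Ioc s0 s1, ENNReal.ofReal M * Aw 1 f := by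
        refine setLIntegral_mono' measurableSet_Ioc fun r hr => ?_
        refine le_trans (le_trans (lintegral_mono fun u => ?_) (hC 1 f hf (z + r • v))) ?_
        · simp only [enorm_mul, pow_one]
          gcongr
          exact enorm_le_iff_norm_le.2 (PiLp.norm_apply_le _ _)
        · gcongr
          exact (le_abs_self _).trans (hM r (Ioc_subset_Icc_self hr))
    _ < ⊤ := by
        rw [setLIntegral_const]
        exact ENNReal.mul_lt_top (ENNReal.mul_lt_top ENNReal.ofReal_lt_top hA) (by simp)

end
end KP


namespace KP

section
variable {d : ℕ}

/-- Derivative of an index. -/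
noncomputable def Dx (l : Fin d) (p : Ix d) : Ix d :=
  (LineDeriv.lineDerivOp (EuclideanSpace.single l (1:ℝ) : Eu d) p.1, p.2)

theorem fwt_integrable (f : Eu d → Eu d) (hf : Measurable f) (hA : Aw 1 f < ⊤) :
    Integrable (fun u => ‖f u‖ * wt u) := by
  refine ⟨(hf.norm.mul wt_cont.measurable).aestronglyMeasurable, ?_⟩
  unfold HasFiniteIntegral
  refine lt_of_le_of_lt (lintegral_mono fun u => ?_) hA
  rw [enorm_mul, pow_one, enorm_norm, Real.enorm_eq_ofReal (wt_pos u).le]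

theorem Gs_eq (f : Eu d → Eu d) (p : Ix d) (x : Eu d) : Gs f p x = ∫ u, p.1 (x - u) * f u p.2 := by
  rw [Gs, ← integral_sub_left_eq_self _ volume x]
  simp

theorem eu_sum_single (y : Eu d) : y = ∑ l, y l • (EuclideanSpace.single l (1:ℝ) : Eu d) := by
  ext i
  simp [Finset.sum_apply, Pi.single_apply]

theorem eu_clm_sum (L : Eu d →L[ℝ] ℝ) :
    L = ∑ l, L (EuclideanSpace.single l 1) • (EuclideanSpace.proj l : Eu d →L[ℝ] ℝ) := by
  ext y
  have hy := eu_sum_single y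
  conv_lhs => rw [hy]
  simp [ContinuousLinearMap.sum_apply, mul_comm]

theorem Gs_hasFDerivAt (f : Eu d → Eu d) (hf : Measurable f) (hA : Aw 1 f < ⊤) (p : Ix d)
    (x : Eu d) : HasFDerivAt (Gs f p)
      (∑ l, Gs f (Dx l p) x • (EuclideanSpace.proj l : Eu d →L[ℝ] ℝ)) x := by
  have e0 : Gs f p = fun x => ∫ u, p.1 (x - u) * f u p.2 := funext fun x => Gs_eq f p x
  have hc : Measurable fun u => f u p.2 :=
    (EuclideanSpace.proj p.2 : Eu d →L[ℝ] ℝ).continuous.measurable.comp hf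
  set C : ℝ := 2 ^ (d + 1) * (Finset.Iic (d + 1, 1)).sup
    (fun m => SchwartzMap.seminorm ℝ m.1 m.2) p.1 with hCdef
  have hC0 : 0 ≤ C := by positivity
  have hCb : ∀ u, ‖fderiv ℝ p.1 u‖ ≤ C * wt u := by
    intro u
    have := SchwartzMap.one_add_le_sup_seminorm_apply (𝕜 := ℝ) (m := (d + 1, 1)) (k := d + 1)
      (n := 1) le_rfl le_rfl p.1 u
    rw [norm_iteratedFDeriv_one] at this
    unfold wt
    rw [← div_eq_mul_inv, le_div_iff₀ (by positivity), mul_comm]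
    exact this
  have hdiff : ∀ y, HasFDerivAt p.1 (fderiv ℝ p.1 y) y := fun y => p.1.differentiableAt.hasFDerivAt
  have hfdc : Continuous (fderiv ℝ p.1) := (p.1.smooth 1).continuous_fderiv (by simp)
  have key := hasFDerivAt_integral_of_dominated_of_fderiv_le (𝕜 := ℝ) (μ := volume)
    (F := fun x u => p.1 (x - u) * f u p.2) (x₀ := x) (s := Metric.ball x 1)
    (F' := fun x u => f u p.2 • fderiv ℝ p.1 (x - u))
    (bound := fun u => C * (2 + ‖x‖) ^ (d + 1) * (‖f u‖ * wt u))
    (Metric.ball_mem_nhds x one_pos) ?_ ?_ ?_ ?_ ?_ ?_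
  · rw [e0]
    refine key.congr_fderiv ?_
    have hI : Integrable (fun u => f u p.2 • fderiv ℝ p.1 (x - u)) := by
      refine ((fwt_integrable f hf hA).const_mul (C * (2 + ‖x‖) ^ (d + 1))).mono' ?_ ?_
      · exact (hc.stronglyMeasurable.smul
          (hfdc.comp (by fun_prop : Continuous fun u => x - u)).stronglyMeasurable).aestronglyMeasurable
      · refine ae_of_all _ fun u => ?_
        rw [norm_smul]
        have h1 := hCb (x - u)
        have h2 := wt_shift x (x - u)
        rw [sub_sub_cancel] at h2
        have h3 : (1 + ‖x‖) ^ (d + 1) ≤ (2 + ‖x‖) ^ (d + 1) := by gcongr; norm_num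
        calc _ ≤ ‖f u‖ * (C * ((2 + ‖x‖) ^ (d + 1) * wt u)) := by
              gcongr
              · exact PiLp.norm_apply_le _ _
              · refine h1.trans ?_
                gcongr
                exact h2.trans (by gcongr; exact (wt_pos u).le)
          _ = _ := by ring
    rw [eu_clm_sum (∫ u, f u p.2 • fderiv ℝ p.1 (x - u))]
    refine Finset.sum_congr rfl fun l _ => ?_
    rw [ContinuousLinearMap.integral_apply hI]
    congr 1
    rw [Gs_eq]
    refine integral_congr_ae (ae_of_all _ fun u => ?_)
    simp only [Dx, SchwartzMap.lineDerivOp_apply_eq_fderiv, ContinuousLinearMap.smul_apply,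
      smul_eq_mul]
    ring
  · refine Eventually.of_forall fun y => ?_
    exact ((p.1.continuous.comp (by fun_prop : Continuous fun u => y - u)).measurable.mul
      hc).aestronglyMeasurable
  · have := Gs_integrable f hf hA p x
    have h2 := (Measure.measurePreserving_sub_left volume x).integrable_comp_of_integrable this
    refine h2.congr (ae_of_all _ fun u => ?_)
    simp [Function.comp]
  · exact (hc.stronglyMeasurable.smul
      (hfdc.comp (by fun_prop : Continuous fun u => x - u)).stronglyMeasurable).aestronglyMeasurable
  · refine ae_of_all _ fun u y hy => ?_
    rw [norm_smul]
    have h1 := hCb (y - u)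
    have h2 := wt_shift y (y - u)
    rw [sub_sub_cancel] at h2
    have hyn : ‖y‖ ≤ 1 + ‖x‖ := by
      have := norm_sub_norm_le y x
      rw [Metric.mem_ball, dist_eq_norm] at hy
      linarith
    have h3 : (1 + ‖y‖) ^ (d + 1) ≤ (2 + ‖x‖) ^ (d + 1) :=
      pow_le_pow_left₀ (by positivity) (by linarith) _
    calc _ ≤ ‖f u‖ * (C * ((2 + ‖x‖) ^ (d + 1) * wt u)) := by
          gcongr
          · exact PiLp.norm_apply_le _ _
          · refine h1.trans ?_
            gcongr
            exact h2.trans (by gcongr; exact (wt_pos u).le)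
      _ = _ := by ring
  · exact (fwt_integrable f hf hA).const_mul _
  · refine ae_of_all _ fun u y _ => ?_
    have h1 := ((hdiff (y - u)).comp y ((hasFDerivAt_id y).sub_const u)).mul_const (f u p.2)
    simpa using h1

end

section
variable {d : ℕ} {Ω : Type*} [MeasurableSpace Ω] {P : Measure Ω} [IsProbabilityMeasure P]
  {F : Ω → Eu d → Eu d} {R : Eu d → Fin d → Fin d → ℝ}

theorem GF.Aw_meas (h : GF P F R) (k : ℕ) : Measurable fun ω => Aw k (F ω) := by
  unfold Aw
  refine Measurable.lintegral_prod_right' (f := fun x : Ω × Eu d => ‖F x.1 x.2‖ₑ ^ k *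
    ENNReal.ofReal (wt x.2)) ?_
  exact (h.meas.enorm.pow_const k).mul (wt_cont.measurable.ennreal_ofReal.comp measurable_snd)

theorem eu_norm_pow_le (k : ℕ) : ∃ C : ℝ, 0 ≤ C ∧ ∀ y : Eu d, ‖y‖ ^ k ≤ C * ∑ c, |y c| ^ k + C := by
  refine ⟨d ^ k + 1, by positivity, fun y => ?_⟩
  rcases isEmpty_or_nonempty (Fin d) with hd | hd
  · have : y = 0 := Subsingleton.elim _ _
    rw [this, norm_zero]
    have h0 : (0:ℝ) ^ k ≤ 1 := pow_le_one₀ le_rfl zero_le_one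
    have : (0:ℝ) ≤ (d:ℝ) ^ k := by positivity
    simp only [Finset.univ_eq_empty, Finset.sum_empty]; linarith
  · obtain ⟨j, -, hj⟩ := Finset.exists_max_image Finset.univ (fun i => |y i|) Finset.univ_nonempty
    have h1 : ‖y‖ ≤ d * |y j| := by
      have e := eu_sum_single y
      calc ‖y‖ = ‖∑ l, y l • (EuclideanSpace.single l (1:ℝ) : Eu d)‖ := by rw [← e]
        _ ≤ ∑ l : Fin d, |y j| := by
          refine norm_sum_le_of_le _ fun l _ => ?_
          rw [norm_smul]; simpa using hj l (Finset.mem_univ l)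
        _ = _ := by simp
    have h2 : |y j| ^ k ≤ ∑ c, |y c| ^ k :=
      Finset.single_le_sum (f := fun c => |y c| ^ k) (fun c _ => by positivity) (Finset.mem_univ j)
    have h3 : ‖y‖ ^ k ≤ d ^ k * |y j| ^ k := by
      rw [← mul_pow]; gcongr
    have h4 : 0 ≤ |y j| ^ k := by positivity
    have h5 : (0:ℝ) ≤ (d:ℝ) ^ k := by positivity
    nlinarith

theorem GF.Aw_bound (h : GF P F R) (k : ℕ) : ∃ C : ℝ, 0 ≤ C ∧
    ∫⁻ ω, Aw k (F ω) ∂P ≤ ENNReal.ofReal C := by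
  obtain ⟨C, hC0, hC⟩ := eu_norm_pow_le (d := d) k
  obtain ⟨M, hM0, hM⟩ := h.mom k
  have hpt : ∀ u, ∫⁻ ω, ‖F ω u‖ₑ ^ k ∂P ≤ ENNReal.ofReal (C * (d * M) + C) := by
    intro u
    have hi : Integrable (fun ω => C * ∑ c, |F ω u c| ^ k + C) P :=
      ((integrable_finsetSum _ fun c _ => gauss_pow_integrable (h.gauss1 u c) k).const_mul C).add
        (integrable_const _)
    calc _ ≤ ∫⁻ ω, ENNReal.ofReal (C * ∑ c, |F ω u c| ^ k + C) ∂P := by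
          refine lintegral_mono fun ω => ?_
          rw [← ofReal_norm, ← ENNReal.ofReal_pow (norm_nonneg _)]
          exact ENNReal.ofReal_le_ofReal (hC _)
      _ = ENNReal.ofReal (∫ ω, (C * ∑ c, |F ω u c| ^ k + C) ∂P) :=
          (ofReal_integral_eq_lintegral_ofReal hi (ae_of_all _ fun ω => by positivity)).symm
      _ ≤ _ := by
          refine ENNReal.ofReal_le_ofReal ?_
          rw [integral_add ((integrable_finsetSum _ fun c _ =>
            gauss_pow_integrable (h.gauss1 u c) k).const_mul C) (integrable_const _),
            integral_const_mul, integral_finsetSum _ fun c _ => gauss_pow_integrable (h.gauss1 u c) k]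
          simp only [integral_const, probReal_univ, one_smul]
          gcongr
          calc _ ≤ ∑ _c : Fin d, M := Finset.sum_le_sum fun c _ => hM u c
            _ = _ := by simp
  refine ⟨(C * (d * M) + C) * ∫ u : Eu d, wt u, mul_nonneg (by positivity)
    (integral_nonneg fun u => (wt_pos u).le), ?_⟩
  unfold Aw
  have hmeas : Measurable fun x : Ω × Eu d => ‖F x.1 x.2‖ₑ ^ k * ENNReal.ofReal (wt x.2) :=
    (h.meas.enorm.pow_const k).mul (wt_cont.measurable.ennreal_ofReal.comp measurable_snd)
  rw [lintegral_lintegral_swap hmeas.aemeasurable]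
  calc _ ≤ ∫⁻ u : Eu d, ENNReal.ofReal (C * (d * M) + C) * ENNReal.ofReal (wt u) := by
        refine lintegral_mono fun u => ?_
        rw [lintegral_mul_const' _ _ (by simp)]
        gcongr
        exact hpt u
    _ = _ := by
        rw [lintegral_const_mul' _ _ (by simp), ENNReal.ofReal_mul (by positivity),
          ofReal_integral_eq_lintegral_ofReal wt_integrable (ae_of_all _ fun u => (wt_pos u).le)]

end
end KP


namespace KP

section
variable {d : ℕ}

theorem schwartz_mul_bdd_integrable (χ : SchwartzMap (Eu d) ℝ) (g : Eu d → ℝ) (hg : Continuous g)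
    (hb : ∀ u, |g u| ≤ 1) : Integrable fun u => χ u * g u := by
  refine (χ.integrable (μ := volume)).norm.mono' (χ.continuous.mul hg).aestronglyMeasurable
    (ae_of_all _ fun u => ?_)
  rw [norm_mul]
  exact mul_le_of_le_one_right (norm_nonneg _) (hb u)

theorem exists_filter (K : ℝ) (hK : 0 < K) : ∃ χ : SchwartzMap (Eu d) ℝ, ∀ k : Eu d, ‖k‖ ≤ K →
    ∫ u, χ u * Real.cos ⟪k, u⟫ = 1 ∧ ∫ u, χ u * Real.sin ⟪k, u⟫ = 0 := by
  let b : ContDiffBump (0 : Eu d) := ⟨K, 2 * K, hK, by linarith⟩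
  have hb1 : HasCompactSupport (fun x => ((b x : ℝ) : ℂ)) :=
    b.hasCompactSupport.comp_left (g := fun x : ℝ => (x : ℂ)) (by simp)
  have hb2 : ContDiff ℝ (⊤ : ℕ∞) (fun x => ((b x : ℝ) : ℂ)) :=
    Complex.ofRealCLM.contDiff.comp b.contDiff
  let g : SchwartzMap (Eu d) ℂ := hb1.toSchwartzMap hb2
  have hg : ∀ k : Eu d, ‖k‖ ≤ K → g k = 1 := by
    intro k hk
    change ((b k : ℝ) : ℂ) = 1
    rw [b.one_of_mem_closedBall (by simpa using hk)]
    simp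
  let χc : SchwartzMap (Eu d) ℂ := FourierTransformInv.fourierInv g
  have hF : ∀ w, ∫ u, Complex.exp (↑(-2 * Real.pi * ⟪u, w⟫) * Complex.I) • χc u = g w := by
    intro w
    have h1 : FourierTransform.fourier χc = g := FourierTransform.fourier_fourierInv_eq g
    have h2 := Real.fourier_eq' (χc : Eu d → ℂ) w
    rw [← h2, ← SchwartzMap.fourier_coe, h1]
  let χ : SchwartzMap (Eu d) ℝ := SchwartzMap.postcompCLM (𝕜 := ℝ) Complex.reCLM χc
  have hχ : ∀ u, χ u = (χc u).re := fun u => rfl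
  let χi : SchwartzMap (Eu d) ℝ := SchwartzMap.postcompCLM (𝕜 := ℝ) Complex.imCLM χc
  have hχi : ∀ u, χi u = (χc u).im := fun u => rfl
  have hre : ∀ k : Eu d, ‖k‖ ≤ K → ∫ u, (χ u * Real.cos ⟪k, u⟫ + χi u * Real.sin ⟪k, u⟫) = 1 ∧ 
     ∫ u, (χi u * Real.cos ⟪k, u⟫ - χ u * Real.sin ⟪k, u⟫) = 0 := by
    intro k hk
    have h1 := hF ((2 * Real.pi)⁻¹ • k)
    have hpi : 1 ≤ 2 * Real.pi := by linarith [Real.pi_gt_three]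
    rw [hg _ (by
      rw [norm_smul, norm_inv, Real.norm_of_nonneg (by positivity)]
      exact (mul_le_of_le_one_left (norm_nonneg _) (inv_le_one_of_one_le₀ hpi)).trans hk)] at h1
    have hintg : Integrable fun u =>
        Complex.exp (↑(-2 * Real.pi * ⟪u, (2 * Real.pi)⁻¹ • k⟫) * Complex.I) • χc u := by
      refine (χc.integrable (μ := volume)).norm.mono' ?_ (ae_of_all _ fun u => ?_)
      · refine Continuous.aestronglyMeasurable ?_
        have := χc.continuous
        fun_prop
      · rw [norm_smul, Complex.norm_exp_ofReal_mul_I, one_mul]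
    have hpt : ∀ u, Complex.exp (↑(-2 * Real.pi * ⟪u, (2 * Real.pi)⁻¹ • k⟫) * Complex.I) • χc u
        = ⟨χ u * Real.cos ⟪k, u⟫ + χi u * Real.sin ⟪k, u⟫,
          χi u * Real.cos ⟪k, u⟫ - χ u * Real.sin ⟪k, u⟫⟩ := by
      intro u
      have e : -2 * Real.pi * ⟪u, (2 * Real.pi)⁻¹ • k⟫ = - ⟪k, u⟫ := by
        rw [inner_smul_right, real_inner_comm]; field_simp
      rw [e, Complex.exp_mul_I, ← Complex.ofReal_cos, ← Complex.ofReal_sin, Real.cos_neg,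
        Real.sin_neg]
      apply Complex.ext
      · simp [hχ, hχi, Complex.cos_ofReal_re, Complex.sin_ofReal_re, -Complex.ofReal_cos, -Complex.ofReal_sin]; ring
      · simp [hχ, hχi, Complex.cos_ofReal_re, Complex.sin_ofReal_re, -Complex.ofReal_cos, -Complex.ofReal_sin]; ring
    constructor
    · have := integral_re hintg
      rw [h1] at this
      simp only [hpt] at this
      simpa using this
    · have := integral_im hintg
      rw [h1] at this
      simp only [hpt] at this
      simpa using this
  refine ⟨χ, fun k hk => ?_⟩
  have hc : ∀ (f : SchwartzMap (Eu d) ℝ), Integrable fun u => f u * Real.cos ⟪k, u⟫ := fun f =>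
    schwartz_mul_bdd_integrable f _ (by fun_prop) fun u => Real.abs_cos_le_one _
  have hs : ∀ (f : SchwartzMap (Eu d) ℝ), Integrable fun u => f u * Real.sin ⟪k, u⟫ := fun f =>
    schwartz_mul_bdd_integrable f _ (by fun_prop) fun u => Real.abs_sin_le_one _
  obtain ⟨h1, h2⟩ := hre k hk
  obtain ⟨h3, h4⟩ := hre (-k) (by simpa using hk)
  simp only [inner_neg_left, Real.cos_neg, Real.sin_neg, mul_neg, ← sub_eq_add_neg, sub_neg_eq_add] at h3 h4
  rw [integral_add (hc _) (hs _)] at h1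
  rw [integral_sub (hc _) (hs _)] at h2
  rw [integral_sub (hc _) (hs _)] at h3
  rw [integral_add (hc _) (hs _)] at h4
  constructor <;> linarith

theorem conv_R (χ : SchwartzMap (Eu d) ℝ) (K : ℝ) (hχ : ∀ k : Eu d, ‖k‖ ≤ K →
    ∫ u, χ u * Real.cos ⟪k, u⟫ = 1 ∧ ∫ u, χ u * Real.sin ⟪k, u⟫ = 0)
    (h : Eu d → ℝ) (hi : Integrable h) (hs : ∀ k, K < ‖k‖ → h k = 0) (x : Eu d) :
    ∫ u, χ u * ∫ k, Real.cos ⟪k, x - u⟫ * h k = ∫ k, Real.cos ⟪k, x⟫ * h k := by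
  have e1 : ∀ u, χ u * ∫ k, Real.cos ⟪k, x - u⟫ * h k = ∫ k, χ u * (Real.cos ⟪k, x - u⟫ * h k) :=
    fun u => (integral_const_mul _ _).symm
  simp only [e1]
  rw [integral_integral_swap]
  · refine integral_congr_ae (ae_of_all _ fun k => ?_)
    simp only
    by_cases hk : K < ‖k‖
    · simp [hs k hk]
    · obtain ⟨h1, h2⟩ := hχ k (not_lt.1 hk)
      have e2 : ∀ u, χ u * (Real.cos ⟪k, x - u⟫ * h k) = 
          (Real.cos ⟪k, x⟫ * h k) * (χ u * Real.cos ⟪k, u⟫) +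
          (Real.sin ⟪k, x⟫ * h k) * (χ u * Real.sin ⟪k, u⟫) := by
        intro u
        rw [inner_sub_right, Real.cos_sub]; ring
      simp only [e2]
      rw [integral_add, integral_const_mul, integral_const_mul, h1, h2]
      · ring
      · exact (schwartz_mul_bdd_integrable χ _ (by fun_prop) fun u => Real.abs_cos_le_one _).const_mul _
      · exact (schwartz_mul_bdd_integrable χ _ (by fun_prop) fun u => Real.abs_sin_le_one _).const_mul _
  · have h1 : Integrable (fun z : Eu d × Eu d => χ z.1 * h z.2) (volume.prod volume) :=
      (χ.integrable (μ := volume)).mul_prod hi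
    have h2 := h1.bdd_mul (c := 1) (f := fun z : Eu d × Eu d => Real.cos ⟪z.2, x - z.1⟫)
      (Continuous.aestronglyMeasurable (by fun_prop)) (ae_of_all _ fun z => by
        simpa using Real.abs_cos_le_one _)
    refine h2.congr (ae_of_all _ fun z => ?_)
    simp only [Function.uncurry]; ring

end
end KP


namespace KP

section
variable {d : ℕ} {Ω : Type*} [MeasurableSpace Ω] {P : Measure Ω} [IsProbabilityMeasure P]
  {F : Ω → Eu d → Eu d} {R : Eu d → Fin d → Fin d → ℝ}

theorem GF.Aw_ae (h : GF P F R) (k : ℕ) : ∀ᵐ ω ∂P, Aw k (F ω) < ⊤ := by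
  obtain ⟨C, -, hC⟩ := h.Aw_bound k
  exact ae_lt_top (h.Aw_meas k) (hC.trans_lt ENNReal.ofReal_lt_top).ne

theorem GF.F_meas (h : GF P F R) (ω : Ω) : Measurable (F ω) :=
  h.meas.comp measurable_prodMk_left

theorem GF.conv_meas (h : GF P F R) (x : Eu d) (c : Fin d) :
    Measurable fun z : Ω × Eu d => F z.1 (x - z.2) c :=
  (EuclideanSpace.proj c : Eu d →L[ℝ] ℝ).continuous.measurable.comp
    (h.meas.comp (measurable_fst.prodMk (measurable_snd.const_sub x)))

theorem GF.Gs_meas (h : GF P F R) (p : Ix d) (x : Eu d) : Measurable fun ω => Gs (F ω) p x := by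
  have h1 : StronglyMeasurable fun z : Ω × Eu d => p.1 z.2 * F z.1 (x - z.2) p.2 :=
    ((p.1.continuous.measurable.comp measurable_snd).mul (h.conv_meas x p.2)).stronglyMeasurable
  exact (h1.integral_prod_right' (ν := volume)).measurable

theorem GF.memF (h : GF P F R) (x : Eu d) (c : Fin d) : MemLp (fun ω => F ω x c) 2 P :=
  (h.gauss1 x c).memLp_two

theorem GF.Gs_memLp (h : GF P F R) (p : Ix d) (x : Eu d) : MemLp (fun ω => Gs (F ω) p x) 2 P := by
  rw [memLp_two_iff_integrable_sq (h.Gs_meas p x).aestronglyMeasurable]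
  obtain ⟨C, hC0, hC⟩ := Gs_bound_high (d := d) p
  obtain ⟨M, hM0, hM⟩ := h.Aw_bound 2
  set c : ℝ := (1 + ‖x‖) ^ (d + 1) with hc
  have hc0 : 0 ≤ c := by positivity
  have hAi : Integrable (fun ω => (Aw 2 (F ω)).toReal) P :=
    integrable_toReal_of_lintegral_ne_top (h.Aw_meas 2).aemeasurable
      (hM.trans_lt ENNReal.ofReal_lt_top).ne
  refine Integrable.mono' (g := fun ω => 4 * C ^ 2 * (c * (Aw 2 (F ω)).toReal + 1))
    (((hAi.const_mul c).add (integrable_const 1)).const_mul _)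
    ((h.Gs_meas p x).pow_const 2).aestronglyMeasurable ?_
  filter_upwards [h.Aw_ae 2] with ω hω
  set A := (Aw 2 (F ω)).toReal with hA
  have hA0 : 0 ≤ A := ENNReal.toReal_nonneg
  set lam := Real.sqrt (c * A + 1) with hl
  have hl2 : lam ^ 2 = c * A + 1 := Real.sq_sqrt (by positivity)
  have hlp : 0 < lam := Real.sqrt_pos.2 (by positivity)
  have h1 := hC 1 (F ω) (h.F_meas ω) A hA0 (by rw [hA, ENNReal.ofReal_toReal hω.ne]) lam hlp x
  have h2 : lam + (lam ^ 1)⁻¹ * (1 + ‖x‖) ^ (d + 1) * A ≤ 2 * lam := by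
    rw [pow_one, mul_assoc, ← hc]
    have : lam⁻¹ * (c * A) ≤ lam := by
      rw [inv_mul_le_iff₀ hlp]; nlinarith
    linarith
  have h3 : |Gs (F ω) p x| ≤ C * (2 * lam) := h1.trans (by gcongr)
  rw [Real.norm_of_nonneg (sq_nonneg _), ← sq_abs]
  calc _ ≤ (C * (2 * lam)) ^ 2 := by gcongr
    _ = _ := by rw [← hl2]; ring

theorem mul_int {f g : Ω → ℝ} (hf : MemLp f 2 P) (hg : MemLp g 2 P) :
    Integrable (fun ω => f ω * g ω) P := hf.integrable_mul hg

/-- Fubini for the smoothed field against a square integrable variable. -/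
theorem GF.fub (h : GF P F R) (p : Ix d) (x : Eu d) (Y : Ω → ℝ) (hYm : Measurable Y)
    (hY : MemLp Y 2 P) :
    ∫ ω, Gs (F ω) p x * Y ω ∂P = ∫ u, p.1 u * ∫ ω, F ω (x - u) p.2 * Y ω ∂P := by
  have e1 : ∀ ω, Gs (F ω) p x * Y ω = ∫ u, p.1 u * (F ω (x - u) p.2 * Y ω) := by
    intro ω
    rw [Gs, ← integral_mul_const]
    refine integral_congr_ae (ae_of_all _ fun u => ?_)
    simp only; ring
  simp only [e1, ← integral_const_mul]
  obtain ⟨M, hM0, hM⟩ := h.mom 2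
  refine integral_integral_swap ?_
  have hm : Measurable fun z : Ω × Eu d => p.1 z.2 * (F z.1 (x - z.2) p.2 * Y z.1) :=
    (p.1.continuous.measurable.comp measurable_snd).mul
      ((h.conv_meas x p.2).mul (hYm.comp measurable_fst))
  have hYi : Integrable (fun ω => Y ω ^ 2) P := hY.integrable_sq
  have hFi : ∀ u, Integrable (fun ω => F ω u p.2 ^ 2) P := fun u => (h.memF u p.2).integrable_sq
  refine (integrable_prod_iff' hm.aestronglyMeasurable).2 ?_
  constructor
  · refine ae_of_all _ fun u => ?_
    exact (mul_int (h.memF (x - u) p.2) hY).const_mul (p.1 u)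
  · refine ((p.1.integrable (μ := volume)).norm.mul_const (M + ∫ ω, Y ω ^ 2 ∂P)).mono' ?_ ?_
    · exact (hm.norm.stronglyMeasurable.integral_prod_left' (μ := P)).aestronglyMeasurable
    · refine ae_of_all _ fun u => ?_
      rw [Real.norm_of_nonneg (integral_nonneg fun ω => norm_nonneg _)]
      simp only [Function.uncurry, norm_mul]
      rw [integral_const_mul]
      gcongr
      have hb : ∫ ω, F ω (x - u) p.2 ^ 2 ∂P ≤ M := by
        have := hM (x - u) p.2
        simpa [sq_abs] using this
      calc _ ≤ ∫ ω, (F ω (x - u) p.2 ^ 2 + Y ω ^ 2) ∂P := by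
            refine integral_mono_of_nonneg (ae_of_all _ fun ω => by positivity)
              ((hFi _).add hYi) (ae_of_all _ fun ω => ?_)
            simp only [Real.norm_eq_abs]
            nlinarith [sq_nonneg (|F ω (x - u) p.2| - |Y ω|), sq_abs (F ω (x - u) p.2),
              sq_abs (Y ω), sq_nonneg (F ω (x - u) p.2), sq_nonneg (Y ω)]
        _ = _ := integral_add (hFi _) hYi
        _ ≤ _ := by gcongr

theorem GF.filter_pt (h : GF P F R) (χ : SchwartzMap (Eu d) ℝ)
    (hχ : ∀ x i j, ∫ u, χ u * R (x - u) i j = R x i j) (x : Eu d) (c : Fin d) :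
    ∀ᵐ ω ∂P, F ω x c = Gs (F ω) (χ, c) x := by
  have hFm : ∀ y, Measurable fun ω => F ω y c := fun y => by
    have := (h.conv_meas (y + 0) c).comp (measurable_id.prodMk (measurable_const (a := (0 : Eu d))))
    simpa [Function.comp_def] using this
  set Z := fun ω => Gs (F ω) (χ, c) x with hZ
  have hZm : Measurable Z := h.Gs_meas (χ, c) x
  have hZ2 : MemLp Z 2 P := h.Gs_memLp (χ, c) x
  set Y : Ω → ℝ := fun ω => F ω x c - Z ω with hYd
  have hYm : Measurable Y := (hFm x).sub hZm
  have hY2 : MemLp Y 2 P := (h.memF x c).sub hZ2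
  have hYF : ∀ y, ∫ ω, F ω y c * Y ω ∂P = 0 := by
    intro y
    have e : ∀ ω, F ω y c * Y ω = F ω y c * F ω x c - Z ω * F ω y c := by
      intro ω; simp only [hYd]; ring
    simp only [e]
    rw [integral_sub (mul_int (h.memF y c) (h.memF x c)) (mul_int hZ2 (h.memF y c)),
      h.cov, h.fub (χ, c) x _ (hFm y) (h.memF y c)]
    have e2 : ∀ u, ∫ ω, F ω (x - u) c * F ω y c ∂P = R ((x - y) - u) c c := by
      intro u; rw [h.cov, sub_right_comm]
    simp only [e2]
    rw [hχ, ← neg_sub x y, h.R_neg, sub_self]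
  have hYZ : ∫ ω, Z ω * Y ω ∂P = 0 := by
    rw [h.fub (χ, c) x Y hYm hY2]
    simp [hYF]
  have hYY : ∫ ω, Y ω ^ 2 ∂P = 0 := by
    have e : ∀ ω, Y ω ^ 2 = F ω x c * Y ω - Z ω * Y ω := by intro ω; simp only [hYd]; ring
    simp only [e]
    rw [integral_sub (mul_int (h.memF x c) hY2) (mul_int hZ2 hY2), hYF, hYZ, sub_self]
  rw [integral_eq_zero_iff_of_nonneg (fun ω => sq_nonneg _) hY2.integrable_sq] at hYY
  filter_upwards [hYY] with ω hω
  have : Y ω = 0 := by simpa using hω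
  exact sub_eq_zero.1 this

theorem GF.filter_ae (h : GF P F R) (χ : SchwartzMap (Eu d) ℝ)
    (hχ : ∀ x i j, ∫ u, χ u * R (x - u) i j = R x i j)
    (hc : ∀ᵐ ω ∂P, Continuous (F ω)) :
    ∀ᵐ ω ∂P, ∀ x c, F ω x c = Gs (F ω) (χ, c) x := by
  have h1 : ∀ᵐ ω ∂P, ∀ n c, F ω (TopologicalSpace.denseSeq (Eu d) n) c =
      Gs (F ω) (χ, c) (TopologicalSpace.denseSeq (Eu d) n) := by
    rw [ae_all_iff]; intro n
    rw [ae_all_iff]; intro c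
    exact h.filter_pt χ hχ _ c
  filter_upwards [h1, hc, h.Aw_ae 1] with ω h1 hc hA x c
  have hG : Continuous (Gs (F ω) (χ, c)) := continuous_iff_continuousAt.2 fun y =>
    (Gs_hasFDerivAt (F ω) (h.F_meas ω) hA (χ, c) y).continuousAt
  have hFc : Continuous fun x => F ω x c :=
    (EuclideanSpace.proj c : Eu d →L[ℝ] ℝ).continuous.comp hc
  have := hFc.ext_on (TopologicalSpace.denseRange_denseSeq (Eu d)) hG (by
    rintro _ ⟨n, rfl⟩; exact h1 n c)
  exact congrFun this x

end
end KP


namespace KP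

/-- One dimensional majorant. -/
noncomputable def phi (γ K x : ℝ) : ENNReal := if |x| ≤ K then (ENNReal.ofReal |x|) ^ (-γ) else 0

theorem phi_meas (γ K : ℝ) : Measurable (phi γ K) := by
  unfold phi
  refine Measurable.ite ?_ ?_ measurable_const
  · exact (isClosed_le continuous_abs continuous_const).measurableSet
  · exact (continuous_abs.measurable.ennreal_ofReal).pow_const _

theorem phi_sq (γ K x : ℝ) : phi γ K x ^ 2 = phi (2 * γ) K x := by
  unfold phi
  split_ifs
  · rw [← ENNReal.rpow_natCast, ← ENNReal.rpow_mul]; congr 1; push_cast; ring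
  · simp

theorem phi_lt_top (γ K : ℝ) (h1 : γ < 1) : ∫⁻ x, phi γ K x < ⊤ := by
  set ψ : ℝ → ENNReal := (Ioc 0 K).indicator fun x => ENNReal.ofReal (x ^ (-γ)) with hψ
  have hψm : Measurable ψ := by
    refine Measurable.indicator ?_ measurableSet_Ioc
    exact (measurable_id.pow_const _).ennreal_ofReal
  have hψf : ∫⁻ x, ψ x < ⊤ := by
    rw [hψ, lintegral_indicator measurableSet_Ioc]
    rcases le_or_gt K 0 with hK | hK
    · simp [Ioc_eq_empty (not_lt.2 hK)]
    · have h2 : IntervalIntegrable (fun x : ℝ => x ^ (-γ)) volume 0 K :=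
        intervalIntegral.intervalIntegrable_rpow' (by linarith)
      rw [intervalIntegrable_iff_integrableOn_Ioc_of_le hK.le] at h2
      exact h2.lintegral_lt_top
  have h3 : ∀ᵐ x : ℝ, phi γ K x ≤ ψ x + ψ (-x) := by
    have : ∀ᵐ x : ℝ, x ≠ 0 := by simp [ae_iff]
    filter_upwards [this] with x hx
    unfold phi
    split_ifs with h
    · rw [ENNReal.ofReal_rpow_of_pos (abs_pos.2 hx)]
      rcases lt_or_gt_of_ne hx with h0 | h0
      · refine le_add_left ?_
        rw [hψ, indicator_of_mem (by rw [abs_of_neg h0] at h; exact ⟨by linarith, h⟩), abs_of_neg h0]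
      · refine le_add_right ?_
        rw [hψ, indicator_of_mem (by rw [abs_of_pos h0] at h; exact ⟨h0, h⟩), abs_of_pos h0]
    · simp
  refine (lintegral_mono_ae h3).trans_lt ?_
  rw [lintegral_add_left hψm, lintegral_neg_eq_self (μ := volume) ψ]
  exact ENNReal.add_lt_top.2 ⟨hψf, hψf⟩

/-- Exponents. -/
noncomputable def gam (d : ℕ) (α : ℝ) (i : Fin d) : ℝ :=
  if i.val < 2 then (max α 0 + 1 / 2) / 2 else 1 - (1 / 2 - max α 0) / d

structure SP (d : ℕ) (α K : ℝ) (a : ℝ → ℝ) : Prop where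
  hd : 2 ≤ d
  hα : α < 1 / 2
  hK : 0 < K
  nonneg : ∀ r : ℝ, 0 ≤ r → 0 ≤ a r
  bdd : ∃ M : ℝ, ∀ r : ℝ, 0 ≤ r → a r ≤ M
  meas : Measurable a
  supp : ∀ r : ℝ, K < r → a r = 0
  cont : ContinuousAt a 0
  one : a 0 = 1

noncomputable def mm (d : ℕ) (α : ℝ) (a : ℝ → ℝ) (k : Eu d) : ℝ :=
  a ‖k‖ * ‖k‖ ^ (-(2 * α + (d : ℝ) - 2))

noncomputable def pp {d : ℕ} (i j : Fin d) (k : Eu d) : ℝ :=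
  (if i = j then (1:ℝ) else 0) - k i * k j / ‖k‖ ^ 2

section
variable {d : ℕ} {α K : ℝ} {a : ℝ → ℝ}

theorem covEntry_eq (x : Eu d) (i j : Fin d) :
    covEntry d α a x i j = ∫ k : Eu d, Real.cos ⟪k, x⟫ * (mm d α a k * pp i j k) := rfl

theorem SP.gam_nonneg (h : SP d α K a) (i : Fin d) : 0 ≤ gam d α i := by
  have hα := h.hα
  have hm : max α 0 < 1 / 2 := max_lt hα (by norm_num)
  have hm0 : 0 ≤ max α 0 := le_max_right _ _
  have hd : (2:ℝ) ≤ d := by exact_mod_cast h.hd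
  unfold gam
  split_ifs
  · positivity
  · have : (1 / 2 - max α 0) / d ≤ 1 := by
      rw [div_le_one (by linarith)]; linarith
    linarith

theorem SP.gam_lt_one (h : SP d α K a) (i : Fin d) : gam d α i < 1 := by
  have hm : max α 0 < 1 / 2 := max_lt h.hα (by norm_num)
  have hd : (2:ℝ) ≤ d := by exact_mod_cast h.hd
  unfold gam
  split_ifs
  · linarith
  · have : 0 < (1 / 2 - max α 0) / d := by
      apply div_pos <;> linarith
    linarith

theorem SP.gam_lt_half (h : SP d α K a) (i : Fin d) (hi : i.val < 2) : 2 * gam d α i < 1 := by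
  have hm : max α 0 < 1 / 2 := max_lt h.hα (by norm_num)
  unfold gam
  rw [if_pos hi]
  linarith

theorem SP.gam_sum (h : SP d α K a) : 2 * α + (d : ℝ) - 2 ≤ ∑ i, gam d α i := by
  have hm : max α 0 < 1 / 2 := max_lt h.hα (by norm_num)
  have hm0 : α ≤ max α 0 := le_max_left _ _
  obtain ⟨n, rfl⟩ : ∃ n, d = n + 2 := ⟨d - 2, by have := h.hd; omega⟩
  rw [Fin.sum_univ_succ, Fin.sum_univ_succ]
  have e : ∀ i : Fin n, gam (n + 2) α i.succ.succ = 1 - (1 / 2 - max α 0) / ((n + 2 : ℕ) : ℝ) := by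
    intro i
    unfold gam
    rw [if_neg (by simp)]
  have e0 : gam (n + 2) α 0 = (max α 0 + 1 / 2) / 2 := by unfold gam; rw [if_pos (by simp)]
  have e1 : gam (n + 2) α (Fin.succ 0) = (max α 0 + 1 / 2) / 2 := by
    unfold gam; rw [if_pos (by simp)]
  simp only [e, e0, e1, Finset.sum_const, Finset.card_univ, Fintype.card_fin, nsmul_eq_mul]
  push_cast
  set s := 1 / 2 - max α 0 with hs
  have : (n:ℝ) * (s / (n + 2)) ≤ s := by
    rw [← mul_div_assoc, div_le_iff₀ (by positivity)]
    have : 0 < s := by linarith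
    nlinarith
  linarith

theorem pp_le (i j : Fin d) (k : Eu d) : |pp i j k| ≤ 2 := by
  unfold pp
  have h1 : |k i * k j / ‖k‖ ^ 2| ≤ 1 := by
    rw [abs_div, abs_mul, abs_of_nonneg (sq_nonneg ‖k‖)]
    refine div_le_one_of_le₀ ?_ (sq_nonneg _)
    rw [sq]
    have h1 : |k i| ≤ ‖k‖ := PiLp.norm_apply_le k i
    have h2 : |k j| ≤ ‖k‖ := PiLp.norm_apply_le k j
    gcongr
  have h2 : |(if i = j then (1:ℝ) else 0)| ≤ 1 := by split_ifs <;> simp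
  have := abs_sub (if i = j then (1:ℝ) else 0) (k i * k j / ‖k‖ ^ 2)
  linarith

theorem pp_meas (i j : Fin d) : Measurable (pp i j : Eu d → ℝ) := by
  unfold pp
  have h : ∀ i : Fin d, Measurable fun k : Eu d => k i := fun i =>
    (EuclideanSpace.proj i : Eu d →L[ℝ] ℝ).continuous.measurable
  exact measurable_const.sub (((h i).mul (h j)).div (measurable_norm.pow_const 2))

theorem SP.mm_meas (h : SP d α K a) : Measurable (mm d α a) := by
  unfold mm
  exact (h.meas.comp measurable_norm).mul (measurable_norm.pow_const _)

theorem SP.mm_nonneg (h : SP d α K a) (k : Eu d) : 0 ≤ mm d α a k :=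
  mul_nonneg (h.nonneg _ (norm_nonneg _)) (Real.rpow_nonneg (norm_nonneg _) _)

theorem SP.mm_supp (h : SP d α K a) (k : Eu d) (hk : K < ‖k‖) : mm d α a k = 0 := by
  unfold mm; rw [h.supp _ hk, zero_mul]

theorem SP.mm_le (h : SP d α K a) : ∃ C : ℝ, 0 < C ∧ ∀ k : Eu d,
    ENNReal.ofReal (mm d α a k) ≤ ENNReal.ofReal C * ∏ i, phi (gam d α i) K (k i) := by
  obtain ⟨M, hM⟩ := h.bdd
  have hM0 : 1 ≤ M := by have := hM 0 le_rfl; rwa [h.one] at this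
  have hK := h.hK
  set s := ∑ i, gam d α i with hs
  set β := 2 * α + (d : ℝ) - 2 with hβ
  have hsβ : β ≤ s := h.gam_sum
  refine ⟨M * K ^ (s - β), by positivity, fun k => ?_⟩
  rcases lt_or_ge K ‖k‖ with hk | hk
  · rw [h.mm_supp k hk]; simp
  have hki : ∀ i, |k i| ≤ K := fun i => (PiLp.norm_apply_le k i).trans hk
  have hC : ENNReal.ofReal (M * K ^ (s - β)) ≠ 0 := by
    rw [ENNReal.ofReal_ne_zero_iff]; positivity
  have hph : ∀ i, phi (gam d α i) K (k i) = ENNReal.ofReal |k i| ^ (-gam d α i) := fun i => by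
    unfold phi; rw [if_pos (hki i)]
  simp only [hph]
  have hpos : ∀ i, ENNReal.ofReal ‖k‖ ^ (-gam d α i) ≤ ENNReal.ofReal |k i| ^ (-gam d α i) := by
    intro i
    rw [ENNReal.rpow_neg, ENNReal.rpow_neg, ENNReal.inv_le_inv]
    exact ENNReal.rpow_le_rpow (ENNReal.ofReal_le_ofReal (PiLp.norm_apply_le k i)) (h.gam_nonneg i)
  have hprod : ∏ i, ENNReal.ofReal ‖k‖ ^ (-gam d α i) ≤ ∏ i, ENNReal.ofReal |k i| ^ (-gam d α i) :=
    Finset.prod_le_prod' fun i _ => hpos i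
  refine le_trans ?_ (mul_le_mul_right hprod _)
  rcases eq_or_ne k 0 with rfl | hk0
  · have hz : ∏ i, ENNReal.ofReal ‖(0 : Eu d)‖ ^ (-gam d α i) = ⊤ := by
      have hd0 : 0 < d := by have := h.hd; omega
      have hp : ∀ i : Fin d, ENNReal.ofReal ‖(0 : Eu d)‖ ^ (-gam d α i) ≠ 0 := by
        intro i
        have := h.gam_nonneg i
        rcases this.eq_or_lt with h0 | h0
        · rw [← h0]; simp
        · simp [ENNReal.zero_rpow_of_neg (show -gam d α i < 0 by linarith)]
      rw [← Finset.mul_prod_erase _ _ (Finset.mem_univ (⟨0, hd0⟩ : Fin d))]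
      have : 0 < gam d α (⟨0, hd0⟩ : Fin d) := by
        unfold gam; rw [if_pos (by simp)]
        have : 0 ≤ max α 0 := le_max_right _ _
        linarith
      rw [norm_zero, ENNReal.ofReal_zero, ENNReal.zero_rpow_of_neg (by linarith)]
      refine ENNReal.top_mul ?_
      rw [Finset.prod_ne_zero_iff]
      intro i _
      simpa using hp i
    rw [hz, ENNReal.mul_top hC]; exact le_top
  · have hk1 : 0 < ‖k‖ := norm_pos_iff.2 hk0
    have : ∀ i, ENNReal.ofReal ‖k‖ ^ (-gam d α i) = ENNReal.ofReal (‖k‖ ^ (-gam d α i)) := fun i =>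
      ENNReal.ofReal_rpow_of_pos hk1
    simp only [this]
    rw [← ENNReal.ofReal_prod_of_nonneg (fun i _ => by positivity), ← Real.rpow_sum_of_pos hk1,
      Finset.sum_neg_distrib, ← ENNReal.ofReal_mul (by positivity)]
    refine ENNReal.ofReal_le_ofReal ?_
    unfold mm
    rw [← hs, ← hβ]
    have e : ‖k‖ ^ (-β) = ‖k‖ ^ (s - β) * ‖k‖ ^ (-s) := by
      rw [← Real.rpow_add hk1]; ring_nf
    rw [e, ← mul_assoc]
    gcongr
    exact hM _ (norm_nonneg _)

theorem lintegral_fin_prod : ∀ (n : ℕ) (f : Fin n → ℝ → ENNReal), (∀ i, Measurable (f i)) →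
    ∫⁻ k : Fin n → ℝ, ∏ i, f i (k i) = ∏ i, ∫⁻ x, f i x
  | 0, f, _ => by
      rw [volume_pi, Measure.pi_of_empty]; simp
  | n + 1, f, hf => by
      have mp := (volume_preserving_piFinSuccAbove (fun _ : Fin (n + 1) => ℝ) 0).symm
      rw [← mp.lintegral_comp (f := fun k : Fin (n + 1) → ℝ => ∏ i, f i (k i)) (Finset.measurable_prod _ fun i _ => (hf i).comp (measurable_pi_apply i))]
      rw [Measure.volume_eq_prod]
      simp only [Fin.prod_univ_succ, MeasurableEquiv.piFinSuccAbove_symm_apply, Fin.insertNthEquiv,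
        Equiv.coe_fn_mk, Fin.insertNth_zero, Fin.cons_zero, Fin.cons_succ, cast_eq]
      rw [lintegral_prod_mul (f := f 0) (g := fun k : Fin n → ℝ => ∏ i, f i.succ (k i)) (hf 0).aemeasurable (Finset.measurable_prod _ fun i _ =>
        (hf i.succ).comp (measurable_pi_apply i)).aemeasurable]
      rw [← lintegral_fin_prod n (fun i => f i.succ) fun i => hf _]

theorem lintegral_eu_prod (f : Fin d → ℝ → ENNReal) (hf : ∀ i, Measurable (f i)) :
    ∫⁻ k : Eu d, ∏ i, f i (k i) = ∏ i, ∫⁻ x, f i x := by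
  rw [← lintegral_fin_prod d f hf]
  exact (EuclideanSpace.volume_preserving_symm_measurableEquiv_toLp (Fin d)).lintegral_comp
    (f := fun k : Fin d → ℝ => ∏ i, f i (k i))
    (Finset.measurable_prod _ fun i _ => (hf i).comp (measurable_pi_apply i))

theorem SP.mm_integrable (h : SP d α K a) : Integrable (mm d α a) := by
  refine ⟨h.mm_meas.aestronglyMeasurable, ?_⟩
  obtain ⟨C, hC, hm⟩ := h.mm_le
  unfold HasFiniteIntegral
  refine lt_of_le_of_lt (lintegral_mono (g := fun k => ENNReal.ofReal C * ∏ i, phi (gam d α i) K (k i))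
    fun k => ?_) ?_
  · simp only
    rw [Real.enorm_eq_ofReal (h.mm_nonneg k)]; exact hm k
  · rw [lintegral_const_mul' _ _ ENNReal.ofReal_ne_top,
      lintegral_eu_prod (fun i => phi (gam d α i) K) (fun i => phi_meas _ _)]
    exact ENNReal.mul_lt_top ENNReal.ofReal_lt_top
      (ENNReal.prod_lt_top fun i _ => phi_lt_top _ _ (h.gam_lt_one i))

theorem SP.hk_integrable (h : SP d α K a) (i j : Fin d) :
    Integrable fun k => mm d α a k * pp i j k := by
  refine (h.mm_integrable.mul_const 2).mono' (h.mm_meas.mul (pp_meas i j)).aestronglyMeasurable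
    (ae_of_all _ fun k => ?_)
  rw [norm_mul, Real.norm_of_nonneg (h.mm_nonneg k)]
  exact mul_le_mul_of_nonneg_left (pp_le i j k) (h.mm_nonneg k)

end
end KP


namespace KP

section
variable {d : ℕ} {α K : ℝ} {a : ℝ → ℝ}

theorem SP.cos_integrable (h : SP d α K a) (i j : Fin d) (x : Eu d) :
    Integrable fun k => Real.cos ⟪k, x⟫ * (mm d α a k * pp i j k) := by
  refine (h.hk_integrable i j).bdd_mul (c := 1) (Continuous.aestronglyMeasurable (by fun_prop))
    (ae_of_all _ fun z => by simpa using Real.abs_cos_le_one _)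

theorem SP.R_bdd (h : SP d α K a) : ∃ B : ℝ, 0 < B ∧ ∀ x i j, |covEntry d α a x i j| ≤ B := by
  have h0 : 0 ≤ ∫ k, mm d α a k * 2 :=
    integral_nonneg fun k => mul_nonneg (h.mm_nonneg k) (by norm_num)
  refine ⟨(∫ k, mm d α a k * 2) + 1, by linarith, fun x i j => ?_⟩
  have : |covEntry d α a x i j| ≤ ∫ k, mm d α a k * 2 := by
    rw [covEntry_eq, ← Real.norm_eq_abs]
    refine norm_integral_le_of_norm_le (h.mm_integrable.mul_const 2) (ae_of_all _ fun k => ?_)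
    rw [norm_mul, norm_mul, Real.norm_of_nonneg (h.mm_nonneg k)]
    refine (mul_le_of_le_one_left (mul_nonneg (h.mm_nonneg k) (norm_nonneg _))
      (by simpa using Real.abs_cos_le_one _)).trans ?_
    exact mul_le_mul_of_nonneg_left (pp_le i j k) (h.mm_nonneg k)
  linarith

theorem SP.R_cont (h : SP d α K a) (i j : Fin d) : Continuous fun x => covEntry d α a x i j := by
  simp only [covEntry_eq]
  refine continuous_of_dominated (bound := fun k => ‖mm d α a k * pp i j k‖)
    (fun x => (h.cos_integrable i j x).aestronglyMeasurable) (fun x => ae_of_all _ fun k => ?_)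
    (h.hk_integrable i j).norm (ae_of_all _ fun k => by fun_prop)
  rw [norm_mul]
  exact mul_le_of_le_one_left (norm_nonneg _) (by simpa using Real.abs_cos_le_one _)

theorem pp_sum (k l : Eu d) : ∑ i, ∑ j, pp i j k * pp i j l =
    d - ‖k‖ ^ 2 / ‖k‖ ^ 2 - ‖l‖ ^ 2 / ‖l‖ ^ 2 + ⟪k, l⟫ ^ 2 / (‖k‖ ^ 2 * ‖l‖ ^ 2) := by
  have e : ∀ i j, pp i j k * pp i j l = (if i = j then (1:ℝ) else 0) -
      (if i = j then k i * k j / ‖k‖ ^ 2 else 0) - (if i = j then l i * l j / ‖l‖ ^ 2 else 0) +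
      (k i * l i) * (k j * l j) / (‖k‖ ^ 2 * ‖l‖ ^ 2) := by
    intro i j
    unfold pp
    split_ifs
    · rw [mul_div_assoc, mul_div_assoc]; ring
    · ring
  have hn : ∀ k : Eu d, ∑ i, k i * k i = ‖k‖ ^ 2 := by
    intro k
    rw [EuclideanSpace.real_norm_sq_eq]
    exact Finset.sum_congr rfl fun i _ => (sq _).symm
  have hi : ∑ i, k i * l i = ⟪k, l⟫ := by
    rw [PiLp.inner_apply]
    exact Finset.sum_congr rfl fun i _ => by simp [mul_comm]
  simp only [e, Finset.sum_add_distrib, Finset.sum_sub_distrib, Finset.sum_ite_eq, Finset.mem_univ,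
    if_true, ← Finset.sum_div, hn]
  simp only [← Finset.mul_sum, ← Finset.sum_mul, hi]
  simp [sq]

/-- Sum of squares of the covariance entries. -/
noncomputable def NN (d : ℕ) (α : ℝ) (a : ℝ → ℝ) (x : Eu d) : ℝ :=
  ∑ i, ∑ j, covEntry d α a x i j ^ 2

theorem SP.NN_eq (h : SP d α K a) (x : Eu d) : NN d α a x =
    ∫ z : Eu d × Eu d, Real.cos ⟪z.1, x⟫ * Real.cos ⟪z.2, x⟫ * (mm d α a z.1 * mm d α a z.2) *
      (d - ‖z.1‖ ^ 2 / ‖z.1‖ ^ 2 - ‖z.2‖ ^ 2 / ‖z.2‖ ^ 2 +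
        ⟪z.1, z.2⟫ ^ 2 / (‖z.1‖ ^ 2 * ‖z.2‖ ^ 2)) := by
  unfold NN
  have e : ∀ i j, covEntry d α a x i j ^ 2 = ∫ z : Eu d × Eu d,
      (Real.cos ⟪z.1, x⟫ * (mm d α a z.1 * pp i j z.1)) *
      (Real.cos ⟪z.2, x⟫ * (mm d α a z.2 * pp i j z.2)) := by
    intro i j
    rw [sq, covEntry_eq, ← integral_prod_mul]; rfl
  have hi : ∀ i j, Integrable (fun z : Eu d × Eu d =>
      (Real.cos ⟪z.1, x⟫ * (mm d α a z.1 * pp i j z.1)) *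
      (Real.cos ⟪z.2, x⟫ * (mm d α a z.2 * pp i j z.2))) := fun i j =>
    (h.cos_integrable i j x).mul_prod (h.cos_integrable i j x)
  simp only [e]
  rw [Finset.sum_congr rfl fun i _ => (integral_finsetSum _ fun j _ => hi i j).symm,
    ← integral_finsetSum _ fun i _ => integrable_finsetSum _ fun j _ => hi i j]
  refine integral_congr_ae (ae_of_all _ fun z => ?_)
  simp only
  rw [← pp_sum, Finset.mul_sum]
  refine Finset.sum_congr rfl fun i _ => ?_
  rw [Finset.mul_sum]
  refine Finset.sum_congr rfl fun j _ => ?_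
  ring

theorem exists_isometry (x y : Eu d) (hxy : ‖x‖ = ‖y‖) : ∃ U : Eu d ≃ₗᵢ[ℝ] Eu d, U x = y :=
  ⟨_, Submodule.reflection_sub hxy⟩

theorem SP.NN_radial (h : SP d α K a) (x y : Eu d) (hxy : ‖x‖ = ‖y‖) : NN d α a x = NN d α a y := by
  obtain ⟨U, hU⟩ := exists_isometry y x hxy.symm
  rw [h.NN_eq, h.NN_eq]
  have mp : MeasurePreserving (Prod.map U U) (volume.prod volume) (volume.prod volume) :=
    U.measurePreserving.prod U.measurePreserving
  have me : MeasurableEmbedding (Prod.map U U) :=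
    (U.toHomeomorph.toMeasurableEquiv.prodCongr U.toHomeomorph.toMeasurableEquiv).measurableEmbedding
  rw [Measure.volume_eq_prod, ← mp.integral_comp me]
  refine integral_congr_ae (ae_of_all _ fun z => ?_)
  simp only [Prod.map_fst, Prod.map_snd, U.norm_map, U.inner_map_map, ← hU, mm]

end
end KP


namespace KP

/-- one-dimensional gaussian kernel -/
noncomputable def gk (ε x : ℝ) : ℝ := Real.sqrt (Real.pi / ε) * Real.exp (-x ^ 2 / (4 * ε))

theorem gk_nonneg (ε x : ℝ) : 0 ≤ gk ε x := by unfold gk; positivity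

theorem gk_cont (ε : ℝ) : Continuous (gk ε) := by unfold gk; fun_prop

theorem gk_lint (ε : ℝ) (hε : 0 < ε) : ∫⁻ x, ENNReal.ofReal (gk ε x) = ENNReal.ofReal (2 * Real.pi) := by
  have e : ∀ x, gk ε x = Real.sqrt (Real.pi / ε) * Real.exp (-(1 / (4 * ε)) * x ^ 2) := by
    intro x; unfold gk; congr 2; ring
  have hi : Integrable (gk ε) := by
    have : gk ε = fun x => Real.sqrt (Real.pi / ε) * Real.exp (-(1 / (4 * ε)) * x ^ 2) := funext e
    rw [this]
    exact (integrable_exp_neg_mul_sq (by positivity)).const_mul _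
  rw [← ofReal_integral_eq_lintegral_ofReal hi (ae_of_all _ fun x => gk_nonneg ε x)]
  congr 1
  simp only [e]
  rw [integral_const_mul, integral_gaussian, ← Real.sqrt_mul (by positivity)]
  have : Real.pi / ε * (Real.pi / (1 / (4 * ε))) = (2 * Real.pi) ^ 2 := by field_simp; ring
  rw [this, Real.sqrt_sq (by positivity)]

theorem gauss2_integrable (ε : ℝ) (hε : 0 < ε) : Integrable fun p : Eu 2 => Real.exp (-ε * ‖p‖ ^ 2) := by
  have := GaussianFourier.integrable_cexp_neg_mul_sq_norm_add (V := Eu 2) (b := (ε : ℂ))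
    (by simpa using hε) 0 0
  refine this.norm.congr (ae_of_all _ fun p => ?_)
  simp only [zero_mul, add_zero, Complex.norm_exp]
  congr 1
  norm_cast

theorem gauss2_cos (ε : ℝ) (hε : 0 < ε) (w : Eu 2) :
    ∫ p : Eu 2, Real.exp (-ε * ‖p‖ ^ 2) * Real.cos ⟪w, p⟫ = gk ε (w 0) * gk ε (w 1) := by
  have h1 := GaussianFourier.integral_cexp_neg_mul_sq_norm_add_of_euclideanSpace (ι := Fin 2) (b := (ε : ℂ))
    (by simpa using hε) Complex.I w
  have hintg := GaussianFourier.integrable_cexp_neg_mul_sq_norm_add (V := Eu 2) (b := (ε : ℂ))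
    (by simpa using hε) Complex.I w
  have h2 := integral_re hintg
  rw [h1] at h2
  have e : ∀ p : Eu 2, RCLike.re (Complex.exp (-(ε:ℂ) * (‖p‖:ℂ) ^ 2 + Complex.I * (⟪w, p⟫ : ℝ))) =
      Real.exp (-ε * ‖p‖ ^ 2) * Real.cos ⟪w, p⟫ := by
    intro p
    have : -(ε:ℂ) * (‖p‖:ℂ) ^ 2 + Complex.I * (⟪w, p⟫ : ℝ) =
      ((-ε * ‖p‖ ^ 2 : ℝ) : ℂ) + (⟪w, p⟫ : ℝ) * Complex.I := by push_cast; ring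
    rw [this]
    simp [Complex.exp_re, -Complex.ofReal_mul, -Complex.ofReal_neg, -Complex.ofReal_pow]
  simp only [e] at h2
  rw [h2]
  have e2 : (Real.pi / (ε:ℂ)) ^ ((Fintype.card (Fin 2) : ℂ) / 2) *
      Complex.exp (Complex.I ^ 2 * (‖w‖:ℂ) ^ 2 / (4 * ε)) =
      ((Real.pi / ε * Real.exp (-‖w‖ ^ 2 / (4 * ε)) : ℝ) : ℂ) := by
    simp
  rw [e2]
  have e3 : RCLike.re ((Real.pi / ε * Real.exp (-‖w‖ ^ 2 / (4 * ε)) : ℝ) : ℂ) =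
    Real.pi / ε * Real.exp (-‖w‖ ^ 2 / (4 * ε)) := Complex.ofReal_re _
  rw [e3]
  unfold gk
  have e4 : ‖w‖ ^ 2 = w 0 ^ 2 + w 1 ^ 2 := by
    rw [EuclideanSpace.real_norm_sq_eq]; simp [Fin.sum_univ_two]
  rw [e4, mul_mul_mul_comm, Real.mul_self_sqrt (by positivity), ← Real.exp_add]
  congr 2; ring

theorem schur1 (f : ℝ → ENNReal) (hf : Measurable f) (g : ℝ → ENNReal) (hg : Measurable g) (C : ENNReal)
    (hC : ∫⁻ x, g x ≤ C) (σ : ℝ) (hσ : σ = 1 ∨ σ = -1) :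
    ∫⁻ x, f x * ∫⁻ y, f y * g (x - σ * y) ≤ 2 * C * ∫⁻ x, f x ^ 2 := by
  have hab : ∀ a b : ENNReal, a * b ≤ a ^ 2 + b ^ 2 := by
    intro a b
    rcases le_total a b with h | h
    · refine le_trans ?_ (le_add_left (le_refl (b ^ 2)))
      rw [sq]; gcongr
    · refine le_trans ?_ (le_add_right (le_refl (a ^ 2)))
      rw [sq]; gcongr
  have hm2 : Measurable fun z : ℝ × ℝ => g (z.1 - σ * z.2) := hg.comp (by fun_prop)
  have hgx : ∀ x, ∫⁻ y, g (x - σ * y) ≤ C := by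
    intro x
    rcases hσ with rfl | rfl
    · simp only [one_mul]; rwa [lintegral_sub_left_eq_self g x]
    · simp only [neg_mul, one_mul, sub_neg_eq_add]
      rwa [lintegral_add_left_eq_self g x]
  have hgy : ∀ y, ∫⁻ x, g (x - σ * y) ≤ C := by
    intro y
    rwa [lintegral_sub_right_eq_self g (σ * y)]
  calc _ = ∫⁻ x, ∫⁻ y, f x * (f y * g (x - σ * y)) := by
        refine lintegral_congr fun x => ?_
        rw [lintegral_const_mul]
        exact hf.mul (hg.comp (by fun_prop))
    _ ≤ ∫⁻ x, ∫⁻ y, (f x ^ 2 * g (x - σ * y) + f y ^ 2 * g (x - σ * y)) := by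
        refine lintegral_mono fun x => lintegral_mono fun y => ?_
        rw [← mul_assoc, ← add_mul]
        gcongr
        exact hab _ _
    _ = (∫⁻ x, f x ^ 2 * ∫⁻ y, g (x - σ * y)) + ∫⁻ y, f y ^ 2 * ∫⁻ x, g (x - σ * y) := by
        have h1 : ∀ x, ∫⁻ y, (f x ^ 2 * g (x - σ * y) + f y ^ 2 * g (x - σ * y)) =
            f x ^ 2 * (∫⁻ y, g (x - σ * y)) + ∫⁻ y, f y ^ 2 * g (x - σ * y) := by
          intro x
          have hm : Measurable fun y => g (x - σ * y) := hg.comp (by fun_prop)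
          rw [lintegral_add_left (hm.const_mul _), lintegral_const_mul _ hm]
        simp only [h1]
        rw [lintegral_add_left (f := fun x => f x ^ 2 * ∫⁻ y, g (x - σ * y)) ((hf.pow_const 2).mul (Measurable.lintegral_prod_right' hm2))]
        congr 1
        rw [lintegral_lintegral_swap]
        · refine lintegral_congr fun y => ?_
          rw [lintegral_const_mul]
          exact hg.comp (by fun_prop)
        · exact (((hf.comp measurable_snd).pow_const 2).mul hm2).aemeasurable
    _ ≤ (∫⁻ x, f x ^ 2 * C) + ∫⁻ y, f y ^ 2 * C := by
        gcongr with x y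
        · exact hgx x
        · exact hgy y
    _ = _ := by
        rw [lintegral_mul_const _ (hf.pow_const 2)]; ring

end KP


namespace KP
section
variable {d : ℕ} {α K : ℝ} {a : ℝ → ℝ}

/-- embedding of a plane -/
noncomputable def io (i0 i1 : Fin d) (p : Eu 2) : Eu d :=
  EuclideanSpace.single i0 (p 0) + EuclideanSpace.single i1 (p 1)

theorem io_inner (i0 i1 : Fin d) (p : Eu 2) (k : Eu d) : ⟪k, io i0 i1 p⟫ = k i0 * p 0 + k i1 * p 1 := by
  unfold io
  rw [inner_add_right, EuclideanSpace.inner_single_right, EuclideanSpace.inner_single_right]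
  simp [mul_comm]

theorem io_cont (i0 i1 : Fin d) : Continuous (io i0 i1) := by
  have h : io i0 i1 = fun p : Eu 2 => p 0 • EuclideanSpace.single i0 (1:ℝ) + p 1 • EuclideanSpace.single i1 (1:ℝ) := by
    ext p i; simp [io]
  rw [h]; fun_prop

theorem io_norm (i0 i1 : Fin d) (h : i0 ≠ i1) (p : Eu 2) : ‖io i0 i1 p‖ = ‖p‖ := by
  have h1 : ‖io i0 i1 p‖ ^ 2 = ‖p‖ ^ 2 := by
    rw [← real_inner_self_eq_norm_sq, io_inner, EuclideanSpace.real_norm_sq_eq]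
    simp [io, h, h.symm, Fin.sum_univ_two, sq]
  exact (sq_eq_sq₀ (norm_nonneg _) (norm_nonneg _)).1 h1

theorem gauss_coscos (ε : ℝ) (hε : 0 < ε) (i0 i1 : Fin d) (z1 z2 : Eu d) :
    ∫ p : Eu 2, Real.exp (-ε * ‖p‖ ^ 2) * (Real.cos ⟪z1, io i0 i1 p⟫ * Real.cos ⟪z2, io i0 i1 p⟫) =
      (gk ε (z1 i0 - z2 i0) * gk ε (z1 i1 - z2 i1) + gk ε (z1 i0 + z2 i0) * gk ε (z1 i1 + z2 i1)) / 2 := by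
  have hintg : ∀ w : Eu 2, Integrable fun p : Eu 2 => Real.exp (-ε * ‖p‖ ^ 2) * Real.cos ⟪w, p⟫ := by
    intro w
    refine (gauss2_integrable ε hε).mul_bdd (c := 1) (Continuous.aestronglyMeasurable (by fun_prop))
      (ae_of_all _ fun z => by simpa using Real.abs_cos_le_one _)
  set w1 : Eu 2 := !₂[z1 i0 - z2 i0, z1 i1 - z2 i1] with hw1
  set w2 : Eu 2 := !₂[z1 i0 + z2 i0, z1 i1 + z2 i1] with hw2
  have e : ∀ p : Eu 2, Real.exp (-ε * ‖p‖ ^ 2) * (Real.cos ⟪z1, io i0 i1 p⟫ * Real.cos ⟪z2, io i0 i1 p⟫) =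
      (Real.exp (-ε * ‖p‖ ^ 2) * Real.cos ⟪w1, p⟫ + Real.exp (-ε * ‖p‖ ^ 2) * Real.cos ⟪w2, p⟫) / 2 := by
    intro p
    rw [io_inner, io_inner]
    have h1 : ⟪w1, p⟫ = (z1 i0 * p 0 + z1 i1 * p 1) - (z2 i0 * p 0 + z2 i1 * p 1) := by
      rw [PiLp.inner_apply, Fin.sum_univ_two]; simp [hw1]; ring
    have h2 : ⟪w2, p⟫ = (z1 i0 * p 0 + z1 i1 * p 1) + (z2 i0 * p 0 + z2 i1 * p 1) := by
      rw [PiLp.inner_apply, Fin.sum_univ_two]; simp [hw2]; ring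
    rw [h1, h2]
    generalize z1 i0 * p 0 + z1 i1 * p 1 = A
    generalize z2 i0 * p 0 + z2 i1 * p 1 = B
    rw [Real.cos_sub, Real.cos_add]; ring
  simp only [e]
  rw [integral_div, integral_add (hintg w1) (hintg w2), gauss2_cos ε hε, gauss2_cos ε hε]
  simp [hw1, hw2]

theorem SP.schur2 (h : SP d α K a) (i0 i1 : Fin d) (h0 : i0.val = 0) (h1 : i1.val = 1) :
    ∃ C : ENNReal, C < ⊤ ∧ ∀ ε : ℝ, 0 < ε → ∀ σ : ℝ, (σ = 1 ∨ σ = -1) →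
      ∫⁻ x : Eu d, ∫⁻ y : Eu d, ENNReal.ofReal (mm d α a x) * ENNReal.ofReal (mm d α a y) *
        ENNReal.ofReal (gk ε (x i0 - σ * y i0) * gk ε (x i1 - σ * y i1)) ≤ C := by
  obtain ⟨M, hM, hmm⟩ := h.mm_le
  set CC : Fin d → ENNReal := fun i => if i.val < 2 then 2 * ENNReal.ofReal (2 * Real.pi) * ∫⁻ x, phi (2 * gam d α i) K x
    else (∫⁻ x, phi (gam d α i) K x) * (∫⁻ x, phi (gam d α i) K x) with hCC
  have hCCt : ∀ i, CC i < ⊤ := by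
    intro i
    simp only [hCC]
    split_ifs with hi
    · exact ENNReal.mul_lt_top (ENNReal.mul_lt_top (by simp) ENNReal.ofReal_lt_top) (phi_lt_top _ _ (h.gam_lt_half i hi))
    · exact ENNReal.mul_lt_top (phi_lt_top _ _ (h.gam_lt_one i)) (phi_lt_top _ _ (h.gam_lt_one i))
  refine ⟨ENNReal.ofReal M * ENNReal.ofReal M * ∏ i, CC i,
    ENNReal.mul_lt_top (ENNReal.mul_lt_top ENNReal.ofReal_lt_top ENNReal.ofReal_lt_top)
      (ENNReal.prod_lt_top fun i _ => hCCt i), fun ε hε σ hσ => ?_⟩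
  set G : Fin d → ℝ → ENNReal := fun i x => if i.val < 2 then ENNReal.ofReal (gk ε x) else 1 with hG
  have hGm : ∀ i, Measurable (G i) := by
    intro i
    simp only [hG]
    split_ifs
    · exact (gk_cont ε).measurable.ennreal_ofReal
    · exact measurable_const
  have hprod : ∀ u : Fin d → ℝ, ∏ i, G i (u i) = ENNReal.ofReal (gk ε (u i0) * gk ε (u i1)) := by
    intro u
    obtain ⟨n, rfl⟩ : ∃ n, d = n + 2 := ⟨d - 2, by have := h.hd; omega⟩
    have hi0 : i0 = 0 := Fin.ext h0
    have hi1 : i1 = 1 := Fin.ext (by simp [h1])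
    rw [Fin.prod_univ_succ, Fin.prod_univ_succ]
    have : ∀ i : Fin n, G i.succ.succ (u i.succ.succ) = 1 := by
      intro i; simp [hG]
    rw [Finset.prod_congr rfl fun i _ => this i, ENNReal.ofReal_mul (gk_nonneg _ _), hi0, hi1]
    simp [hG]
  set f : Fin d → ℝ → ENNReal := fun i => phi (gam d α i) K with hf
  have hfm : ∀ i, Measurable (f i) := fun i => phi_meas _ _
  have hcm : Measurable fun z : ℝ × ℝ => z.1 - σ * z.2 := by fun_prop
  have hcx : ∀ x, Measurable fun y : ℝ => x - σ * y := by intro x; fun_prop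
  have hgm : ∀ i, Measurable fun x => ∫⁻ y, f i y * G i (x - σ * y) := by
    intro i
    exact Measurable.lintegral_prod_right' (f := fun z : ℝ × ℝ => f i z.2 * G i (z.1 - σ * z.2))
      (((hfm i).comp measurable_snd).mul ((hGm i).comp hcm))
  have hone : ∀ i, ∫⁻ x, f i x * ∫⁻ y, f i y * G i (x - σ * y) ≤ CC i := by
    intro i
    by_cases hi : i.val < 2
    · have := schur1 (f i) (hfm i) (G i) (hGm i) (ENNReal.ofReal (2 * Real.pi))
        (by simp only [hG, if_pos hi]; exact (gk_lint ε hε).le) σ hσ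
      refine this.trans (le_of_eq ?_)
      simp only [hCC, if_pos hi, hf, phi_sq]
    · simp only [hG, hCC, if_neg hi, mul_one]
      rw [lintegral_mul_const _ (hfm i)]
  calc _ ≤ ∫⁻ x : Eu d, ∫⁻ y : Eu d, ENNReal.ofReal M * ENNReal.ofReal M *
        ((∏ i, f i (x i)) * ∏ i, (f i (y i) * G i (x i - σ * y i))) := by
        refine lintegral_mono fun x => lintegral_mono fun y => ?_
        rw [← hprod fun i => x i - σ * y i]
        calc _ ≤ (ENNReal.ofReal M * ∏ i, f i (x i)) * (ENNReal.ofReal M * ∏ i, f i (y i)) *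
            ∏ i, G i (x i - σ * y i) := by
              gcongr
              · exact hmm x
              · exact hmm y
          _ = _ := by rw [Finset.prod_mul_distrib]; ring
    _ = ENNReal.ofReal M * ENNReal.ofReal M * ∫⁻ x : Eu d,
        ∏ i, (f i (x i) * ∫⁻ y, f i y * G i (x i - σ * y)) := by
        rw [← lintegral_const_mul' _ _ (ENNReal.mul_ne_top ENNReal.ofReal_ne_top ENNReal.ofReal_ne_top)]
        refine lintegral_congr fun x => ?_
        rw [lintegral_const_mul' _ _ (ENNReal.mul_ne_top ENNReal.ofReal_ne_top ENNReal.ofReal_ne_top)]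
        congr 1
        have hme : ∀ i, Measurable fun y => f i y * G i (x i - σ * y) :=
          fun i => (hfm i).mul ((hGm i).comp (hcx _))
        rw [lintegral_const_mul, lintegral_eu_prod (fun i y => f i y * G i (x i - σ * y)) hme,
          Finset.prod_mul_distrib]
        exact Finset.measurable_prod _ fun i _ => (hme i).comp (EuclideanSpace.proj i : Eu d →L[ℝ] ℝ).continuous.measurable
    _ = ENNReal.ofReal M * ENNReal.ofReal M * ∏ i, ∫⁻ x, f i x * ∫⁻ y, f i y * G i (x - σ * y) := by
        congr 1
        exact lintegral_eu_prod (fun i x => f i x * ∫⁻ y, f i y * G i (x - σ * y)) fun i => (hfm i).mul (hgm i)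
    _ ≤ _ := by
        gcongr with i
        exact hone i

theorem SP.gauss_R (h : SP d α K a) (i0 i1 : Fin d) (h0 : i0.val = 0) (h1 : i1.val = 1) (i j : Fin d) :
    ∃ C : ENNReal, C < ⊤ ∧ ∀ ε : ℝ, 0 < ε →
      ∫⁻ p : Eu 2, ENNReal.ofReal (Real.exp (-ε * ‖p‖ ^ 2) * covEntry d α a (io i0 i1 p) i j ^ 2) ≤ C := by
  obtain ⟨C, hC, hs⟩ := h.schur2 i0 i1 h0 h1
  refine ⟨4 * (C + C), by finiteness, fun ε hε => ?_⟩
  have hioc := io_cont i0 i1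
  obtain ⟨B, hB, hR⟩ := h.R_bdd
  have hintg : Integrable fun p : Eu 2 => Real.exp (-ε * ‖p‖ ^ 2) * covEntry d α a (io i0 i1 p) i j ^ 2 := by
    refine (gauss2_integrable ε hε).mul_bdd (c := B ^ 2)
      (Continuous.aestronglyMeasurable (((h.R_cont i j).comp hioc).pow 2)) (ae_of_all _ fun p => ?_)
    rw [Real.norm_eq_abs, abs_pow]
    exact pow_le_pow_left₀ (abs_nonneg _) (hR _ _ _) 2
  rw [← ofReal_integral_eq_lintegral_ofReal hintg (ae_of_all _ fun p => by positivity)]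
  set H : Eu d → ℝ := fun k => mm d α a k * pp i j k with hH
  have hHi : Integrable H := h.hk_integrable i j
  have e1 : ∀ p, Real.exp (-ε * ‖p‖ ^ 2) * covEntry d α a (io i0 i1 p) i j ^ 2 =
      ∫ z : Eu d × Eu d, Real.exp (-ε * ‖p‖ ^ 2) * (Real.cos ⟪z.1, io i0 i1 p⟫ * Real.cos ⟪z.2, io i0 i1 p⟫) * (H z.1 * H z.2) := by
    intro p
    rw [sq (covEntry _ _ _ _ _ _), covEntry_eq, ← integral_prod_mul, ← integral_const_mul]
    refine integral_congr_ae (ae_of_all _ fun z => ?_)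
    simp only [hH]; ring
  have hbig : Integrable (Function.uncurry fun (p : Eu 2) (z : Eu d × Eu d) =>
      Real.exp (-ε * ‖p‖ ^ 2) * (Real.cos ⟪z.1, io i0 i1 p⟫ * Real.cos ⟪z.2, io i0 i1 p⟫) * (H z.1 * H z.2))
      (volume.prod volume) := by
    have h1 : Integrable (fun q : Eu 2 × (Eu d × Eu d) => Real.exp (-ε * ‖q.1‖ ^ 2) * (H q.2.1 * H q.2.2))
        (volume.prod volume) :=
      (gauss2_integrable ε hε).mul_prod (hHi.mul_prod hHi)
    have h2 := h1.bdd_mul (c := 1) (f := fun q : Eu 2 × (Eu d × Eu d) => Real.cos ⟪q.2.1, io i0 i1 q.1⟫ * Real.cos ⟪q.2.2, io i0 i1 q.1⟫)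
      (Continuous.aestronglyMeasurable (by fun_prop)) (ae_of_all _ fun q => by
        rw [norm_mul]
        exact mul_le_one₀ (Real.abs_cos_le_one _) (norm_nonneg _) (Real.abs_cos_le_one _))
    refine h2.congr (ae_of_all _ fun q => ?_)
    simp only [Function.uncurry]; ring
  have e2 : ∫ p : Eu 2, Real.exp (-ε * ‖p‖ ^ 2) * covEntry d α a (io i0 i1 p) i j ^ 2 =
      ∫ z : Eu d × Eu d, (H z.1 * H z.2) * ((gk ε (z.1 i0 - z.2 i0) * gk ε (z.1 i1 - z.2 i1) + gk ε (z.1 i0 + z.2 i0) * gk ε (z.1 i1 + z.2 i1)) / 2) := by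
    simp only [e1]
    rw [integral_integral_swap hbig]
    refine integral_congr_ae (ae_of_all _ fun z => ?_)
    simp only
    rw [integral_mul_const, gauss_coscos ε hε, mul_comm]
  rw [e2]
  have hpr : ∀ i : Fin d, Measurable fun k : Eu d => k i := fun i =>
    (EuclideanSpace.proj i : Eu d →L[ℝ] ℝ).continuous.measurable
  have hgkm := (gk_cont ε).measurable
  have hHb : ∀ k, |H k| ≤ 2 * mm d α a k := by
    intro k
    simp only [hH]
    rw [abs_mul, abs_of_nonneg (h.mm_nonneg k), mul_comm]
    exact mul_le_mul_of_nonneg_right (pp_le i j k) (h.mm_nonneg k)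
  set T : ℝ → Eu d × Eu d → ENNReal := fun σ z => ENNReal.ofReal (mm d α a z.1) * ENNReal.ofReal (mm d α a z.2) *
        ENNReal.ofReal (gk ε (z.1 i0 - σ * z.2 i0) * gk ε (z.1 i1 - σ * z.2 i1)) with hT
  have hTm : ∀ σ, Measurable (T σ) := by
    intro σ
    refine ((h.mm_meas.comp measurable_fst).ennreal_ofReal.mul (h.mm_meas.comp measurable_snd).ennreal_ofReal).mul
      (Measurable.ennreal_ofReal ?_)
    exact (hgkm.comp (((hpr i0).comp measurable_fst).sub (((hpr i0).comp measurable_snd).const_mul _))).mul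
      (hgkm.comp (((hpr i1).comp measurable_fst).sub (((hpr i1).comp measurable_snd).const_mul _)))
  have hTi : ∀ σ, (σ = 1 ∨ σ = -1) → ∫⁻ z, T σ z ≤ C := by
    intro σ hσ
    rw [Measure.volume_eq_prod, lintegral_prod _ (hTm σ).aemeasurable]
    exact hs ε hε σ hσ
  refine (ENNReal.ofReal_le_ofReal (le_abs_self _)).trans ?_
  rw [← Real.norm_eq_abs, ofReal_norm]
  refine (enorm_integral_le_lintegral_enorm _).trans ?_
  calc _ ≤ ∫⁻ z, 4 * (T 1 z + T (-1) z) := by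
        refine lintegral_mono fun z => ?_
        have hg := gk_nonneg ε
        have hm1 := h.mm_nonneg z.1
        have hm2 := h.mm_nonneg z.2
        have e3 : 4 * (T 1 z + T (-1) z) = ENNReal.ofReal (4 * (mm d α a z.1 * mm d α a z.2 *
          (gk ε (z.1 i0 - z.2 i0) * gk ε (z.1 i1 - z.2 i1)) + mm d α a z.1 * mm d α a z.2 *
          (gk ε (z.1 i0 + z.2 i0) * gk ε (z.1 i1 + z.2 i1)))) := by
          simp only [hT]
          rw [← ENNReal.ofReal_mul hm1, ← ENNReal.ofReal_mul (mul_nonneg hm1 hm2),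
            ← ENNReal.ofReal_mul (mul_nonneg hm1 hm2), ← ENNReal.ofReal_add, ENNReal.ofReal_mul (by norm_num)]
          · simp
          · exact mul_nonneg (mul_nonneg hm1 hm2) (mul_nonneg (hg _) (hg _))
          · exact mul_nonneg (mul_nonneg hm1 hm2) (mul_nonneg (hg _) (hg _))
        rw [e3, ← ofReal_norm]
        apply ENNReal.ofReal_le_ofReal
        have hA := mul_nonneg (hg (z.1 i0 - z.2 i0)) (hg (z.1 i1 - z.2 i1))
        have hB := mul_nonneg (hg (z.1 i0 + z.2 i0)) (hg (z.1 i1 + z.2 i1))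
        rw [norm_mul, norm_mul, Real.norm_eq_abs, Real.norm_eq_abs, Real.norm_eq_abs,
          abs_of_nonneg (a := (_ + _) / 2) (by linarith)]
        have hHH : |H z.1| * |H z.2| ≤ (2 * mm d α a z.1) * (2 * mm d α a z.2) :=
          mul_le_mul (hHb _) (hHb _) (abs_nonneg _) (by linarith)
        refine (mul_le_mul_of_nonneg_right hHH (by linarith)).trans ?_
        have := mul_nonneg (mul_nonneg hm1 hm2) (add_nonneg hA hB)
        nlinarith
    _ = 4 * ((∫⁻ z, T 1 z) + ∫⁻ z, T (-1) z) := by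
        rw [lintegral_const_mul (f := fun z => T 1 z + T (-1) z) _ ((hTm 1).add (hTm (-1))), lintegral_add_left (hTm 1)]
    _ ≤ _ := by
        gcongr
        · exact hTi 1 (Or.inl rfl)
        · exact hTi (-1) (Or.inr rfl)

theorem SP.NN_cont (h : SP d α K a) : Continuous (NN d α a) := by
  unfold NN
  exact continuous_finsetSum _ fun i _ => continuous_finsetSum _ fun j _ => (h.R_cont i j).pow 2

theorem NN_nonneg (x : Eu d) : 0 ≤ NN d α a x :=
  Finset.sum_nonneg fun i _ => Finset.sum_nonneg fun j _ => sq_nonneg _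

theorem SP.R_sq_int (h : SP d α K a) (i0 i1 : Fin d) (h0 : i0.val = 0) (h1 : i1.val = 1) (i j : Fin d) :
    Integrable fun p : Eu 2 => covEntry d α a (io i0 i1 p) i j ^ 2 := by
  have hc : Continuous fun p : Eu 2 => covEntry d α a (io i0 i1 p) i j ^ 2 :=
    ((h.R_cont i j).comp (io_cont i0 i1)).pow 2
  refine ⟨hc.aestronglyMeasurable, ?_⟩
  obtain ⟨C, hC, hb⟩ := h.gauss_R i0 i1 h0 h1 i j
  unfold HasFiniteIntegral
  refine lt_of_le_of_lt ?_ hC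
  set f : ℕ → Eu 2 → ENNReal := fun n p => ENNReal.ofReal (Real.exp (-(1 / ((n:ℝ) + 1)) * ‖p‖ ^ 2) * covEntry d α a (io i0 i1 p) i j ^ 2) with hf
  have hlim : ∀ p, ‖covEntry d α a (io i0 i1 p) i j ^ 2‖ₑ = liminf (fun n => f n p) atTop := by
    intro p
    refine (Tendsto.liminf_eq ?_).symm
    rw [Real.enorm_eq_ofReal (sq_nonneg _)]
    refine (ENNReal.continuous_ofReal.tendsto _).comp ?_
    have h1 : Tendsto (fun n : ℕ => Real.exp (-(1 / ((n:ℝ) + 1)) * ‖p‖ ^ 2) * covEntry d α a (io i0 i1 p) i j ^ 2) atTop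
      (nhds (Real.exp (-0 * ‖p‖ ^ 2) * covEntry d α a (io i0 i1 p) i j ^ 2)) := by
      refine Tendsto.mul_const _ ((Real.continuous_exp.tendsto _).comp (Tendsto.mul_const _ ?_))
      exact tendsto_one_div_add_atTop_nhds_zero_nat.neg
    simpa using h1
  simp only [hlim]
  refine (lintegral_liminf_le ?_).trans ?_
  · intro n
    exact (Continuous.measurable (by fun_prop)).ennreal_ofReal
  · refine liminf_le_of_frequently_le' (Frequently.of_forall fun n => hb _ (by positivity))

/-- radial profile -/
noncomputable def nn (d : ℕ) (α : ℝ) (a : ℝ → ℝ) (i0 : Fin d) (u : ℝ) : ℝ := NN d α a (EuclideanSpace.single i0 u)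

theorem SP.NN_nn (h : SP d α K a) (i0 : Fin d) (x : Eu d) : NN d α a x = nn d α a i0 ‖x‖ := by
  unfold nn
  apply h.NN_radial
  simp

theorem SP.nn_cont (h : SP d α K a) (i0 : Fin d) : Continuous (nn d α a i0) := by
  unfold nn
  refine h.NN_cont.comp ?_
  have : (fun u : ℝ => EuclideanSpace.single i0 u) = fun u : ℝ => u • EuclideanSpace.single i0 (1:ℝ) := by
    ext u i; simp
  exact (by fun_prop : Continuous fun u : ℝ => u • EuclideanSpace.single i0 (1:ℝ)).congr fun u => (congrFun this u).symm

theorem SP.nn_int (h : SP d α K a) (i0 : Fin d) (h0 : i0.val = 0) :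
    IntegrableOn (fun u => u * nn d α a i0 u) (Ioi 0) := by
  have hi1 : 1 < d := by have := h.hd; omega
  have hI : Integrable fun p : Eu 2 => nn d α a i0 ‖p‖ := by
    have : Integrable fun p : Eu 2 => NN d α a (io i0 ⟨1, hi1⟩ p) := by
      unfold NN
      exact integrable_finsetSum _ fun i _ => integrable_finsetSum _ fun j _ =>
        h.R_sq_int i0 ⟨1, hi1⟩ h0 rfl i j
    refine this.congr (ae_of_all _ fun p => ?_)
    simp only
    rw [h.NN_nn i0, io_norm]
    intro hh
    rw [hh] at h0; simp at h0
  have := (integrable_fun_norm_addHaar (volume : Measure (Eu 2)) (f := nn d α a i0)).1 hI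
  simpa using this

end
end KP


namespace KP
section
variable {d : ℕ} {α K : ℝ} {a : ℝ → ℝ}

theorem lint_inv (A τ : ℝ) (hA : 1 ≤ A) (hτ : 1 ≤ τ) :
    ∫⁻ s in Icc A (A + τ), ENNReal.ofReal (1 / s) ≤ ENNReal.ofReal (1 + Real.log τ) := by
  have hi : IntegrableOn (fun s : ℝ => 1 / s) (Icc A (A + τ)) := by
    refine ContinuousOn.integrableOn_Icc (continuousOn_const.div continuousOn_id fun s hs => ?_)
    have := hs.1; linarith
  rw [← ofReal_integral_eq_lintegral_ofReal hi ((ae_restrict_iff' measurableSet_Icc).2 (ae_of_all _ fun s hs => by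
    have := hs.1
    have : 0 < s := by linarith
    simp only [Pi.zero_apply]; positivity))]
  apply ENNReal.ofReal_le_ofReal
  rw [integral_Icc_eq_integral_Ioc, ← intervalIntegral.integral_of_le (by linarith), integral_one_div_of_pos (by linarith) (by linarith)]
  have h1 : (A + τ) / A ≤ 2 * τ := by
    rw [div_le_iff₀ (by linarith)]; nlinarith
  calc _ ≤ Real.log (2 * τ) := Real.log_le_log (by apply div_pos <;> linarith) h1
    _ = Real.log 2 + Real.log τ := Real.log_mul (by norm_num) (by linarith)
    _ ≤ _ := by have := Real.log_two_lt_d9; linarith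

theorem radial_bound (n : ℝ → ℝ) (hn : ∀ u, 0 ≤ n u) (c : ℝ) :
    ∫⁻ s in Ioi (0:ℝ), ENNReal.ofReal (s * n (Real.sqrt (s ^ 2 + c ^ 2))) ≤
      ∫⁻ u in Ioi (0:ℝ), ENNReal.ofReal (u * n u) := by
  set f : ℝ → ℝ := fun s => Real.sqrt (s ^ 2 + c ^ 2) with hf
  have hpos : ∀ s ∈ Ioi (0:ℝ), 0 < s ^ 2 + c ^ 2 := fun s hs => by
    have : (0:ℝ) < s := hs
    positivity
  have h := lintegral_image_eq_lintegral_abs_deriv_mul (s := Ioi (0:ℝ)) (f := f) (f' := fun s => s / f s)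
    measurableSet_Ioi (fun s hs => by
      have h1 : HasDerivAt (fun s : ℝ => s ^ 2 + c ^ 2) (2 * s) s := by
        simpa using (hasDerivAt_pow 2 s).add_const (c ^ 2)
      have h2 := h1.sqrt (hpos s hs).ne'
      refine HasDerivAt.hasDerivWithinAt ?_
      have e : s / f s = 2 * s / (2 * Real.sqrt (s ^ 2 + c ^ 2)) := (mul_div_mul_left _ _ (two_ne_zero)).symm
      exact e ▸ h2)
    (by
      intro x hx y hy hxy
      simp only [hf] at hxy
      have := (Real.sqrt_inj (hpos x hx).le (hpos y hy).le).1 hxy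
      have hx' : (0:ℝ) < x := hx
      have hy' : (0:ℝ) < y := hy
      nlinarith) (fun u => ENNReal.ofReal (u * n u))
  calc _ = ∫⁻ u in f '' Ioi 0, ENNReal.ofReal (u * n u) := by
        rw [h]
        refine setLIntegral_congr_fun measurableSet_Ioi fun s hs => ?_
        have hs' : (0:ℝ) < s := hs
        have hfp : 0 < f s := Real.sqrt_pos.2 (hpos s hs)
        rw [abs_of_pos (by positivity), ← ENNReal.ofReal_mul (by positivity)]
        congr 1
        change s * n (f s) = _
        field_simp
    _ ≤ _ := by
        refine lintegral_mono_set ?_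
        rintro _ ⟨s, hs, rfl⟩
        exact Real.sqrt_pos.2 (hpos s hs)

theorem half_bound (n : ℝ → ℝ) (hn : ∀ u, 0 ≤ n u) (hnm : Measurable n) (c p q τ : ℝ) (hτ : 1 ≤ τ) (hpq : q - p ≤ τ) :
    ∫⁻ s in Icc p q ∩ Ioi 1, ENNReal.ofReal (Real.sqrt (n (Real.sqrt (s ^ 2 + c ^ 2)))) ≤
      (∫⁻ u in Ioi (0:ℝ), ENNReal.ofReal (u * n u)) + ENNReal.ofReal (1 + Real.log τ) := by
  have hm : Measurable fun s : ℝ => ENNReal.ofReal (s * n (Real.sqrt (s ^ 2 + c ^ 2))) := by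
    refine Measurable.ennreal_ofReal (measurable_id.mul (hnm.comp (Continuous.measurable (by fun_prop))))
  calc _ ≤ ∫⁻ s in Icc p q ∩ Ioi 1, (ENNReal.ofReal (s * n (Real.sqrt (s ^ 2 + c ^ 2))) + ENNReal.ofReal (1 / s)) := by
        refine setLIntegral_mono' (measurableSet_Icc.inter measurableSet_Ioi) fun s hs => ?_
        have hs1 : (1:ℝ) < s := hs.2
        have hnn := hn (Real.sqrt (s ^ 2 + c ^ 2))
        set N := n (Real.sqrt (s ^ 2 + c ^ 2))
        rw [← ENNReal.ofReal_add (by positivity) (by positivity)]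
        apply ENNReal.ofReal_le_ofReal
        refine Real.sqrt_le_iff.2 ⟨by positivity, ?_⟩
        have : (s * N + 1 / s) ^ 2 = (s * N) ^ 2 + 2 * N + (1 / s) ^ 2 := by field_simp; ring
        rw [this]
        nlinarith [sq_nonneg (s * N), sq_nonneg (1 / s)]
    _ = (∫⁻ s in Icc p q ∩ Ioi 1, ENNReal.ofReal (s * n (Real.sqrt (s ^ 2 + c ^ 2)))) +
        ∫⁻ s in Icc p q ∩ Ioi 1, ENNReal.ofReal (1 / s) := lintegral_add_left hm _
    _ ≤ _ := by
        refine add_le_add ?_ ?_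
        · refine le_trans (lintegral_mono_set ?_) (radial_bound n hn c)
          intro s hs
          exact lt_trans zero_lt_one (show (1:ℝ) < s from hs.2)
        · refine le_trans (lintegral_mono_set ?_) (lint_inv (max p 1) τ (le_max_right _ _) hτ)
          intro s hs
          refine ⟨max_le hs.1.1 (le_of_lt hs.2), ?_⟩
          have := hs.1.2
          have := le_max_left p 1
          linarith

theorem full_bound (n : ℝ → ℝ) (hn : ∀ u, 0 ≤ n u) (hnm : Measurable n) (B : ℝ) (hB : ∀ u, Real.sqrt (n u) ≤ B)
    (c p q τ : ℝ) (hτ : 1 ≤ τ) (hpq : q - p ≤ τ) :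
    ∫⁻ s in Ioc p q, ENNReal.ofReal (Real.sqrt (n (Real.sqrt (s ^ 2 + c ^ 2)))) ≤
      ENNReal.ofReal B * 2 + 2 * ((∫⁻ u in Ioi (0:ℝ), ENNReal.ofReal (u * n u)) + ENNReal.ofReal (1 + Real.log τ)) := by
  set m : ℝ → ENNReal := fun s => ENNReal.ofReal (Real.sqrt (n (Real.sqrt (s ^ 2 + c ^ 2)))) with hm
  have h1 : ∫⁻ s in Icc (-1:ℝ) 1, m s ≤ ENNReal.ofReal B * 2 := by
    calc _ ≤ ∫⁻ s in Icc (-1:ℝ) 1, ENNReal.ofReal B := lintegral_mono fun s => ENNReal.ofReal_le_ofReal (hB _)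
      _ = _ := by rw [setLIntegral_const, Real.volume_Icc]; norm_num
  have h2 : ∫⁻ s in Icc p q ∩ Iio (-1), m s ≤ (∫⁻ u in Ioi (0:ℝ), ENNReal.ofReal (u * n u)) + ENNReal.ofReal (1 + Real.log τ) := by
    refine le_trans (le_of_eq ?_) (half_bound n hn hnm c (-q) (-p) τ hτ (by linarith))
    have hS : MeasurableSet (Icc p q ∩ Iio (-1 : ℝ)) := measurableSet_Icc.inter measurableSet_Iio
    rw [← lintegral_indicator hS, ← lintegral_indicator (measurableSet_Icc.inter measurableSet_Ioi),
      ← lintegral_neg_eq_self]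
    refine lintegral_congr fun s => ?_
    have : (-s ∈ Icc p q ∩ Iio (-1 : ℝ)) ↔ s ∈ Icc (-q) (-p) ∩ Ioi (1:ℝ) := by
      simp only [mem_inter_iff, mem_Icc, mem_Iio, mem_Ioi]
      constructor <;> rintro ⟨⟨_, _⟩, _⟩ <;> refine ⟨⟨?_, ?_⟩, ?_⟩ <;> linarith
    by_cases hs : s ∈ Icc (-q) (-p) ∩ Ioi (1:ℝ)
    · rw [indicator_of_mem (this.2 hs), indicator_of_mem hs]
      simp [hm]
    · rw [indicator_of_notMem (fun h => hs (this.1 h)), indicator_of_notMem hs]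
  have h3 := half_bound n hn hnm c p q τ hτ hpq
  have hsub : Ioc p q ⊆ Icc (-1:ℝ) 1 ∪ ((Icc p q ∩ Iio (-1)) ∪ (Icc p q ∩ Ioi 1)) := by
    intro s hs
    have hs' := Ioc_subset_Icc_self hs
    rcases lt_or_ge s (-1) with h | h
    · exact Or.inr (Or.inl ⟨hs', h⟩)
    · rcases lt_or_ge 1 s with h' | h'
      · exact Or.inr (Or.inr ⟨hs', h'⟩)
      · exact Or.inl ⟨h, h'⟩
  calc _ ≤ ∫⁻ s in Icc (-1:ℝ) 1 ∪ ((Icc p q ∩ Iio (-1)) ∪ (Icc p q ∩ Ioi 1)), m s := lintegral_mono_set hsub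
    _ ≤ (∫⁻ s in Icc (-1:ℝ) 1, m s) + ((∫⁻ s in Icc p q ∩ Iio (-1), m s) + ∫⁻ s in Icc p q ∩ Ioi 1, m s) := by
        refine (lintegral_union_le _ _ _).trans ?_
        gcongr
        exact lintegral_union_le _ _ _
    _ ≤ _ := by
        rw [two_mul (_ + _)]
        gcongr

theorem R_le_nn (h : SP d α K a) (i0 : Fin d) (x : Eu d) (i j : Fin d) :
    |covEntry d α a x i j| ≤ Real.sqrt (nn d α a i0 ‖x‖) := by
  rw [← h.NN_nn i0]
  apply Real.abs_le_sqrt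
  unfold NN
  refine le_trans ?_ (Finset.single_le_sum (f := fun i => ∑ j, covEntry d α a x i j ^ 2)
    (fun i _ => Finset.sum_nonneg fun j _ => sq_nonneg _) (Finset.mem_univ i))
  exact Finset.single_le_sum (f := fun j => covEntry d α a x i j ^ 2) (fun j _ => sq_nonneg _) (Finset.mem_univ j)

theorem SP.lineBound (h : SP d α K a) (v : Eu d) (hv : ‖v‖ = 1) :
    ∃ C : ℝ, 0 ≤ C ∧ LineBound (fun x i j => covEntry d α a x i j) v C := by
  have hd0 : 0 < d := by have := h.hd; omega
  set i0 : Fin d := ⟨0, hd0⟩ with hi0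
  obtain ⟨B, hB, hR⟩ := h.R_bdd
  set n := nn d α a i0 with hn
  have hn0 : ∀ u, 0 ≤ n u := fun u => NN_nonneg _
  have hnB : ∀ u, Real.sqrt (n u) ≤ d * B := by
    intro u
    refine Real.sqrt_le_iff.2 ⟨by positivity, ?_⟩
    simp only [hn, nn, NN]
    calc _ ≤ ∑ i : Fin d, ∑ j : Fin d, B ^ 2 := by
          refine Finset.sum_le_sum fun i _ => Finset.sum_le_sum fun j _ => ?_
          rw [← sq_abs]
          exact pow_le_pow_left₀ (abs_nonneg _) (hR _ _ _) 2
      _ = _ := by simp; ring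
  have hI := h.nn_int i0 rfl
  set Cn := ∫ u in Ioi (0:ℝ), u * n u with hCn
  have hCne : ∫⁻ u in Ioi (0:ℝ), ENNReal.ofReal (u * n u) = ENNReal.ofReal Cn := by
    rw [hCn, ofReal_integral_eq_lintegral_ofReal hI]
    refine (ae_restrict_iff' measurableSet_Ioi).2 (ae_of_all _ fun u hu => mul_nonneg (le_of_lt hu) (hn0 u))
  have hCn0 : 0 ≤ Cn := setIntegral_nonneg measurableSet_Ioi fun u hu => mul_nonneg (le_of_lt hu) (hn0 u)
  refine ⟨2 * (d * B) + 2 * Cn + 2, by positivity, ?_⟩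
  intro w i j p q τ hτ hpq
  have hlog := Real.log_nonneg hτ
  set b := ⟪w, v⟫ with hb
  have hρ : 0 ≤ ‖w‖ ^ 2 - b ^ 2 := by
    have := abs_real_inner_le_norm w v
    rw [hv, mul_one] at this
    have := sq_le_sq' (by linarith [neg_abs_le b]) (le_of_abs_le this)
    linarith
  set c := Real.sqrt (‖w‖ ^ 2 - b ^ 2) with hc
  have hnorm : ∀ r : ℝ, ‖r • v + w‖ = Real.sqrt ((r + b) ^ 2 + c ^ 2) := by
    intro r
    rw [hc, Real.sq_sqrt hρ]
    symm
    rw [Real.sqrt_eq_iff_mul_self_eq (by positivity) (norm_nonneg _), ← sq, norm_add_sq_real, norm_smul, hv,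
      inner_smul_left, real_inner_comm, ← hb]
    simp; ring
  have hfb := full_bound n hn0 (h.nn_cont i0).measurable (d * B) hnB c (p + b) (q + b) τ hτ (by linarith)
  calc ∫⁻ r in Ioc p q, ‖covEntry d α a (r • v + w) i j‖ₑ
      ≤ ∫⁻ r in Ioc p q, ENNReal.ofReal (Real.sqrt (n (Real.sqrt ((r + b) ^ 2 + c ^ 2)))) := by
        refine lintegral_mono fun r => ?_
        rw [← ofReal_norm]
        apply ENNReal.ofReal_le_ofReal
        rw [← hnorm]
        exact R_le_nn h i0 _ i j
    _ = ∫⁻ s in Ioc (p + b) (q + b), ENNReal.ofReal (Real.sqrt (n (Real.sqrt (s ^ 2 + c ^ 2)))) := by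
        rw [← lintegral_indicator measurableSet_Ioc, ← lintegral_indicator measurableSet_Ioc,
          ← lintegral_add_right_eq_self (μ := volume) (indicator (Ioc (p + b) (q + b)) _) b]
        refine lintegral_congr fun s => ?_
        have : s + b ∈ Ioc (p + b) (q + b) ↔ s ∈ Ioc p q := by simp
        by_cases hs : s ∈ Ioc p q
        · rw [indicator_of_mem (this.2 hs), indicator_of_mem hs]
        · rw [indicator_of_notMem (fun h => hs (this.1 h)), indicator_of_notMem hs]
    _ ≤ _ := hfb
    _ = ENNReal.ofReal ((d * B) * 2 + 2 * (Cn + (1 + Real.log τ))) := by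
        rw [hCne, ENNReal.ofReal_add (p := (d:ℝ) * B * 2) (by positivity) (by positivity), ENNReal.ofReal_mul (p := (d:ℝ) * B) (q := 2) (by positivity),
          ENNReal.ofReal_mul (p := 2) (by positivity), ENNReal.ofReal_add (p := Cn) (by positivity) (by positivity)]
        simp
    _ ≤ _ := by
        apply ENNReal.ofReal_le_ofReal
        have : 0 ≤ (d * B) := by positivity
        nlinarith

end
end KP


namespace KP
section
variable {d : ℕ} {α K : ℝ} {a : ℝ → ℝ}

theorem pp_psd (k : Eu d) (A : Fin d → ℝ) : 0 ≤ ∑ i, ∑ i', pp i i' k * (A i * A i') := by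
  set w : Eu d := WithLp.toLp 2 A with hw
  have h1 : ∑ i, ∑ i', pp i i' k * (A i * A i') = ‖w‖ ^ 2 - ⟪k, w⟫ ^ 2 / ‖k‖ ^ 2 := by
    have e : ∀ i i', pp i i' k * (A i * A i') = (if i = i' then A i * A i' else 0) - (k i * A i) * (k i' * A i') / ‖k‖ ^ 2 := by
      intro i i'
      unfold pp
      split_ifs <;> ring
    simp only [e, Finset.sum_sub_distrib, Finset.sum_ite_eq, Finset.mem_univ, if_true]
    rw [EuclideanSpace.real_norm_sq_eq w, PiLp.inner_apply, sq (∑ i, _), Finset.sum_mul_sum, Finset.sum_div]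
    congr 1
    · exact Finset.sum_congr rfl fun i _ => by simp [hw, sq]
    · refine Finset.sum_congr rfl fun i _ => ?_
      rw [Finset.sum_div]
      refine Finset.sum_congr rfl fun j _ => ?_
      simp [hw]; ring
  rw [h1]
  have h2 : ⟪k, w⟫ ^ 2 ≤ ‖k‖ ^ 2 * ‖w‖ ^ 2 := by
    rw [← mul_pow]
    exact sq_le_sq.2 (by rw [abs_of_nonneg (by positivity : 0 ≤ ‖k‖ * ‖w‖)]; exact abs_real_inner_le_norm k w)
  have : ⟪k, w⟫ ^ 2 / ‖k‖ ^ 2 ≤ ‖w‖ ^ 2 := by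
    apply div_le_of_le_mul₀ (sq_nonneg _) (sq_nonneg _)
    linarith
  linarith

/-- quadratic form -/
noncomputable def QQ (d : ℕ) (α : ℝ) (a : ℝ → ℝ) {N : ℕ} (x c : Fin N → Eu d) : ℝ :=
  ∑ j : Fin N, ∑ l : Fin N, ∑ i : Fin d, ∑ i' : Fin d, c j i * covEntry d α a (x j - x l) i i' * c l i'

theorem SP.QQ_nonneg (h : SP d α K a) {N : ℕ} (x c : Fin N → Eu d) : 0 ≤ QQ d α a x c := by
  have hI : ∀ (j l : Fin N) (i i' : Fin d), Integrable fun k =>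
      c j i * (Real.cos ⟪k, x j - x l⟫ * (mm d α a k * pp i i' k)) * c l i' := fun j l i i' =>
    ((h.cos_integrable i i' (x j - x l)).const_mul _).mul_const _
  have e : QQ d α a x c = ∫ k : Eu d, ∑ j : Fin N, ∑ l : Fin N, ∑ i : Fin d, ∑ i' : Fin d,
      c j i * (Real.cos ⟪k, x j - x l⟫ * (mm d α a k * pp i i' k)) * c l i' := by
    unfold QQ
    rw [integral_finsetSum _ fun j _ => integrable_finsetSum _ fun l _ => integrable_finsetSum _ fun i _ =>
      integrable_finsetSum _ fun i' _ => hI j l i i']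
    refine Finset.sum_congr rfl fun j _ => ?_
    rw [integral_finsetSum _ fun l _ => integrable_finsetSum _ fun i _ =>
      integrable_finsetSum _ fun i' _ => hI j l i i']
    refine Finset.sum_congr rfl fun l _ => ?_
    rw [integral_finsetSum _ fun i _ =>
      integrable_finsetSum _ fun i' _ => hI j l i i']
    refine Finset.sum_congr rfl fun i _ => ?_
    rw [integral_finsetSum _ fun i' _ => hI j l i i']
    refine Finset.sum_congr rfl fun i' _ => ?_
    rw [integral_mul_const, integral_const_mul, covEntry_eq]
  rw [e]
  refine integral_nonneg fun k => ?_
  simp only [Pi.zero_apply]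
  set A : Fin d → ℝ := fun i => ∑ j, c j i * Real.cos ⟪k, x j⟫ with hA
  set B : Fin d → ℝ := fun i => ∑ j, c j i * Real.sin ⟪k, x j⟫ with hB
  have e2 : ∑ j : Fin N, ∑ l : Fin N, ∑ i : Fin d, ∑ i' : Fin d,
      c j i * (Real.cos ⟪k, x j - x l⟫ * (mm d α a k * pp i i' k)) * c l i' =
      mm d α a k * ((∑ i, ∑ i', pp i i' k * (A i * A i')) + ∑ i, ∑ i', pp i i' k * (B i * B i')) := by
    have e3 : ∀ i i', pp i i' k * (A i * A i') + pp i i' k * (B i * B i') =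
        ∑ j : Fin N, ∑ l : Fin N, pp i i' k * (c j i * Real.cos ⟪k, x j - x l⟫ * c l i') := by
      intro i i'
      simp only [hA, hB]
      rw [Finset.sum_mul_sum, Finset.sum_mul_sum, ← mul_add, ← Finset.sum_add_distrib, Finset.mul_sum]
      refine Finset.sum_congr rfl fun j _ => ?_
      rw [← Finset.sum_add_distrib, Finset.mul_sum]
      refine Finset.sum_congr rfl fun l _ => ?_
      rw [inner_sub_right, Real.cos_sub]; ring
    rw [← Finset.sum_add_distrib, Finset.mul_sum]
    simp only [← Finset.sum_add_distrib, e3]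
    calc _ = ∑ j : Fin N, ∑ i : Fin d, ∑ l : Fin N, ∑ i' : Fin d,
          c j i * (Real.cos ⟪k, x j - x l⟫ * (mm d α a k * pp i i' k)) * c l i' :=
          Finset.sum_congr rfl fun j _ => Finset.sum_comm
      _ = ∑ i : Fin d, ∑ j : Fin N, ∑ i' : Fin d, ∑ l : Fin N,
          c j i * (Real.cos ⟪k, x j - x l⟫ * (mm d α a k * pp i i' k)) * c l i' := by
          rw [Finset.sum_comm]
          exact Finset.sum_congr rfl fun i _ => Finset.sum_congr rfl fun j _ => Finset.sum_comm
      _ = _ := by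
          refine Finset.sum_congr rfl fun i _ => ?_
          rw [Finset.sum_comm, Finset.mul_sum]
          refine Finset.sum_congr rfl fun i' _ => ?_
          rw [Finset.mul_sum]
          refine Finset.sum_congr rfl fun j _ => ?_
          rw [Finset.mul_sum]
          refine Finset.sum_congr rfl fun l _ => ?_
          ring
  rw [e2]
  exact mul_nonneg (h.mm_nonneg k) (add_nonneg (pp_psd k A) (pp_psd k B))

theorem cov_symm (x : Eu d) (i j : Fin d) : covEntry d α a (-x) j i = covEntry d α a x i j := by
  rw [covEntry_eq, covEntry_eq]
  refine integral_congr_ae (ae_of_all _ fun k => ?_)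
  simp only [inner_neg_right, Real.cos_neg]
  have : pp j i k = pp i j k := by
    unfold pp
    rw [mul_comm (k j)]
    simp only [eq_comm]
  rw [this]

variable {Ω : Type*} [MeasurableSpace Ω] {P : Measure Ω} [IsProbabilityMeasure P]

theorem gauss_facts (W : Ω → ℝ) (hW : Measurable W) (q : ℝ) (hq : 0 ≤ q)
    (hm : Measure.map W P = gaussianReal 0 (Real.toNNReal q)) :
    MemLp W 2 P ∧ ∫ ω, W ω ∂P = 0 ∧ ∫ ω, W ω ^ 2 ∂P = q := by
  have h1 : MemLp W 2 P := by
    have := memLp_id_gaussianReal (μ := 0) (v := Real.toNNReal q) 2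
    rw [← hm] at this
    exact (memLp_map_measure_iff (by fun_prop) hW.aemeasurable).1 this
  have h2 : ∫ ω, W ω ∂P = 0 := by
    have := integral_id_gaussianReal (μ := 0) (v := Real.toNNReal q)
    rw [← hm, integral_map hW.aemeasurable (by fun_prop)] at this
    exact this
  refine ⟨h1, h2, ?_⟩
  have h3 := variance_id_gaussianReal (μ := 0) (v := Real.toNNReal q)
  rw [← hm, variance_map (by fun_prop) hW.aemeasurable] at h3
  have h4 := variance_eq_sub h1
  have h5 : Var[W; P] = q := by
    rw [show W = id ∘ W from rfl, h3]; simp [hq]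
  rw [h5, h2] at h4
  simp at h4
  exact h4.symm

theorem SP.mkGF (h : SP d α K a) (F : Ω → Eu d → Eu d)
    (hF_meas : Measurable (Function.uncurry F))
    (hF_gauss : ∀ (N : ℕ) (x c : Fin N → EuclideanSpace ℝ (Fin d)),
      Measure.map (fun ω => ∑ j : Fin N, ⟪c j, F ω (x j)⟫) P =
        gaussianReal 0 (Real.toNNReal (∑ j : Fin N, ∑ l : Fin N,
          ∑ i : Fin d, ∑ i' : Fin d,
            c j i * covEntry d α a (x j - x l) i i' * c l i'))) :
    GF P F (fun x i j => covEntry d α a x i j) := by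
  have hFm : ∀ x c, Measurable fun ω => F ω x c := fun x c =>
    ((EuclideanSpace.proj c : Eu d →L[ℝ] ℝ).continuous.measurable.comp
      (hF_meas.comp (measurable_id.prodMk measurable_const)))
  have hsum : ∀ (n : ℕ) (x : Fin n → Eu d) (c : Fin n → Fin d) (l : Fin n → ℝ),
      Measure.map (fun ω => ∑ j, l j * F ω (x j) (c j)) P =
        gaussianReal 0 (Real.toNNReal (QQ d α a x fun j => EuclideanSpace.single (c j) (l j))) := by
    intro n x c l
    have := hF_gauss n x fun j => EuclideanSpace.single (c j) (l j)
    simp only [EuclideanSpace.inner_single_left] at this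
    simpa [QQ] using this
  have hfacts : ∀ (n : ℕ) (x : Fin n → Eu d) (c : Fin n → Fin d) (l : Fin n → ℝ),
      MemLp (fun ω => ∑ j, l j * F ω (x j) (c j)) 2 P ∧ ∫ ω, ∑ j, l j * F ω (x j) (c j) ∂P = 0 ∧
      ∫ ω, (∑ j, l j * F ω (x j) (c j)) ^ 2 ∂P = QQ d α a x fun j => EuclideanSpace.single (c j) (l j) :=
    fun n x c l => gauss_facts _ (Finset.measurable_sum _ fun j _ => (hFm _ _).const_mul _) _
      (h.QQ_nonneg _ _) (hsum n x c l)
  have h1 : ∀ x c, MemLp (fun ω => F ω x c) 2 P ∧ ∫ ω, F ω x c ∂P = 0 ∧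
      ∫ ω, F ω x c ^ 2 ∂P = covEntry d α a 0 c c := by
    intro x c
    have := hfacts 1 (fun _ => x) (fun _ => c) (fun _ => 1)
    simpa [QQ] using this
  refine ⟨hF_meas, fun n x c => ?_, fun x c => (h1 x c).2.1, fun x y i j => ?_⟩
  · refine ⟨isGaussian_of_map_eq_gaussianReal fun L => ?_⟩
    have hmm : Measurable fun ω (i : Fin n) => F ω (x i) (c i) := measurable_pi_lambda _ fun i => hFm _ _
    refine ⟨0, Real.toNNReal (QQ d α a x fun j => EuclideanSpace.single (c j) (L (Pi.single j 1))), ?_⟩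
    · rw [Measure.map_map L.continuous.measurable hmm]
      have : (L ∘ fun ω (i : Fin n) => F ω (x i) (c i)) = fun ω => ∑ j, L (Pi.single j 1) * F ω (x j) (c j) := by
        funext ω
        simp only [Function.comp]
        conv_lhs => rw [pi_eq_sum_univ' (fun i => F ω (x i) (c i))]
        rw [map_sum]
        refine Finset.sum_congr rfl fun j _ => ?_
        rw [map_smul, smul_eq_mul, mul_comm]
      rw [this]
      exact hsum n x c fun j => L (Pi.single j 1)
  · have h2 := (hfacts 2 ![x, y] ![i, j] ![1, 1]).2.2
    simp only [Fin.sum_univ_two, Matrix.cons_val_zero, Matrix.cons_val_one, one_mul] at h2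
    have e : ∀ ω, (F ω x i + F ω y j) ^ 2 = F ω x i ^ 2 + 2 * (F ω x i * F ω y j) + F ω y j ^ 2 := fun ω => by ring
    simp only [e] at h2
    have hi : Integrable (fun ω => F ω x i * F ω y j) P := mul_int (h1 x i).1 (h1 y j).1
    rw [integral_add (f := fun ω => F ω x i ^ 2 + 2 * (F ω x i * F ω y j)) ((h1 x i).1.integrable_sq.add (hi.const_mul 2)) (h1 y j).1.integrable_sq,
      integral_add (h1 x i).1.integrable_sq (hi.const_mul 2), integral_const_mul, (h1 x i).2.2, (h1 y j).2.2] at h2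
    have e2 : QQ d α a ![x, y] (fun m => EuclideanSpace.single (![i, j] m) (![1, 1] m)) =
      covEntry d α a 0 i i + 2 * covEntry d α a (x - y) i j + covEntry d α a 0 j j := by
      have := cov_symm (α := α) (a := a) (x - y) i j
      rw [neg_sub] at this
      simp [QQ, Fin.sum_univ_two, this]
      ring
    rw [e2] at h2
    linarith

end
end KP


namespace KP
section
variable {d : ℕ} {α K : ℝ} {a : ℝ → ℝ}

theorem SP.r0 (h : SP d α K a) : ∃ r0 m0 : ℝ, 0 < r0 ∧ 0 < m0 ∧ ∀ k : Eu d, r0 / 2 ≤ ‖k‖ → ‖k‖ ≤ r0 → m0 ≤ mm d α a k := by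
  have h1 : ∀ᶠ r in nhds (0:ℝ), 1 / 2 < a r := by
    have := h.cont.tendsto
    rw [h.one] at this
    exact this.eventually (lt_mem_nhds (by norm_num))
  obtain ⟨ε, hε, hb⟩ := Metric.eventually_nhds_iff.1 h1
  set β := -(2 * α + (d : ℝ) - 2) with hβ
  have hp1 : 0 < (ε / 2 / 2) ^ β := Real.rpow_pos_of_pos (by positivity) _
  have hp2 : 0 < (ε / 2) ^ β := Real.rpow_pos_of_pos (by positivity) _
  refine ⟨ε / 2, 1 / 2 * min ((ε / 2 / 2) ^ β) ((ε / 2) ^ β), by positivity, by positivity, fun k hk1 hk2 => ?_⟩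
  unfold mm
  have ha : 1 / 2 ≤ a ‖k‖ := (hb (by simp [abs_of_nonneg]; linarith)).le
  have hk : 0 < ‖k‖ := lt_of_lt_of_le (by positivity) hk1
  refine mul_le_mul ha ?_ (by positivity) (by linarith)
  rcases le_total 0 β with hb0 | hb0
  · exact (min_le_left _ _).trans (Real.rpow_le_rpow (by positivity) hk1 hb0)
  · exact (min_le_right _ _).trans (Real.rpow_le_rpow_of_nonpos hk hk2 hb0)

/-- slab -/
def slab (v : Eu d) (r0 τ : ℝ) : Set (Eu d) := {k | |⟪k, v⟫| ≤ 1 / τ ∧ r0 / 2 ≤ ‖k‖ ∧ ‖k‖ ≤ r0}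

theorem slab_meas (v : Eu d) (r0 τ : ℝ) : MeasurableSet (slab v r0 τ) := by
  apply IsClosed.measurableSet
  have h1 : IsClosed {k : Eu d | |⟪k, v⟫| ≤ 1 / τ} := isClosed_le (by fun_prop) (by fun_prop)
  have h2 : IsClosed {k : Eu d | r0 / 2 ≤ ‖k‖} := isClosed_le (by fun_prop) (by fun_prop)
  have h3 : IsClosed {k : Eu d | ‖k‖ ≤ r0} := isClosed_le (by fun_prop) (by fun_prop)
  exact h1.inter (h2.inter h3)

theorem slab_vol (hd : 2 ≤ d) (v : Eu d) (hv : ‖v‖ = 1) (r0 : ℝ) (hr : 0 < r0) :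
    ∃ c : ℝ, 0 < c ∧ ∀ τ : ℝ, 4 / r0 ≤ τ → ENNReal.ofReal (c / τ) ≤ volume (slab v r0 τ) := by
  have hd0 : 0 < d := by omega
  have hd1 : 1 < d := by omega
  set i0 : Fin d := ⟨0, hd0⟩ with hi0
  set i1 : Fin d := ⟨1, hd1⟩ with hi1
  obtain ⟨U, hU⟩ := exists_isometry (EuclideanSpace.single i0 (1:ℝ)) v (by simp [hv])
  have hdr : (2:ℝ) ≤ d := by exact_mod_cast hd
  set c := 2 * (r0 / 4) * (r0 / (2 * d)) ^ (d - 2) with hc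
  have hcp : 0 < c := by positivity
  refine ⟨c, hcp, fun τ hτ => ?_⟩
  have hτp : 0 < τ := lt_of_lt_of_le (by positivity) hτ
  have hτi : 1 / τ ≤ r0 / 4 := by
    rw [div_le_iff₀ hτp]
    rw [div_le_iff₀ hr] at hτ
    linarith
  have hmp : MeasurePreserving U volume volume := U.measurePreserving
  rw [← hmp.measure_preimage (slab_meas v r0 τ).nullMeasurableSet]
  set I : Fin d → Set ℝ := fun i => if i = i0 then Icc (-(1/τ)) (1/τ) else if i = i1 then Icc (r0 / 2) (3 * r0 / 4)
    else Icc (-(r0 / (4 * d))) (r0 / (4 * d)) with hI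
  have hIm : ∀ i, MeasurableSet (I i) := by
    intro i; simp only [hI]; split_ifs <;> exact measurableSet_Icc
  set Bx : Set (Eu d) := {k | ∀ i, k i ∈ I i} with hBx
  have hsub : Bx ⊆ U ⁻¹' slab v r0 τ := by
    intro k hk
    have hk0 : k i0 ∈ Icc (-(1/τ)) (1/τ) := by have := hk i0; simpa [hI] using this
    have hk1 : k i1 ∈ Icc (r0 / 2) (3 * r0 / 4) := by
      have := hk i1; simpa [hI, hi0, hi1] using this
    have hkr : ∀ i, i ≠ i0 → i ≠ i1 → |k i| ≤ r0 / (4 * d) := by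
      intro i h0 h1
      have := hk i
      simp only [hI, if_neg h0, if_neg h1] at this
      exact abs_le.2 this
    have hnorm := EuclideanSpace.real_norm_sq_eq k
    refine ⟨?_, ?_, ?_⟩
    · rw [← hU, U.inner_map_map, EuclideanSpace.inner_single_right]
      simpa [abs_le] using hk0
    · rw [U.norm_map]
      have := PiLp.norm_apply_le k i1
      rw [Real.norm_eq_abs] at this
      linarith [le_abs_self (k i1), hk1.1]
    · rw [U.norm_map]
      have hle : ∀ i, k i ^ 2 ≤ (if i = i0 then r0 ^ 2 / 16 else 0) + (if i = i1 then 9 * r0 ^ 2 / 16 else 0) + r0 ^ 2 / (16 * d) := by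
        intro i
        by_cases h0 : i = i0
        · subst h0
          have : k i0 ^ 2 ≤ r0 ^ 2 / 16 := by
            have := sq_le_sq' (by linarith [hk0.1] : -(r0/4) ≤ k i0) (by linarith [hk0.2])
            linarith
          have h3 : 0 ≤ r0 ^ 2 / (16 * (d:ℝ)) := by positivity
          have h4 : 0 ≤ (if i0 = i1 then 9 * r0 ^ 2 / 16 else 0) := by positivity
          rw [if_pos rfl]; linarith
        · by_cases h1 : i = i1
          · subst h1
            have : k i1 ^ 2 ≤ 9 * r0 ^ 2 / 16 := by
              have := sq_le_sq' (by linarith [hk1.1] : -(3*r0/4) ≤ k i1) (by linarith [hk1.2])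
              linarith
            have h3 : 0 ≤ r0 ^ 2 / (16 * (d:ℝ)) := by positivity
            rw [if_neg h0, if_pos rfl]; linarith
          · rw [if_neg h0, if_neg h1, ← sq_abs]
            have := pow_le_pow_left₀ (abs_nonneg _) (hkr i h0 h1) 2
            refine this.trans ?_
            rw [div_pow, mul_pow]
            have : (4:ℝ) ^ 2 * (d:ℝ) ^ 2 = 16 * d * d := by ring
            rw [this, zero_add, zero_add]
            gcongr
            nlinarith
      have hs : ‖k‖ ^ 2 ≤ r0 ^ 2 := by
        rw [hnorm]
        refine (Finset.sum_le_sum fun i _ => hle i).trans ?_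
        simp only [Finset.sum_add_distrib, Finset.sum_ite_eq', Finset.mem_univ, if_true, Finset.sum_const,
          Finset.card_univ, Fintype.card_fin, nsmul_eq_mul]
        have : (d:ℝ) * (r0 ^ 2 / (16 * d)) = r0 ^ 2 / 16 := by field_simp
        rw [this]; nlinarith
      exact (sq_le_sq₀ (norm_nonneg _) hr.le).1 hs
  refine le_trans ?_ (measure_mono hsub)
  have hvol : volume Bx = ∏ i, volume (I i) := by
    have e := lintegral_eu_prod (d := d) (fun i => (I i).indicator 1) fun i => measurable_one.indicator (hIm i)
    simp only [lintegral_indicator_one (hIm _)] at e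
    rw [← e]
    have hBm : MeasurableSet Bx := by
      have : Bx = ⋂ i, (fun k : Eu d => k i) ⁻¹' I i := by ext k; simp [hBx]
      rw [this]
      exact MeasurableSet.iInter fun i => (EuclideanSpace.proj i : Eu d →L[ℝ] ℝ).continuous.measurable (hIm i)
    rw [← lintegral_indicator_one hBm]
    refine lintegral_congr fun k => ?_
    by_cases hk : k ∈ Bx
    · rw [indicator_of_mem hk]
      rw [Finset.prod_eq_one fun i _ => by rw [indicator_of_mem (hk i)]; rfl]; rfl
    · rw [indicator_of_notMem hk]
      have : ∃ i, k i ∉ I i := by simpa [hBx] using hk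
      obtain ⟨i, hi⟩ := this
      exact (Finset.prod_eq_zero (Finset.mem_univ i) (indicator_of_notMem hi _)).symm
  rw [hvol]
  have hv0 : ∀ i, volume (I i) = ENNReal.ofReal (if i = i0 then 2 / τ else if i = i1 then r0 / 4 else r0 / (2 * d)) := by
    intro i
    simp only [hI]
    split_ifs <;> rw [Real.volume_Icc] <;> congr 1 <;> field_simp <;> ring
  simp only [hv0]
  rw [← ENNReal.ofReal_prod_of_nonneg (fun i _ => by positivity)]
  apply ENNReal.ofReal_le_ofReal
  refine le_of_eq ?_
  obtain ⟨n, rfl⟩ : ∃ n, d = n + 2 := ⟨d - 2, by omega⟩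
  rw [Fin.prod_univ_succ, Fin.prod_univ_succ]
  have e1 : ∀ i : Fin n, (if i.succ.succ = i0 then 2 / τ else if i.succ.succ = i1 then r0 / 4 else r0 / (2 * ((n+2:ℕ):ℝ))) = r0 / (2 * ((n+2:ℕ):ℝ)) := by
    intro i
    rw [if_neg (by simp [hi0, Fin.ext_iff]), if_neg (by simp [hi1, Fin.ext_iff])]
  rw [Finset.prod_congr rfl fun i _ => e1 i]
  rw [if_pos (by simp [hi0]), if_neg (by simp [hi0, Fin.ext_iff]), if_pos (by simp [hi1, Fin.ext_iff])]
  rw [Finset.prod_const, Finset.card_univ, Fintype.card_fin, hc, Nat.add_sub_cancel]; ring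

/-- longitudinal quadratic form of the projector -/
noncomputable def qv (v k : Eu d) : ℝ := ∑ i, ∑ j, v i * v j * pp i j k

theorem qv_eq (v k : Eu d) : qv v k = ‖v‖ ^ 2 - ⟪k, v⟫ ^ 2 / ‖k‖ ^ 2 := by
  unfold qv
  have e : ∀ i j, v i * v j * pp i j k = (if i = j then v i * v j else 0) - (k i * v i) * (k j * v j) / ‖k‖ ^ 2 := by
    intro i j
    unfold pp
    split_ifs <;> ring
  simp only [e, Finset.sum_sub_distrib, Finset.sum_ite_eq, Finset.mem_univ, if_true]
  rw [EuclideanSpace.real_norm_sq_eq v, PiLp.inner_apply, sq (∑ i, _), Finset.sum_mul_sum, Finset.sum_div]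
  congr 1
  · exact Finset.sum_congr rfl fun i _ => by simp [sq]
  · refine Finset.sum_congr rfl fun i _ => ?_
    rw [Finset.sum_div]
    refine Finset.sum_congr rfl fun j _ => ?_
    simp; ring

theorem qv_nonneg (v k : Eu d) : 0 ≤ qv v k := by
  have := pp_psd k (fun i => v i)
  unfold qv
  simpa [mul_comm] using this

theorem SP.lower (h : SP d α K a) (v : Eu d) (hv : ‖v‖ = 1) :
    ∃ c : ℝ, 0 < c ∧ ∃ τ0 : ℝ, 1 ≤ τ0 ∧ ∀ s0 s1 : ℝ, τ0 ≤ s1 - s0 → c * (s1 - s0) ≤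
      ∫ z, (∑ i, ∑ j, v i * v j * covEntry d α a ((z.1 - z.2) • v) i j)
        ∂((volume.restrict (Ioc s0 s1)).prod (volume.restrict (Ioc s0 s1))) := by
  obtain ⟨r0, m0, hr0, hm0, hmm⟩ := h.r0
  obtain ⟨c, hc, hvol⟩ := slab_vol h.hd v hv r0 hr0
  refine ⟨c * m0 / 4, by positivity, max 1 (4 / r0), le_max_left _ _, fun s0 s1 hs => ?_⟩
  set τ := s1 - s0 with hτ
  have hτ1 : 1 ≤ τ := (le_max_left _ _).trans hs
  have hτ4 : 4 / r0 ≤ τ := (le_max_right _ _).trans hs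
  set μ := (volume : Measure ℝ).restrict (Ioc s0 s1) with hμ
  have : IsFiniteMeasure μ := by rw [hμ]; infer_instance
  have hμr : μ.real univ = τ := by
    rw [hμ, measureReal_restrict_apply_univ, Real.volume_real_Ioc_of_le (by linarith)]
  set w : Eu d → ℝ := fun k => mm d α a k * qv v k with hw
  have hwI : Integrable w := by
    have : w = fun k => ∑ i, ∑ j, v i * v j * (mm d α a k * pp i j k) := by
      funext k
      simp only [hw, qv, Finset.mul_sum]
      exact Finset.sum_congr rfl fun i _ => Finset.sum_congr rfl fun j _ => by ring
    rw [this]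
    exact integrable_finsetSum _ fun i _ => integrable_finsetSum _ fun j _ => (h.hk_integrable i j).const_mul _
  have hw0 : ∀ k, 0 ≤ w k := fun k => mul_nonneg (h.mm_nonneg k) (qv_nonneg v k)
  have e1 : ∀ z : ℝ × ℝ, ∑ i, ∑ j, v i * v j * covEntry d α a ((z.1 - z.2) • v) i j =
      ∫ k, Real.cos ((z.1 - z.2) * ⟪k, v⟫) * w k := by
    intro z
    simp only [covEntry_eq]
    have hI : ∀ i j, Integrable fun k => v i * v j * (Real.cos ⟪k, (z.1 - z.2) • v⟫ * (mm d α a k * pp i j k)) :=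
      fun i j => (h.cos_integrable i j _).const_mul _
    have : ∀ k, Real.cos ((z.1 - z.2) * ⟪k, v⟫) * w k =
        ∑ i, ∑ j, v i * v j * (Real.cos ⟪k, (z.1 - z.2) • v⟫ * (mm d α a k * pp i j k)) := by
      intro k
      simp only [hw, qv, Finset.mul_sum, inner_smul_right]
      exact Finset.sum_congr rfl fun i _ => Finset.sum_congr rfl fun j _ => by ring
    simp only [this]
    rw [integral_finsetSum _ fun i _ => integrable_finsetSum _ fun j _ => hI i j]
    refine Finset.sum_congr rfl fun i _ => ?_
    rw [integral_finsetSum _ fun j _ => hI i j]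
    refine Finset.sum_congr rfl fun j _ => ?_
    rw [integral_const_mul]
  simp only [e1]
  have hbig : Integrable (Function.uncurry fun (z : ℝ × ℝ) (k : Eu d) => Real.cos ((z.1 - z.2) * ⟪k, v⟫) * w k)
      ((μ.prod μ).prod volume) := by
    have h1 : Integrable (fun q : (ℝ × ℝ) × Eu d => (1:ℝ) * w q.2) ((μ.prod μ).prod volume) :=
      (integrable_const (1:ℝ)).mul_prod hwI
    have h2 := h1.bdd_mul (c := 1) (f := fun q : (ℝ × ℝ) × Eu d => Real.cos ((q.1.1 - q.1.2) * ⟪q.2, v⟫))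
      (Continuous.aestronglyMeasurable (by fun_prop)) (ae_of_all _ fun q => Real.abs_cos_le_one _)
    refine h2.congr (ae_of_all _ fun q => ?_)
    simp [Function.uncurry]
  rw [integral_integral_swap hbig]
  simp only [integral_mul_const]
  set g : Eu d → ℝ := fun k => ∫ z, Real.cos ((z.1 - z.2) * ⟪k, v⟫) ∂(μ.prod μ) with hg
  have hcosI : ∀ k, Integrable (fun z : ℝ × ℝ => Real.cos ((z.1 - z.2) * ⟪k, v⟫)) (μ.prod μ) := fun k =>
    Integrable.of_bound (Continuous.aestronglyMeasurable (by fun_prop)) 1 (ae_of_all _ fun q => Real.abs_cos_le_one _)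
  have hg0 : ∀ k, 0 ≤ g k := by
    intro k
    have e : g k = (∫ s, Real.cos (s * ⟪k, v⟫) ∂μ) * (∫ s, Real.cos (s * ⟪k, v⟫) ∂μ) +
        (∫ s, Real.sin (s * ⟪k, v⟫) ∂μ) * (∫ s, Real.sin (s * ⟪k, v⟫) ∂μ) := by
      rw [← integral_prod_mul, ← integral_prod_mul, ← integral_add]
      · simp only [hg]
        refine integral_congr_ae (ae_of_all _ fun z => ?_)
        simp only [sub_mul, Real.cos_sub]
      · exact Integrable.of_bound (Continuous.aestronglyMeasurable (by fun_prop)) 1 (ae_of_all _ fun q => by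
          rw [norm_mul]; exact mul_le_one₀ (Real.abs_cos_le_one _) (norm_nonneg _) (Real.abs_cos_le_one _))
      · exact Integrable.of_bound (Continuous.aestronglyMeasurable (by fun_prop)) 1 (ae_of_all _ fun q => by
          rw [norm_mul]; exact mul_le_one₀ (Real.abs_sin_le_one _) (norm_nonneg _) (Real.abs_sin_le_one _))
    rw [e]
    exact add_nonneg (mul_self_nonneg _) (mul_self_nonneg _)
  have hgs : ∀ k ∈ slab v r0 τ, τ ^ 2 / 2 ≤ g k := by
    intro k hk
    have hae : ∀ᵐ z ∂(μ.prod μ), (1:ℝ) / 2 ≤ Real.cos ((z.1 - z.2) * ⟪k, v⟫) := by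
      have hm : ∀ᵐ z ∂(μ.prod μ), z.1 ∈ Ioc s0 s1 ∧ z.2 ∈ Ioc s0 s1 := by
        rw [hμ, Measure.prod_restrict]
        exact (ae_restrict_iff' (measurableSet_Ioc.prod measurableSet_Ioc)).2 (ae_of_all _ fun z hz => ⟨hz.1, hz.2⟩)
      filter_upwards [hm] with z hz
      have h1 : |z.1 - z.2| ≤ τ := by
        rw [abs_le]; constructor <;> linarith [hz.1.1, hz.1.2, hz.2.1, hz.2.2]
      have h2 : |(z.1 - z.2) * ⟪k, v⟫| ≤ 1 := by
        rw [abs_mul]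
        calc _ ≤ τ * (1 / τ) := mul_le_mul h1 hk.1 (abs_nonneg _) (by linarith)
          _ = 1 := by field_simp
      have h3 := Real.one_sub_sq_div_two_le_cos (x := (z.1 - z.2) * ⟪k, v⟫)
      have h4 := (sq_le_one_iff_abs_le_one _).2 h2
      linarith
    have := integral_mono_ae (integrable_const ((1:ℝ) / 2)) (hcosI k) hae
    rw [integral_const] at this
    have e : (μ.prod μ).real univ = τ * τ := by
      rw [← univ_prod_univ, measureReal_prod_prod, hμr]
    rw [e] at this
    simp only [smul_eq_mul] at this
    simp only [hg]
    linarith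
  have hws : ∀ k ∈ slab v r0 τ, m0 / 2 ≤ w k := by
    intro k hk
    have h1 := hmm k hk.2.1 hk.2.2
    have hkp : 0 < ‖k‖ := lt_of_lt_of_le (by positivity) hk.2.1
    have h2 : 1 / 2 ≤ qv v k := by
      rw [qv_eq, hv]
      have h3 : ⟪k, v⟫ ^ 2 ≤ (r0 / 4) ^ 2 := by
        rw [← sq_abs]
        refine pow_le_pow_left₀ (abs_nonneg _) (hk.1.trans ?_) 2
        rw [div_le_iff₀ (by linarith)]
        rw [div_le_iff₀ hr0] at hτ4
        linarith
      have h4 : (r0 / 2) ^ 2 ≤ ‖k‖ ^ 2 := pow_le_pow_left₀ (by positivity) hk.2.1 2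
      have h5 : ⟪k, v⟫ ^ 2 / ‖k‖ ^ 2 ≤ 1 / 2 := by
        rw [div_le_iff₀ (by positivity)]
        nlinarith
      linarith
    simp only [hw]
    calc m0 / 2 = m0 * (1 / 2) := by ring
      _ ≤ _ := mul_le_mul h1 h2 (by norm_num) (by linarith)
  have hS := slab_meas v r0 τ
  have hSfin : volume (slab v r0 τ) ≠ ⊤ := by
    refine ne_top_of_le_ne_top (measure_closedBall_lt_top (x := (0 : Eu d)) (r := r0)).ne (measure_mono fun k hk => ?_)
    simpa using hk.2.2
  have hgw : Integrable fun k => g k * w k := by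
    have := hbig.integral_prod_right
    simpa [integral_mul_const] using this
  have hfinal : ∫ k, (slab v r0 τ).indicator (fun _ => τ ^ 2 / 2 * (m0 / 2)) k ≤ ∫ k, g k * w k := by
    refine integral_mono ?_ hgw fun k => ?_
    · exact (integrable_indicator_iff hS).2 (integrableOn_const hSfin)
    · by_cases hk : k ∈ slab v r0 τ
      · rw [indicator_of_mem hk]
        exact mul_le_mul (hgs k hk) (hws k hk) (by positivity) (hg0 k)
      · rw [indicator_of_notMem hk]
        exact mul_nonneg (hg0 k) (hw0 k)
  rw [integral_indicator_const _ hS, smul_eq_mul] at hfinal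
  refine le_trans ?_ hfinal
  have hvr : c / τ ≤ volume.real (slab v r0 τ) := by
    have := hvol τ hτ4
    exact (ENNReal.ofReal_le_iff_le_toReal hSfin).1 this
  calc c * m0 / 4 * τ = c / τ * (τ ^ 2 / 2 * (m0 / 2)) := by field_simp; ring
    _ ≤ _ := by gcongr

end
end KP


namespace KP

/-- Square of a simple integral as an iterated integral. -/
theorem Jw_sq {d : ℕ} {ι : Type*} (G : ι → Eu d → ℝ) (v : Eu d) (s0 : ℝ)
    (hG : ∀ p, Continuous (G p)) (p : ι) (s : ℝ) (z : Eu d) :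
    Jw G v s0 [p] s z ^ 2 = 2 * Jw G v s0 [p, p] s z := by
  have hc : Continuous fun r : ℝ => G p (z + r • v) := (hG p).comp (by fun_prop)
  simp only [Jw, mul_one]
  have hd : ∀ x, HasDerivAt (fun x => (∫ r in s0..x, G p (z + r • v)) ^ 2)
      (2 * (G p (z + x • v) * ∫ r in s0..x, G p (z + r • v))) x := by
    intro x
    have h1 : HasDerivAt (fun x => ∫ r in s0..x, G p (z + r • v)) (G p (z + x • v)) x :=
      intervalIntegral.integral_hasDerivAt_right (hc.intervalIntegrable _ _)
        hc.stronglyMeasurable.stronglyMeasurableAtFilter hc.continuousAt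
    have h2 := h1.pow 2
    refine h2.congr_deriv ?_
    push_cast
    ring
  have hcc : Continuous fun x => ∫ r in s0..x, G p (z + r • v) :=
    continuous_iff_continuousAt.2 fun x => (intervalIntegral.integral_hasDerivAt_right
      (hc.intervalIntegrable _ _) hc.stronglyMeasurable.stronglyMeasurableAtFilter
        hc.continuousAt).continuousAt
  have h3 := intervalIntegral.integral_eq_sub_of_hasDerivAt (a := s0) (b := s)
    (fun x _ => hd x) ((continuous_const.mul (hc.mul hcc)).intervalIntegrable _ _)
  rw [intervalIntegral.integral_same] at h3
  rw [intervalIntegral.integral_const_mul] at h3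
  simp only [ne_eq, OfNat.ofNat_ne_zero, not_false_eq_true, zero_pow, sub_zero] at h3
  exact h3.symm

/-- Anti-concentration by fourth moments. -/
theorem anticonc {Ω : Type*} [MeasurableSpace Ω] {P : Measure Ω} [IsProbabilityMeasure P]
    (Z : Ω → ℝ) (hZ : Measurable Z) (m A b : ℝ) (hm : 0 < m) (hA : 0 < A) (hb : 0 ≤ b)
    (h2 : m ≤ ∫ ω, Z ω ^ 2 ∂P)
    (h4 : ∫⁻ ω, ENNReal.ofReal (Z ω ^ 4) ∂P ≤ ENNReal.ofReal A)
    (B : Set Ω) (hB : P B ≤ ENNReal.ofReal b)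
    (hZB : ∀ᵐ ω ∂P, ω ∉ B → Z ω ^ 2 ≤ m / 4) : m ^ 2 ≤ 2 * A * b := by
  set B' := toMeasurable P B with hB'
  have mB : MeasurableSet B' := measurableSet_toMeasurable _ _
  have pB : P.real B' ≤ b := by
    rw [Measure.real, measure_toMeasurable]
    exact ENNReal.toReal_le_of_le_ofReal hb hB
  have i4 : Integrable (fun ω => Z ω ^ 4) P := by
    refine ⟨(hZ.pow_const 4).aestronglyMeasurable, ?_⟩
    rw [hasFiniteIntegral_iff_ofReal (Eventually.of_forall fun ω => by positivity)]
    exact h4.trans_lt ENNReal.ofReal_lt_top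
  have e4 : ∫ ω, Z ω ^ 4 ∂P ≤ A := by
    rw [integral_eq_lintegral_of_nonneg_ae (Eventually.of_forall fun ω => by positivity)
      i4.aestronglyMeasurable]
    exact ENNReal.toReal_le_of_le_ofReal hA.le h4
  have iB : Integrable (B'.indicator fun _ => A / m) P :=
    (integrable_const _).indicator mB
  have hpt : ∀ᵐ ω ∂P, Z ω ^ 2 ≤ m / 4 + m / (4 * A) * Z ω ^ 4 + B'.indicator (fun _ => A / m) ω := by
    filter_upwards [hZB] with ω hω
    have p4 : 0 ≤ m / (4 * A) * Z ω ^ 4 := by positivity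
    by_cases hm' : ω ∈ B'
    · rw [indicator_of_mem hm']
      have key : m / (4 * A) * Z ω ^ 4 + A / m - Z ω ^ 2
          = (m / (4 * A)) * (Z ω ^ 2 - 2 * A / m) ^ 2 := by
        field_simp
        ring
      have : 0 ≤ (m / (4 * A)) * (Z ω ^ 2 - 2 * A / m) ^ 2 := by positivity
      linarith
    · rw [indicator_of_notMem hm']
      have := hω (fun hh => hm' (subset_toMeasurable P B hh))
      linarith
  have hle : ∫ ω, Z ω ^ 2 ∂P ≤ ∫ ω, (m / 4 + m / (4 * A) * Z ω ^ 4
      + B'.indicator (fun _ => A / m) ω) ∂P := by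
    refine integral_mono_of_nonneg (Eventually.of_forall fun ω => by positivity)
      (((integrable_const _).add (i4.const_mul _)).add iB) hpt
  rw [integral_add (f := fun ω => m / 4 + m / (4 * A) * Z ω ^ 4)
      ((integrable_const _).add (i4.const_mul _)) iB,
    integral_add (f := fun ω => m / 4) (integrable_const _) (i4.const_mul _),
    integral_const_mul, integral_indicator_const _ mB] at hle
  simp only [integral_const, probReal_univ, smul_eq_mul, one_mul] at hle
  have h5 : m / (4 * A) * ∫ ω, Z ω ^ 4 ∂P ≤ m / 4 := by
    calc _ ≤ m / (4 * A) * A := by gcongr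
      _ = m / 4 := by field_simp
  have h6 : P.real B' * (A / m) ≤ b * (A / m) := by gcongr
  have h7 : m / 2 ≤ b * (A / m) := by linarith
  rw [mul_div_assoc', div_le_div_iff₀ (by norm_num) hm] at h7
  nlinarith

end KP


namespace KP
section
variable {d : ℕ} {Ω : Type*} [MeasurableSpace Ω] {P : Measure Ω} [IsProbabilityMeasure P]
  {F : Ω → Eu d → Eu d} {R : Eu d → Fin d → Fin d → ℝ}

/-- Longitudinal component along the line. -/
noncomputable def lg (v : Eu d) (f : Eu d → Eu d) (s : ℝ) : ℝ := ∑ c, v c * f (s • v) c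

theorem GF.lg_meas (h : GF P F R) (v : Eu d) : Measurable fun x : Ω × ℝ => lg v (F x.1) x.2 := by
  unfold lg
  refine Finset.measurable_sum _ fun c _ => measurable_const.mul ?_
  have := h.meas.comp (measurable_fst.prodMk (measurable_snd.smul_const v) :
    Measurable fun x : Ω × ℝ => (x.1, x.2 • v))
  exact (EuclideanSpace.proj c : Eu d →L[ℝ] ℝ).continuous.measurable.comp this

theorem GF.lg_memLp (h : GF P F R) (v : Eu d) (s : ℝ) : MemLp (fun ω => lg v (F ω) s) 2 P := by
  unfold lg
  exact memLp_finsetSum _ fun c _ => (h.memF (s • v) c).const_mul (v c)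

theorem GF.lg_cov (h : GF P F R) (v : Eu d) (s s' : ℝ) :
    ∫ ω, lg v (F ω) s * lg v (F ω) s' ∂P = ∑ i, ∑ j, v i * v j * R ((s - s') • v) i j := by
  unfold lg
  simp_rw [Finset.sum_mul_sum]
  have hi : ∀ i j, Integrable (fun ω => v i * F ω (s • v) i * (v j * F ω (s' • v) j)) P :=
    fun i j => mul_int ((h.memF (s • v) i).const_mul (v i)) ((h.memF (s' • v) j).const_mul (v j))
  rw [integral_finsetSum _ fun i _ => integrable_finsetSum _ fun j _ => hi i j]
  refine Finset.sum_congr rfl fun i _ => ?_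
  rw [integral_finsetSum _ fun j _ => hi i j]
  refine Finset.sum_congr rfl fun j _ => ?_
  rw [sub_smul, ← h.cov, ← integral_const_mul]
  congr 1; ext ω; ring

theorem GF.lg_sq (h : GF P F R) (v : Eu d) (s0 s1 : ℝ) :
    ∫ ω, (∫ s in Ioc s0 s1, lg v (F ω) s) ^ 2 ∂P = ∫ z, (∑ i, ∑ j, v i * v j *
      R ((z.1 - z.2) • v) i j) ∂((volume.restrict (Ioc s0 s1)).prod (volume.restrict (Ioc s0 s1))) := by
  set μ : Measure ℝ := volume.restrict (Ioc s0 s1) with hμ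
  set B : ℝ := ∑ i, ∑ j, v i * v j * R 0 i j with hB
  have hsq : ∀ s, ∫ ω, lg v (F ω) s * lg v (F ω) s ∂P = B := by
    intro s; rw [h.lg_cov]; simp [hB]
  have m1 : Measurable fun x : Ω × ℝ × ℝ => lg v (F x.1) x.2.1 * lg v (F x.1) x.2.2 :=
    ((h.lg_meas v).comp (f := fun x : Ω × ℝ × ℝ => (x.1, x.2.1)) (by fun_prop)).mul
      ((h.lg_meas v).comp (f := fun x : Ω × ℝ × ℝ => (x.1, x.2.2)) (by fun_prop))
  have i1 : Integrable (fun x : Ω × ℝ × ℝ => lg v (F x.1) x.2.1 * lg v (F x.1) x.2.2)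
      (P.prod (μ.prod μ)) := by
    rw [integrable_prod_iff' m1.aestronglyMeasurable]
    refine ⟨Eventually.of_forall fun z => mul_int (h.lg_memLp v z.1) (h.lg_memLp v z.2), ?_⟩
    refine Integrable.of_bound (C := 2 * B) ?_ (Eventually.of_forall fun z => ?_)
    · exact (m1.norm.comp measurable_swap).stronglyMeasurable.integral_prod_right'.aestronglyMeasurable
    · have a1 := mul_int (h.lg_memLp v z.1) (h.lg_memLp v z.1)
      have a2 := mul_int (h.lg_memLp v z.2) (h.lg_memLp v z.2)
      rw [Real.norm_of_nonneg (integral_nonneg fun ω => norm_nonneg _)]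
      have : ∫ ω, ‖lg v (F ω) z.1 * lg v (F ω) z.2‖ ∂P ≤ ∫ ω, (lg v (F ω) z.1 * lg v (F ω) z.1
          + lg v (F ω) z.2 * lg v (F ω) z.2) ∂P := by
        refine integral_mono_of_nonneg (Eventually.of_forall fun ω => norm_nonneg _) (a1.add a2)
          (Eventually.of_forall fun ω => ?_)
        dsimp only
        rw [Real.norm_eq_abs, abs_le]
        constructor <;> nlinarith [sq_nonneg (lg v (F ω) z.1 + lg v (F ω) z.2),
          sq_nonneg (lg v (F ω) z.1 - lg v (F ω) z.2), sq_nonneg (lg v (F ω) z.1),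
          sq_nonneg (lg v (F ω) z.2)]
      rw [integral_add a1 a2, hsq, hsq] at this
      linarith
  have e1 : ∀ ω, (∫ s, lg v (F ω) s ∂μ) ^ 2
      = ∫ z, lg v (F ω) z.1 * lg v (F ω) z.2 ∂(μ.prod μ) := by
    intro ω; rw [integral_prod_mul (fun s => lg v (F ω) s) (fun s => lg v (F ω) s), sq]
  simp_rw [e1]
  rw [integral_integral_swap (f := fun ω (z : ℝ × ℝ) => lg v (F ω) z.1 * lg v (F ω) z.2) i1]
  simp_rw [h.lg_cov]

/-- The leading fluctuation. -/
noncomputable def Zf (v : Eu d) (χ : SchwartzMap (Eu d) ℝ) (s0 s1 : ℝ) (f : Eu d → Eu d) : ℝ :=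
  ∑ c, v c * Jw (Gs f) v s0 [(χ, c)] s1 0

theorem GF.good (h : GF P F R) : ∀ᵐ ω ∂P, ∀ (v : Eu d) s0 s1, ∀ (p : Ix d) z,
    Integrable (fun a : ℝ × Eu d => p.1 a.2 * F ω (z + a.1 • v - a.2) p.2) (nu d s0 s1) := by
  filter_upwards [h.Aw_ae 1] with ω hω v s0 s1 p z
  exact hf_nu v s0 s1 (F ω) (h.F_meas ω) hω p z

theorem GF.Jw_eq (h : GF P F R) (v : Eu d) : ∀ᵐ ω ∂P, ∀ s0 s1 (w : List (Ix d)) s (_ : s ∈ Icc s0 s1) z,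
    Jw (Gs (F ω)) v s0 w s z = Jr v s0 s1 (F ω) w.get s z := by
  filter_upwards [h.good] with ω hω s0 s1 w s hs z
  rw [← Jw_eq_Jr v s0 s1 (F ω) (hω v s0 s1) w.get s hs z, List.ofFn_get]

theorem GF.Jw_sq_bound (h : GF P F R) (v : Eu d) (C : ℝ) (hC : 0 ≤ C) (hL : LineBound R v C)
    (w : List (Ix d)) : ∃ Cw : ℝ, 0 ≤ Cw ∧ ∀ s0 s1 : ℝ, 1 ≤ s1 - s0 → ∀ s ∈ Icc s0 s1, ∀ z,
      ∫⁻ ω, ENNReal.ofReal (Jw (Gs (F ω)) v s0 w s z ^ 2) ∂P ≤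
        ENNReal.ofReal (Cw * ((s1 - s0) * (1 + Real.log (s1 - s0))) ^ w.length) := by
  obtain ⟨Cw, h0, h1⟩ := h.Jr_sq_bound v C hC hL w.get
  refine ⟨Cw, h0, fun s0 s1 hs s hss z => ?_⟩
  refine (lintegral_congr_ae ?_).le.trans (h1 s0 s1 hs s z)
  filter_upwards [h.Jw_eq v] with ω hω
  rw [hω s0 s1 w s hss z]

theorem GF.Gs_cont (h : GF P F R) : ∀ᵐ ω ∂P, ∀ p, Continuous (Gs (F ω) p) := by
  filter_upwards [h.Aw_ae 1] with ω hω p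
  exact continuous_iff_continuousAt.2 fun x =>
    (Gs_hasFDerivAt (F ω) (h.F_meas ω) hω p x).continuousAt

theorem GF.anticonc (h : GF P F R) (v : Eu d) (hv : ‖v‖ = 1) (C : ℝ) (hC : 0 ≤ C)
    (hL : LineBound R v C) (χ : SchwartzMap (Eu d) ℝ)
    (hχ : ∀ᵐ ω ∂P, ∀ x c, F ω x c = Gs (F ω) (χ, c) x)
    (c τ0 : ℝ) (hc : 0 < c) (hτ0 : 1 ≤ τ0)
    (hlow : ∀ s0 s1, τ0 ≤ s1 - s0 → c * (s1 - s0) ≤ ∫ z, (∑ i, ∑ j, v i * v j *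
      R ((z.1 - z.2) • v) i j) ∂((volume.restrict (Ioc s0 s1)).prod (volume.restrict (Ioc s0 s1)))) :
    ∃ C' > 0, ∀ s0 s1, τ0 ≤ s1 - s0 → ∀ b, 0 ≤ b → ∀ B : Set Ω, P B ≤ ENNReal.ofReal b →
      (∀ᵐ ω ∂P, ω ∉ B → Zf v χ s0 s1 (F ω) ^ 2 ≤ c * (s1 - s0) / 4) →
      1 ≤ C' * (1 + Real.log (s1 - s0)) ^ 2 * b := by
  choose Cp hCp0 hCp using fun i : Fin d => h.Jw_sq_bound v C hC hL [(χ, i), (χ, i)]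
  set A0 : ℝ := 4 * d ^ 3 * ∑ i, Cp i + 1 with hA0
  have hA0p : 0 < A0 := by
    have : 0 ≤ ∑ i, Cp i := Finset.sum_nonneg fun i _ => hCp0 i
    positivity
  refine ⟨2 * A0 / c ^ 2, by positivity, fun s0 s1 hs b hb B hB hZB => ?_⟩
  have hτ1 : 1 ≤ s1 - s0 := hτ0.trans hs
  have hτ : 0 < s1 - s0 := by linarith
  have hlog : 0 ≤ Real.log (s1 - s0) := Real.log_nonneg hτ1
  set τ := s1 - s0 with hτd
  have hss : s1 ∈ Icc s0 s1 := ⟨by linarith, le_rfl⟩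
  set Z : Ω → ℝ := fun ω => ∑ i, v i * Jr v s0 s1 (F ω) [(χ, i)].get s1 0 with hZ
  have hZe : ∀ᵐ ω ∂P, Zf v χ s0 s1 (F ω) = Z ω := by
    filter_upwards [h.Jw_eq v] with ω hω
    unfold Zf
    simp_rw [hω s0 s1 _ s1 hss 0]
    rfl
  have mZ : Measurable Z := Finset.measurable_sum _ fun i _ => measurable_const.mul
    ((h.Jr_meas v s0 s1 [(χ, i)].get 0).comp (f := fun ω => (ω, s1)) (by fun_prop))
  have e2 : ∫ ω, Z ω ^ 2 ∂P = ∫ ω, (∫ s in Ioc s0 s1, lg v (F ω) s) ^ 2 ∂P := by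
    refine integral_congr_ae ?_
    filter_upwards [hZe, hχ, h.Gs_cont] with ω h1 h2 h3
    rw [← h1]
    congr 1
    unfold Zf lg
    simp only [Jw, mul_one, zero_add]
    simp_rw [h2]
    rw [← intervalIntegral.integral_of_le hss.1, intervalIntegral.integral_finsetSum]
    · simp_rw [intervalIntegral.integral_const_mul]
    · intro i _
      exact (continuous_const.mul ((h3 (χ, i)).comp (by fun_prop : Continuous fun s : ℝ => s • v))).intervalIntegrable _ _
  have h4 : ∫⁻ ω, ENNReal.ofReal (Z ω ^ 4) ∂P ≤ ENNReal.ofReal (A0 * (τ * (1 + Real.log τ)) ^ 2) := by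
    have hpt : ∀ᵐ ω ∂P, ENNReal.ofReal (Z ω ^ 4) ≤ ∑ i, ENNReal.ofReal (4 * d ^ 3) *
        ENNReal.ofReal (Jw (Gs (F ω)) v s0 [(χ, i), (χ, i)] s1 0 ^ 2) := by
      filter_upwards [hZe, h.Gs_cont] with ω h1 h3
      rw [← h1]
      simp_rw [← ENNReal.ofReal_mul (show (0:ℝ) ≤ 4 * d ^ 3 by positivity)]
      rw [← ENNReal.ofReal_sum_of_nonneg fun i _ => by positivity]
      refine ENNReal.ofReal_le_ofReal ?_
      have q : |Zf v χ s0 s1 (F ω)| ≤ ∑ i, |Jw (Gs (F ω)) v s0 [(χ, i)] s1 0| := by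
        unfold Zf
        refine (Finset.abs_sum_le_sum_abs _ _).trans (Finset.sum_le_sum fun i _ => ?_)
        rw [abs_mul]
        have : |v i| ≤ 1 := by rw [← hv]; exact PiLp.norm_apply_le v i
        exact mul_le_of_le_one_left (abs_nonneg _) this
      calc Zf v χ s0 s1 (F ω) ^ 4 = |Zf v χ s0 s1 (F ω)| ^ 4 := by
            rw [pow_abs, abs_of_nonneg (by positivity)]
        _ ≤ (∑ i, |Jw (Gs (F ω)) v s0 [(χ, i)] s1 0|) ^ 4 := by gcongr
        _ ≤ (Finset.univ : Finset (Fin d)).card ^ 3 * ∑ i, |Jw (Gs (F ω)) v s0 [(χ, i)] s1 0| ^ 4 :=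
            pow_sum_le_card_mul_sum_pow (fun i _ => abs_nonneg _) 3
        _ = _ := by
            rw [Finset.card_univ, Fintype.card_fin, Finset.mul_sum]
            refine Finset.sum_congr rfl fun i _ => ?_
            have := Jw_sq (Gs (F ω)) v s0 h3 (χ, i) s1 0
            rw [pow_abs, abs_of_nonneg (by positivity), show ∀ x : ℝ, x ^ 4 = (x ^ 2) ^ 2 by
              intro x; ring, this]
            ring
    refine (lintegral_mono_ae hpt).trans ?_
    have haem : ∀ i, AEMeasurable (fun ω => ENNReal.ofReal (Jw (Gs (F ω)) v s0 [(χ, i), (χ, i)] s1 0 ^ 2)) P := by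
      intro i
      refine ⟨fun ω => ENNReal.ofReal (Jr v s0 s1 (F ω) [(χ, i), (χ, i)].get s1 0 ^ 2), ?_, ?_⟩
      · exact (((h.Jr_meas v s0 s1 [(χ, i), (χ, i)].get 0).comp (f := fun ω => (ω, s1)) (by fun_prop)).pow_const 2).ennreal_ofReal
      · filter_upwards [h.Jw_eq v] with ω hω
        rw [hω s0 s1 _ s1 hss 0]
    rw [lintegral_finsetSum' _ fun i _ => (haem i).const_mul _]
    have : ∀ i, ∫⁻ ω, ENNReal.ofReal (4 * d ^ 3) *
        ENNReal.ofReal (Jw (Gs (F ω)) v s0 [(χ, i), (χ, i)] s1 0 ^ 2) ∂P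
        ≤ ENNReal.ofReal (4 * d ^ 3 * (Cp i * (τ * (1 + Real.log τ)) ^ 2)) := by
      intro i
      rw [lintegral_const_mul'' _ (haem i), ENNReal.ofReal_mul (p := 4 * d ^ 3) (by positivity)]
      exact mul_le_mul_right (hCp i s0 s1 hτ1 s1 hss 0) _
    refine (Finset.sum_le_sum fun i _ => this i).trans ?_
    rw [← ENNReal.ofReal_sum_of_nonneg fun i _ => by have := hCp0 i; positivity]
    refine ENNReal.ofReal_le_ofReal ?_
    rw [← Finset.mul_sum, ← Finset.sum_mul, ← mul_assoc]
    gcongr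
    rw [hA0]; linarith
  have h2 : c * τ ≤ ∫ ω, Z ω ^ 2 ∂P := by rw [e2, h.lg_sq]; exact hlow s0 s1 hs
  have fin := KP.anticonc Z mZ (c * τ) (A0 * (τ * (1 + Real.log τ)) ^ 2) b (by positivity)
    (by positivity) hb h2 h4 B hB (by
      filter_upwards [hZB, hZe] with ω h1 h2 hb
      rw [← h2]; exact h1 hb)
  have e : 2 * (A0 * (τ * (1 + Real.log τ)) ^ 2) * b
      = (c * τ) ^ 2 * (2 * A0 / c ^ 2 * (1 + Real.log τ) ^ 2 * b) := by
    field_simp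
  rw [e] at fin
  have hp : 0 < (c * τ) ^ 2 := by positivity
  exact le_of_mul_le_mul_left (by rw [mul_one]; exact fin) hp

end
end KP


namespace KP
section
variable {d : ℕ} {ι : Type*} (G : ι → Eu d → ℝ) (D : Fin d → ι → ι) (e : Fin d → ι) (v : Eu d) (s0 : ℝ)

theorem absJ_cont (hG : ∀ p, Continuous (G p)) (W : List (List ι)) :
    Continuous (fun q : ℝ × Eu d => absJ G v s0 W q.1 q.2) := by
  induction W with
  | nil => simp only [absJ_nil]; exact continuous_const
  | cons w W ih => simp only [absJ_cons]; exact (Jw_cont G v s0 hG w).abs.add ih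

theorem det_main (hG : ∀ p x, HasFDerivAt (G p)
      (∑ l, G (D l p) x • (EuclideanSpace.proj l : Eu d →L[ℝ] ℝ)) x)
    (F : Eu d → Eu d) (hF : ∀ x l, F x l = G (e l) x) (δ : ℝ) (hδ : 0 < δ)
    (y : ℝ → Eu d) (s1 : ℝ) (h01 : s0 ≤ s1)
    (hy : ∀ s ∈ Icc s0 s1, HasDerivAt y (δ • F (y s + s • v)) s) (N L : ℕ)
    (κ σ A Bc E Mc : ℝ) (hκ0 : 0 ≤ κ) (hκ1 : κ ≤ 1) (hσ : 1 ≤ σ) (hA : 0 ≤ A) (hMc : 0 ≤ Mc)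
    (hy0 : ‖y s0‖ ≤ κ) (hy1 : ‖y s1‖ ≤ κ)
    (hJ : ∀ c, ∀ n ≤ N, ∀ j ≤ L, absJ G v s0 ((dAll D)^[j] (Uw D e c n)) s1 0 ≤ A * σ ^ (n + 1))
    (hB : ∀ c, ∀ n ≤ N, ∀ j ≤ L + 1, ∀ z ∈ Metric.closedBall (0 : Eu d) κ,
      absJ G v s0 ((dAll D)^[j] (Uw D e c n)) s1 z ≤ Bc)
    (hκB : κ ^ L * Bc ≤ 1)
    (hE : ∀ c, δ ^ (N + 2) * ∫ s in s0..s1, |Ef G D e v s0 (Uw D e c N) s (y s)| ≤ E)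
    (hδσ : δ * σ ≤ 1)
    (hM : ∀ c, ∀ n ≤ N, ∀ j ≤ 1, (cW D L ((dAll D)^[j] (Uw D e c n)) : ℝ) ≤ Mc) (c : Fin d) :
    δ * |Jw G v s0 [e c] s1 0| ≤ 2 * κ + E + Mc * (L * A + 1) * κ * (δ * σ)
      + N * (Mc * (L * A + 1)) * (δ * σ) ^ 2 := by
  set Q := Mc * (L * A + 1) with hQ
  have hQ0 : 0 ≤ Q := by positivity
  have key : ∀ n ≤ N, ∀ i ≤ 1, ∀ z ∈ Metric.closedBall (0 : Eu d) κ,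
      absJ G v s0 ((dAll D)^[i] (Uw D e c n)) s1 z ≤ Q * σ ^ (n + 1) := by
    intro n hn i hi z hz
    have hpow : 1 ≤ σ ^ (n + 1) := one_le_pow₀ hσ
    have t := absJ_taylor G D v s0 hG L ((dAll D)^[i] (Uw D e c n)) s1 0 z κ Bc
      (by simpa using hz) (fun z' hz' => by
        rw [← Function.iterate_add_apply]
        exact hB c n hn (L + i) (by omega) z' hz')
    refine t.trans ?_
    have h1 : ∑ j ∈ Finset.range L, κ ^ j * absJ G v s0 ((dAll D)^[j] ((dAll D)^[i] (Uw D e c n))) s1 0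
        ≤ ∑ j ∈ Finset.range L, A * σ ^ (n + 1) := by
      refine Finset.sum_le_sum fun j hj => ?_
      rw [← Function.iterate_add_apply]
      have := hJ c n hn (j + i) (by have := Finset.mem_range.1 hj; omega)
      exact (mul_le_of_le_one_left (absJ_nonneg _ _ _ _ _ _) (pow_le_one₀ hκ0 hκ1)).trans this
    rw [Finset.sum_const, Finset.card_range, nsmul_eq_mul] at h1
    calc _ ≤ Mc * (L * (A * σ ^ (n + 1)) + σ ^ (n + 1)) := by
          refine mul_le_mul (hM c n hn i hi) (by linarith) ?_ hMc
          have : 0 ≤ ∑ j ∈ Finset.range L, κ ^ j * absJ G v s0 ((dAll D)^[j] ((dAll D)^[i] (Uw D e c n))) s1 0 :=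
            Finset.sum_nonneg fun j _ => mul_nonneg (by positivity) (absJ_nonneg _ _ _ _ _ _)
          have hBc : 0 ≤ Bc := (absJ_nonneg _ _ _ _ _ _).trans (hB c n hn 0 (by omega) z hz)
          positivity
      _ = _ := by rw [hQ]; ring
  have hy1' : y s1 ∈ Metric.closedBall (0 : Eu d) κ := by simpa using hy1
  have ex := expansion G D e v s0 hG F hF δ hδ y s1 h01 hy c N
  have ex' := ex.trans (hE c)
  rw [Finset.sum_range_succ'] at ex'
  simp only [pow_zero, one_mul] at ex'
  have e0 : Jsum G v s0 (Uw D e c 0) s1 (y s1) = Jw G v s0 [e c] s1 (y s1) := by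
    simp [Uw, Jsum]
  rw [e0] at ex'
  have d0 : |Jw G v s0 [e c] s1 (y s1) - Jw G v s0 [e c] s1 0| ≤ κ * (Q * σ) := by
    refine Jw_mvt G D v s0 hG [e c] s1 0 (y s1) κ (Q * σ) (by simpa using hy1) fun z' hz' => ?_
    have := key 0 (Nat.zero_le _) 1 le_rfl z' hz'
    simpa [Uw] using this
  have ds : |δ * ∑ n ∈ Finset.range N, (-δ) ^ (n + 1) * Jsum G v s0 (Uw D e c (n + 1)) s1 (y s1)|
      ≤ N * Q * (δ * σ) ^ 2 := by
    rw [Finset.mul_sum]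
    refine (Finset.abs_sum_le_sum_abs _ _).trans ?_
    have : ∀ n ∈ Finset.range N, |δ * ((-δ) ^ (n + 1) * Jsum G v s0 (Uw D e c (n + 1)) s1 (y s1))|
        ≤ Q * (δ * σ) ^ 2 := by
      intro n hn
      have hn' := Finset.mem_range.1 hn
      have k1 := (abs_Jsum_le G v s0 (Uw D e c (n + 1)) s1 (y s1)).trans
        (key (n + 1) (by omega) 0 (by omega) (y s1) hy1')
      rw [abs_mul, abs_mul, abs_pow, abs_neg, abs_of_pos hδ]
      calc _ ≤ δ * (δ ^ (n + 1) * (Q * σ ^ (n + 1 + 1))) := by gcongr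
        _ = Q * ((δ * σ) ^ 2 * (δ * σ) ^ n) := by ring
        _ ≤ Q * ((δ * σ) ^ 2 * 1) := by
          gcongr
          exact pow_le_one₀ (by positivity) hδσ
        _ = _ := by ring
    refine (Finset.sum_le_sum this).trans ?_
    rw [Finset.sum_const, Finset.card_range, nsmul_eq_mul]
    exact (mul_assoc _ _ _).ge
  have c0 : |y s0 c| ≤ κ := (PiLp.norm_apply_le _ c).trans hy0
  have c1 : |y s1 c| ≤ κ := (PiLp.norm_apply_le _ c).trans hy1
  rw [mul_add] at ex'
  set S := δ * ∑ n ∈ Finset.range N, (-δ) ^ (n + 1) * Jsum G v s0 (Uw D e c (n + 1)) s1 (y s1)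
  set J1 := Jw G v s0 [e c] s1 (y s1)
  set J0 := Jw G v s0 [e c] s1 0
  have : |δ * (J1 - J0)| ≤ Q * κ * (δ * σ) := by
    rw [abs_mul, abs_of_pos hδ]
    calc _ ≤ δ * (κ * (Q * σ)) := by gcongr
      _ = _ := by ring
  rw [show δ * |J0| = |δ * J0| by rw [abs_mul, abs_of_pos hδ]]
  rw [abs_le] at *
  constructor <;> linarith

theorem det_rem (hG : ∀ p x, HasFDerivAt (G p)
      (∑ l, G (D l p) x • (EuclideanSpace.proj l : Eu d →L[ℝ] ℝ)) x)
    (y : ℝ → Eu d) (s1 : ℝ) (h01 : s0 ≤ s1) (W : List (List ι)) (L : ℕ)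
    (Γ r Bc : ℝ) (hr1 : r ≤ 1) (hΓ0 : 0 ≤ Γ)
    (hΓ : ∀ s ∈ Icc s0 s1, ∀ l, |G (e l) (y s + s • v)| ≤ Γ)
    (net : Finset (Eu d)) (hnet : ∀ s ∈ Icc s0 s1, ∃ m ∈ net, ‖y s - m‖ ≤ r)
    (hB : ∀ s ∈ Icc s0 s1, ∀ z, ‖z - y s‖ ≤ 2 * r →
      absJ G v s0 ((dAll D)^[L] (dAll D W)) s z ≤ Bc) (hrB : r ^ L * Bc ≤ 1) :
    ∫ s in s0..s1, |Ef G D e v s0 W s (y s)| ≤ Γ * cW D L (dAll D W) *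
      ((∫ s in s0..s1, ∑ m ∈ net, ∑ j ∈ Finset.range L, absJ G v s0 ((dAll D)^[j] (dAll D W)) s m)
        + (s1 - s0)) := by
  have cG := G_cont G D hG
  set H : ℝ → ℝ := fun s => ∑ m ∈ net, ∑ j ∈ Finset.range L,
    absJ G v s0 ((dAll D)^[j] (dAll D W)) s m with hH
  have cH : Continuous H := continuous_finsetSum _ fun m _ => continuous_finsetSum _ fun j _ =>
    (absJ_cont G v s0 cG _).comp (by fun_prop : Continuous fun s : ℝ => (s, m))
  have hpt : ∀ s ∈ Icc s0 s1, |Ef G D e v s0 W s (y s)| ≤ Γ * cW D L (dAll D W) * (H s + 1) := by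
    intro s hs
    obtain ⟨m, hm, hmr⟩ := hnet s hs
    have hr0 : 0 ≤ r := (norm_nonneg _).trans hmr
    have t := absJ_taylor G D v s0 hG L (dAll D W) s m (y s) r Bc hmr (fun z' hz' => by
      refine hB s hs z' ?_
      have h1 : ‖z' - m‖ ≤ r := by simpa [dist_eq_norm] using hz'
      have h2 : z' - y s = (z' - m) - (y s - m) := by abel
      rw [h2]
      exact (norm_sub_le _ _).trans (by linarith))
    have h1 : ∑ j ∈ Finset.range L, r ^ j * absJ G v s0 ((dAll D)^[j] (dAll D W)) s m ≤ H s := by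
      refine (Finset.sum_le_sum fun j _ => mul_le_of_le_one_left (absJ_nonneg _ _ _ _ _ _)
        (pow_le_one₀ hr0 hr1)).trans ?_
      exact Finset.single_le_sum (f := fun m => ∑ j ∈ Finset.range L,
        absJ G v s0 ((dAll D)^[j] (dAll D W)) s m)
        (fun m _ => Finset.sum_nonneg fun j _ => absJ_nonneg _ _ _ _ _ _) hm
    have h2 : |Ef G D e v s0 W s (y s)| ≤ Γ * absJ G v s0 (dAll D W) s (y s) := by
      rw [absJ_dAll, Finset.mul_sum, Ef]
      refine (Finset.abs_sum_le_sum_abs _ _).trans (Finset.sum_le_sum fun l _ => ?_)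
      rw [abs_mul]
      exact mul_le_mul (hΓ s hs l) (abs_Jsum_le _ _ _ _ _ _) (abs_nonneg _) hΓ0
    refine h2.trans ?_
    rw [mul_assoc]
    refine mul_le_mul_of_nonneg_left (t.trans ?_) hΓ0
    exact mul_le_mul_of_nonneg_left (by linarith) (Nat.cast_nonneg _)
  have hI : IntervalIntegrable (fun s => Γ * cW D L (dAll D W) * (H s + 1)) volume s0 s1 :=
    (continuous_const.mul (cH.add continuous_const)).intervalIntegrable _ _
  have e1 : ∫ s in s0..s1, Γ * cW D L (dAll D W) * (H s + 1)
      = Γ * cW D L (dAll D W) * ((∫ s in s0..s1, H s) + (s1 - s0)) := by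
    rw [intervalIntegral.integral_const_mul, intervalIntegral.integral_add
      (cH.intervalIntegrable _ _) (by simp)]
    simp
  rw [← e1, intervalIntegral.integral_of_le h01, intervalIntegral.integral_of_le h01]
  refine integral_mono_of_nonneg (Eventually.of_forall fun s => abs_nonneg _) hI.1 ?_
  filter_upwards [ae_restrict_mem measurableSet_Ioc] with s hs
  exact hpt s ⟨hs.1.le, hs.2⟩

end
end KP


namespace KP

theorem y_bound {d : ℕ} (v : Eu d) (hv : ‖v‖ = 1) (f : Eu d → Eu d) (y : ℝ → Eu d) (δ T Γ : ℝ)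
    (hδ : 0 < δ) (hT : 0 ≤ T) (hy0 : y 0 = 0)
    (hy : ∀ s, 0 ≤ s → HasDerivAt y (δ • f (y s + s • v)) s)
    (hf : ∀ x, ‖x‖ ≤ 2 * T → ‖f x‖ ≤ Γ) (hΓ : δ * Γ < 1) : ∀ s ∈ Icc 0 T, ‖y s‖ ≤ s := by
  intro s hs
  refine image_norm_le_of_norm_deriv_right_lt_deriv_boundary (f := y)
    (f' := fun s => δ • f (y s + s • v)) (a := 0) (b := T) (B := fun s => s) (B' := fun _ => 1)
    (fun x hx => (hy x hx.1).continuousAt.continuousWithinAt)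
    (fun x hx => (hy x hx.1).hasDerivWithinAt) (by simp [hy0]) (fun x => hasDerivAt_id x) ?_ hs
  intro x hx hxe
  have h1 : ‖y x + x • v‖ ≤ 2 * T := by
    refine (norm_add_le _ _).trans ?_
    rw [hxe, norm_smul, hv, Real.norm_of_nonneg hx.1]
    linarith [hx.2]
  rw [norm_smul, Real.norm_of_nonneg hδ.le]
  exact (mul_le_mul_of_nonneg_left (hf _ h1) hδ.le).trans_lt hΓ

theorem exists_net (d : ℕ) (T δ : ℝ) (hT : 0 ≤ T) (hδ : 0 < δ) : ∃ net : Finset (Eu d),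
    (net.card : ℝ) ≤ (2 * (T / δ) + 3) ^ d ∧ ∀ y : Eu d, ‖y‖ ≤ T → ∃ m ∈ net, ‖y - m‖ ≤ d * δ := by
  classical
  set M : ℤ := ⌈T / δ⌉ with hM
  have hM0 : 0 ≤ M := Int.ceil_nonneg (by positivity)
  set S : Finset (Fin d → ℤ) := Fintype.piFinset fun _ => Finset.Icc (-M) M with hS
  refine ⟨S.image fun z => (WithLp.toLp 2 fun i => δ * (z i : ℝ)), ?_, ?_⟩
  · have h1 : S.card = (2 * M + 1).toNat ^ d := by
      rw [hS, Fintype.card_piFinset]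
      simp
      congr 2
      ring
    have h2 : (((2 * M + 1).toNat : ℕ) : ℝ) = 2 * M + 1 := by
      have : (((2 * M + 1).toNat : ℕ) : ℤ) = 2 * M + 1 := Int.toNat_of_nonneg (by omega)
      exact_mod_cast this
    have h3 : (M : ℝ) < T / δ + 1 := Int.ceil_lt_add_one _
    have h4 : (0:ℝ) ≤ M := by exact_mod_cast hM0
    calc _ ≤ (S.card : ℝ) := by exact_mod_cast Finset.card_image_le
      _ = (2 * M + 1 : ℝ) ^ d := by rw [h1]; push_cast; rw [h2]
      _ ≤ _ := pow_le_pow_left₀ (by positivity) (by linarith) d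
  · intro y hy
    refine ⟨_, Finset.mem_image_of_mem _ (a := fun i => ⌊y i / δ⌋) ?_, ?_⟩
    · rw [hS, Fintype.mem_piFinset]
      intro i
      have hi : |y i| ≤ T := (PiLp.norm_apply_le y i).trans hy
      rw [abs_le] at hi
      rw [Finset.mem_Icc]
      constructor
      · rw [Int.le_floor]
        push_cast
        have := Int.le_ceil (T / δ)
        have h2 : -(T / δ) ≤ y i / δ := by
          rw [← neg_div]; gcongr; exact hi.1
        rw [← hM] at this
        linarith
      · have h1 : y i / δ ≤ T / δ := by gcongr; exact hi.2
        have h2 : ((⌊y i / δ⌋ : ℤ) : ℝ) ≤ M := (Int.floor_le _).trans (h1.trans (Int.le_ceil _))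
        exact_mod_cast h2
    · rw [EuclideanSpace.norm_eq]
      rw [Real.sqrt_le_left (by positivity)]
      calc ∑ i, ‖(y - WithLp.toLp 2 fun i => δ * ((⌊y i / δ⌋ : ℤ) : ℝ)) i‖ ^ 2
          ≤ ∑ i : Fin d, δ ^ 2 := by
            refine Finset.sum_le_sum fun i _ => ?_
            simp only [PiLp.sub_apply, Real.norm_eq_abs, sq_abs]
            have e : y i - δ * ((⌊y i / δ⌋ : ℤ) : ℝ) = δ * Int.fract (y i / δ) := by
              rw [Int.fract]; field_simp
            rw [e]
            have h0 := Int.fract_nonneg (y i / δ)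
            have h1 := (Int.fract_lt_one (y i / δ)).le
            gcongr
            exact mul_le_of_le_one_right hδ.le h1
        _ = d * δ ^ 2 := by simp
        _ ≤ (d * δ) ^ 2 := by
            rw [mul_pow]
            gcongr
            rcases Nat.eq_zero_or_pos d with h | h
            · simp [h]
            · have : (1:ℝ) ≤ d := by exact_mod_cast h
              nlinarith

section
variable {d : ℕ} {Ω : Type*} [MeasurableSpace Ω] {P : Measure Ω} [IsProbabilityMeasure P]
  {F : Ω → Eu d → Eu d} {R : Eu d → Fin d → Fin d → ℝ}

theorem markov (f : Ω → ENNReal) (hf : AEMeasurable f P) (E K : ℝ) (hK : 0 < K) 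
    (h : ∫⁻ ω, f ω ∂P ≤ ENNReal.ofReal E) :
    P {ω | ENNReal.ofReal K < f ω} ≤ ENNReal.ofReal (E / K) := by
  refine (measure_mono (t := {ω | ENNReal.ofReal K ≤ f ω})
    (fun ω (hω : ENNReal.ofReal K < f ω) => hω.le)).trans
    ((meas_ge_le_lintegral_div hf (by simpa using hK) ENNReal.ofReal_ne_top).trans ?_)
  rw [ENNReal.ofReal_div_of_pos hK]
  exact ENNReal.div_le_div_right h _

theorem GF.word_prob (h : GF P F R) (v : Eu d) (C : ℝ) (hC : 0 ≤ C) (hL : LineBound R v C)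
    (w : List (Ix d)) (hw : w ≠ []) : ∃ Cw : ℝ, 0 ≤ Cw ∧ ∀ s0 s1 : ℝ, 1 ≤ s1 - s0 → ∀ σ K u : ℝ,
      0 < σ → 0 < K → 0 ≤ u → u ≤ 1 → (s1 - s0) * (1 + Real.log (s1 - s0)) ≤ u * σ ^ 2 →
      ∀ net : Finset (Eu d), ∃ B : Set Ω,
        P B ≤ ENNReal.ofReal (Cw * (u + net.card * (s1 - s0) / K)) ∧
        ∀ᵐ ω ∂P, ω ∉ B → |Jw (Gs (F ω)) v s0 w s1 0| ≤ σ ^ w.length ∧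
          ∀ m ∈ net, ∫ s in s0..s1, |Jw (Gs (F ω)) v s0 w s m| ≤ K * σ ^ w.length := by
  obtain ⟨Cw, h0, h1⟩ := h.Jr_sq_bound v C hC hL w.get
  refine ⟨1 + Cw, by positivity, fun s0 s1 hs σ K u hσ hK hu hu1 hX net => ?_⟩
  set τ := s1 - s0 with hτ
  have hlog : 0 ≤ Real.log τ := Real.log_nonneg hs
  set n := w.length with hn
  have hn1 : 1 ≤ n := List.length_pos_iff.2 hw
  have hq : Cw * (τ * (1 + Real.log τ)) ^ n ≤ Cw * (u * (σ ^ n) ^ 2) := by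
    gcongr
    calc (τ * (1 + Real.log τ)) ^ n ≤ (u * σ ^ 2) ^ n := by
          have : 0 ≤ τ * (1 + Real.log τ) := by positivity
          gcongr
      _ = u ^ n * (σ ^ n) ^ 2 := by rw [mul_pow, ← pow_mul, ← pow_mul, mul_comm 2]
      _ ≤ u * (σ ^ n) ^ 2 := by
          gcongr
          exact pow_le_of_le_one hu hu1 (by omega)
  have h2 : ∀ s z, ∫⁻ ω, ENNReal.ofReal (Jr v s0 s1 (F ω) w.get s z ^ 2) ∂P ≤
      ENNReal.ofReal (Cw * (u * (σ ^ n) ^ 2)) := fun s z =>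
    (h1 s0 s1 hs s z).trans (ENNReal.ofReal_le_ofReal hq)
  have hm : ∀ z, Measurable fun x : Ω × ℝ => Jr v s0 s1 (F x.1) w.get x.2 z :=
    fun z => h.Jr_meas v s0 s1 w.get z
  have hms : ∀ s z, Measurable fun ω => Jr v s0 s1 (F ω) w.get s z := fun s z =>
    (hm z).comp (f := fun ω => (ω, s)) (by fun_prop)
  have hσn : 0 < σ ^ n := by positivity
  -- first moments
  have h3 : ∀ s z, ∫⁻ ω, ENNReal.ofReal |Jr v s0 s1 (F ω) w.get s z| ∂P ≤
      ENNReal.ofReal ((1 + Cw) * σ ^ n) := by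
    intro s z
    have : ∀ ω, ENNReal.ofReal |Jr v s0 s1 (F ω) w.get s z| ≤ ENNReal.ofReal (σ ^ n)
        + ENNReal.ofReal (σ ^ n)⁻¹ * ENNReal.ofReal (Jr v s0 s1 (F ω) w.get s z ^ 2) := by
      intro ω
      rw [← ENNReal.ofReal_mul (by positivity), ← ENNReal.ofReal_add (by positivity) (by positivity)]
      refine ENNReal.ofReal_le_ofReal ?_
      rw [← sq_abs]
      set x := |Jr v s0 s1 (F ω) w.get s z|
      have e : σ ^ n + (σ ^ n)⁻¹ * x ^ 2 - x = (σ ^ n)⁻¹ * ((x - σ ^ n / 2) ^ 2 + 3 / 4 * (σ ^ n) ^ 2) := by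
        field_simp; ring
      have : 0 ≤ (σ ^ n)⁻¹ * ((x - σ ^ n / 2) ^ 2 + 3 / 4 * (σ ^ n) ^ 2) := by positivity
      linarith
    refine (lintegral_mono this).trans ?_
    rw [lintegral_add_left measurable_const, lintegral_const, measure_univ, mul_one,
      lintegral_const_mul _ ((hms s z).pow_const 2).ennreal_ofReal]
    refine (add_le_add le_rfl (mul_le_mul_right (h2 s z) _)).trans ?_
    rw [← ENNReal.ofReal_mul (by positivity), ← ENNReal.ofReal_add (by positivity) (by positivity)]
    refine ENNReal.ofReal_le_ofReal ?_
    have e : (σ ^ n)⁻¹ * (Cw * (u * (σ ^ n) ^ 2)) = Cw * u * σ ^ n := by field_simp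
    rw [e]
    have : Cw * u * σ ^ n ≤ Cw * 1 * σ ^ n := by gcongr
    linarith
  set B0 : Set Ω := {ω | ENNReal.ofReal ((σ ^ n) ^ 2) < ENNReal.ofReal (Jr v s0 s1 (F ω) w.get s1 0 ^ 2)}
  set Bm : Eu d → Set Ω := fun m => {ω | ENNReal.ofReal (K * σ ^ n) <
    ∫⁻ s in Ioc s0 s1, ENNReal.ofReal |Jr v s0 s1 (F ω) w.get s m|}
  have pB0 : P B0 ≤ ENNReal.ofReal (Cw * u) := by
    refine (markov _ ((hms s1 0).pow_const 2).ennreal_ofReal.aemeasurable _ _ (by positivity)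
      (h2 s1 0)).trans (ENNReal.ofReal_le_ofReal ?_)
    exact le_of_eq (by field_simp)
  have pBm : ∀ m, P (Bm m) ≤ ENNReal.ofReal ((1 + Cw) * τ / K) := by
    intro m
    have mm : Measurable fun x : Ω × ℝ => ENNReal.ofReal |Jr v s0 s1 (F x.1) w.get x.2 m| :=
      (hm m).norm.ennreal_ofReal
    refine (markov _ mm.lintegral_prod_right'.aemeasurable (τ * ((1 + Cw) * σ ^ n)) _ (by positivity)
      ?_).trans (ENNReal.ofReal_le_ofReal ?_)
    · rw [lintegral_lintegral_swap mm.aemeasurable]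
      refine (lintegral_mono fun s => h3 s m).trans ?_
      rw [lintegral_const, Measure.restrict_apply_univ, Real.volume_Ioc, mul_comm,
        ← ENNReal.ofReal_mul (by linarith)]
    · exact le_of_eq (by field_simp)
  refine ⟨B0 ∪ ⋃ m ∈ net, Bm m, ?_, ?_⟩
  · refine (measure_union_le _ _).trans ?_
    refine (add_le_add pB0 ((measure_biUnion_finset_le _ _).trans
      (Finset.sum_le_sum fun m _ => pBm m))).trans ?_
    rw [← ENNReal.ofReal_sum_of_nonneg fun m _ => by positivity, ← ENNReal.ofReal_add (by positivity)
      (Finset.sum_nonneg fun m _ => by positivity)]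
    refine ENNReal.ofReal_le_ofReal ?_
    rw [Finset.sum_const, nsmul_eq_mul]
    have : (net.card : ℝ) * ((1 + Cw) * τ / K) = (1 + Cw) * (net.card * τ / K) := by ring
    rw [this]
    nlinarith
  · filter_upwards [h.Jw_eq v, h.Gs_cont] with ω hω hcont hB
    simp only [mem_union, not_or, mem_iUnion, not_exists] at hB
    obtain ⟨hb0, hbm⟩ := hB
    have hss : s1 ∈ Icc s0 s1 := ⟨by linarith, le_rfl⟩
    constructor
    · have : ENNReal.ofReal (Jr v s0 s1 (F ω) w.get s1 0 ^ 2) ≤ ENNReal.ofReal ((σ ^ n) ^ 2) :=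
        not_lt.1 hb0
      rw [ENNReal.ofReal_le_ofReal_iff (by positivity)] at this
      rw [hω s0 s1 w s1 hss 0]
      exact abs_le_of_sq_le_sq this hσn.le
    · intro m hm'
      have h5 : ∫⁻ s in Ioc s0 s1, ENNReal.ofReal |Jr v s0 s1 (F ω) w.get s m|
          ≤ ENNReal.ofReal (K * σ ^ n) := not_lt.1 (hbm m hm')
      have cJ : Continuous fun s => Jw (Gs (F ω)) v s0 w s m :=
        (Jw_cont (Gs (F ω)) v s0 hcont w).comp (by fun_prop : Continuous fun s : ℝ => (s, m))
      rw [intervalIntegral.integral_of_le hss.1,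
        integral_eq_lintegral_of_nonneg_ae (Eventually.of_forall fun s => abs_nonneg _)
          cJ.abs.aestronglyMeasurable]
      refine ENNReal.toReal_le_of_le_ofReal (by positivity) (le_trans (le_of_eq ?_) h5)
      refine setLIntegral_congr_fun measurableSet_Ioc fun s hs' => ?_
      rw [hω s0 s1 w s ⟨hs'.1.le, hs'.2⟩ m]

theorem GF.words_prob (h : GF P F R) (v : Eu d) (C : ℝ) (hC : 0 ≤ C) (hL : LineBound R v C)
    (W : List (List (Ix d))) (hW : ∀ w ∈ W, w ≠ []) : ∃ Cw : ℝ, 0 ≤ Cw ∧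
      ∀ s0 s1 : ℝ, 1 ≤ s1 - s0 → ∀ σ K u : ℝ,
      0 < σ → 0 < K → 0 ≤ u → u ≤ 1 → (s1 - s0) * (1 + Real.log (s1 - s0)) ≤ u * σ ^ 2 →
      ∀ net : Finset (Eu d), ∃ B : Set Ω,
        P B ≤ ENNReal.ofReal (Cw * (u + net.card * (s1 - s0) / K)) ∧
        ∀ᵐ ω ∂P, ω ∉ B → ∀ w ∈ W, |Jw (Gs (F ω)) v s0 w s1 0| ≤ σ ^ w.length ∧
          ∀ m ∈ net, ∫ s in s0..s1, |Jw (Gs (F ω)) v s0 w s m| ≤ K * σ ^ w.length := by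
  induction W with
  | nil => exact ⟨0, le_rfl, fun s0 s1 _ σ K u _ _ _ _ _ net => ⟨∅, by simp, by simp⟩⟩
  | cons w W ih =>
    obtain ⟨C1, h10, h1⟩ := h.word_prob v C hC hL w (hW w (by simp))
    obtain ⟨C2, h20, h2⟩ := ih fun w' hw' => hW w' (by simp [hw'])
    refine ⟨C1 + C2, by positivity, fun s0 s1 hs σ K u hσ hK hu hu1 hX net => ?_⟩
    obtain ⟨B1, p1, q1⟩ := h1 s0 s1 hs σ K u hσ hK hu hu1 hX net
    obtain ⟨B2, p2, q2⟩ := h2 s0 s1 hs σ K u hσ hK hu hu1 hX net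
    have hp : 0 ≤ u + net.card * (s1 - s0) / K := by
      have : 0 ≤ s1 - s0 := by linarith
      positivity
    refine ⟨B1 ∪ B2, ?_, ?_⟩
    · refine (measure_union_le _ _).trans ((add_le_add p1 p2).trans ?_)
      rw [← ENNReal.ofReal_add (by positivity) (by positivity), add_mul]
    · filter_upwards [q1, q2] with ω a1 a2 hB w' hw'
      simp only [mem_union, not_or] at hB
      rcases List.mem_cons.1 hw' with rfl | hw'
      · exact a1 hB.1
      · exact a2 hB.2 w' hw'

theorem GF.Aw_prob (h : GF P F R) (k : ℕ) : ∃ C : ℝ, 0 ≤ C ∧ ∀ Γ : ℝ, 0 < Γ →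
    P {ω | ENNReal.ofReal Γ < Aw k (F ω)} ≤ ENNReal.ofReal (C / Γ) := by
  obtain ⟨C, h0, h1⟩ := h.Aw_bound k
  exact ⟨C, h0, fun Γ hΓ => markov _ (h.Aw_meas k).aemeasurable C Γ hΓ h1⟩

end
end KP


namespace KP

theorem sum3_le {d N L : ℕ} (g : Fin d → ℕ → ℕ → ℝ) (hg : ∀ c n j, 0 ≤ g c n j) (c : Fin d) (n j : ℕ)
    (hn : n ≤ N) (hj : j ≤ L + 1) :
    g c n j ≤ ∑ c, ∑ n ∈ Finset.range (N + 1), ∑ j ∈ Finset.range (L + 2), g c n j := by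
  have h1 : g c n j ≤ ∑ j ∈ Finset.range (L + 2), g c n j :=
    Finset.single_le_sum (f := fun j => g c n j) (fun j _ => hg c n j) (Finset.mem_range.2 (by omega))
  have h2 : ∑ j ∈ Finset.range (L + 2), g c n j ≤ ∑ n ∈ Finset.range (N + 1), ∑ j ∈ Finset.range (L + 2), g c n j :=
    Finset.single_le_sum (f := fun n => ∑ j ∈ Finset.range (L + 2), g c n j)
      (fun n _ => Finset.sum_nonneg fun j _ => hg c n j) (Finset.mem_range.2 (by omega))
  have h3 := Finset.single_le_sum (f := fun c => ∑ n ∈ Finset.range (N + 1), ∑ j ∈ Finset.range (L + 2), g c n j)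
      (fun c _ => Finset.sum_nonneg fun n _ => Finset.sum_nonneg fun j _ => hg c n j) (Finset.mem_univ c)
  exact h1.trans (h2.trans h3)

theorem absJ_le_len {d : ℕ} {ι : Type*} (G : ι → Eu d → ℝ) (v : Eu d) (s0 s : ℝ) (z : Eu d) (X : ℝ)
    (W : List (List ι)) (h : ∀ w ∈ W, |Jw G v s0 w s z| ≤ X) : absJ G v s0 W s z ≤ W.length * X := by
  induction W with
  | nil => simp [absJ_nil]
  | cons w W ih =>
    rw [absJ_cons, List.length_cons]
    push_cast
    have h1 := h w (by simp)
    have h2 := ih fun w' hw' => h w' (by simp [hw'])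
    linarith

theorem int_absJ_le_len {d : ℕ} {ι : Type*} (G : ι → Eu d → ℝ) (hG : ∀ p, Continuous (G p))
    (v : Eu d) (s0 s1 : ℝ) (z : Eu d) (X : ℝ)
    (W : List (List ι)) (h : ∀ w ∈ W, ∫ s in s0..s1, |Jw G v s0 w s z| ≤ X) :
    ∫ s in s0..s1, absJ G v s0 W s z ≤ W.length * X := by
  induction W with
  | nil => simp [absJ_nil]
  | cons w W ih =>
    simp only [absJ_cons, List.length_cons]
    have c1 : Continuous fun s => |Jw G v s0 w s z| :=
      ((Jw_cont G v s0 hG w).comp (by fun_prop : Continuous fun s : ℝ => (s, z))).abs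
    have c2 : Continuous fun s => absJ G v s0 W s z :=
      (absJ_cont G v s0 hG W).comp (by fun_prop : Continuous fun s : ℝ => (s, z))
    rw [intervalIntegral.integral_add (c1.intervalIntegrable _ _) (c2.intervalIntegrable _ _)]
    push_cast
    have h1 := h w (by simp)
    have h2 := ih fun w' hw' => h w' (by simp [hw'])
    linarith

/-- All words used. -/
noncomputable def allW {d : ℕ} (χ : SchwartzMap (Eu d) ℝ) (N L : ℕ) : List (List (Ix d)) :=
  (List.finRange d).flatMap fun c => (List.range (N + 1)).flatMap fun n =>
    (List.range (L + 2)).flatMap fun j => (dAll Dx)^[j] (Uw Dx (fun c => (χ, c)) c n)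

theorem mem_allW {d : ℕ} (χ : SchwartzMap (Eu d) ℝ) (N L : ℕ) (w : List (Ix d)) :
    w ∈ allW χ N L ↔ ∃ c n j, n ≤ N ∧ j ≤ L + 1 ∧ w ∈ (dAll Dx)^[j] (Uw Dx (fun c => (χ, c)) c n) := by
  simp only [allW, List.mem_flatMap, List.mem_finRange, List.mem_range, true_and]
  constructor
  · rintro ⟨c, n, hn, j, hj, h⟩; exact ⟨c, n, j, by omega, by omega, h⟩
  · rintro ⟨c, n, j, hn, hj, h⟩; exact ⟨c, n, by omega, j, by omega, h⟩

theorem allW_ne {d : ℕ} (χ : SchwartzMap (Eu d) ℝ) (N L : ℕ) (w : List (Ix d)) (hw : w ∈ allW χ N L) :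
    w ≠ [] := by
  obtain ⟨c, n, j, -, -, h⟩ := (mem_allW χ N L w).1 hw
  have := dAll_iter_length Dx _ _ (Uw_length Dx (fun c => (χ, c)) c n) j w h
  intro hh; simp [hh] at this

theorem det_all {d : ℕ} (v : Eu d) (hv : ‖v‖ = 1) (χ : SchwartzMap (Eu d) ℝ) (N L : ℕ) :
    ∃ CF Acr Mc A : ℝ, 0 ≤ CF ∧ 0 ≤ Acr ∧ 0 ≤ Mc ∧ 0 ≤ A ∧
    ∀ (f : Eu d → Eu d) (_ : Measurable f) (_ : ∀ x c, f x c = Gs f (χ, c) x) (δ : ℝ) (_ : 0 < δ)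
      (k : ℕ) (_ : Aw 1 f ≤ ENNReal.ofReal δ⁻¹) (_ : Aw (k + 1) f ≤ ENNReal.ofReal δ⁻¹)
      (y : ℝ → Eu d) (_ : y 0 = 0) (_ : ∀ s, 0 ≤ s → HasDerivAt y (δ • f (y s + s • v)) s)
      (s0 s1 T : ℝ) (_ : 0 ≤ s0) (_ : s0 ≤ s1) (_ : s1 ≤ T) (_ : 2 ≤ T)
      (κ σ lam Γ0 Bc K E : ℝ) (_ : 0 ≤ κ) (_ : κ ≤ 1) (_ : 1 ≤ σ) (_ : δ * σ ≤ 1) (_ : 0 < lam)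
      (_ : 0 ≤ K)
      (_ : CF * (lam + (lam ^ k)⁻¹ * (1 + 3 * T) ^ (d + 1) * δ⁻¹) ≤ Γ0) (_ : δ * Γ0 < 1)
      (_ : ∀ n ≤ N, Acr * ((s1 - s0) * ((1 + 3 * T) ^ (d + 1) * δ⁻¹)) ^ (n + 1) ≤ Bc)
      (_ : κ ^ L * Bc ≤ 1) (_ : (d * δ) ^ L * Bc ≤ 1) (_ : d * δ ≤ 1)
      (net : Finset (Eu d)) (_ : ∀ y : Eu d, ‖y‖ ≤ T → ∃ m ∈ net, ‖y - m‖ ≤ d * δ)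
      (_ : δ ^ (N + 2) * (Γ0 * Mc * (net.card * (L * (A * (K * σ ^ (N + 1)))) + (s1 - s0))) ≤ E)
      (_ : ∀ w ∈ allW χ N L, |Jw (Gs f) v s0 w s1 0| ≤ σ ^ w.length ∧
          ∀ m ∈ net, ∫ s in s0..s1, |Jw (Gs f) v s0 w s m| ≤ K * σ ^ w.length)
      (_ : ‖y s0‖ ≤ κ) (_ : ‖y s1‖ ≤ κ) (c : Fin d),
      δ * |Jw (Gs f) v s0 [(χ, c)] s1 0| ≤ 2 * κ + E + Mc * (L * A + 1) * κ * (δ * σ)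
        + N * (Mc * (L * A + 1)) * (δ * σ) ^ 2 := by
  choose Ch hCh0 hCh using fun c : Fin d => Gs_bound_high ((χ, c) : Ix d)
  choose Cb hCb0 hCb using fun p : Ix d => Gs_bound p
  set e : Fin d → Ix d := fun c => (χ, c) with he
  set U : Fin d → ℕ → ℕ → List (List (Ix d)) := fun c n j => (dAll Dx)^[j] (Uw Dx e c n) with hU
  have hUl : ∀ c n j, ∀ w ∈ U c n j, w.length = n + 1 := fun c n j =>
    dAll_iter_length Dx _ _ (Uw_length Dx e c n) j
  set g1 : Fin d → ℕ → ℕ → ℝ := fun c n j => ((U c n j).map (fun w => (w.map Cb).prod)).sum with hg1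
  have hg10 : ∀ c n j, 0 ≤ g1 c n j := fun c n j => List.sum_nonneg (by
    intro x hx
    obtain ⟨w, -, rfl⟩ := List.mem_map.1 hx
    exact List.prod_nonneg (by
      intro x hx
      obtain ⟨p, -, rfl⟩ := List.mem_map.1 hx
      exact hCb0 p))
  set g2 : Fin d → ℕ → ℕ → ℝ := fun c n j => (cW Dx L (U c n j) : ℝ) with hg2
  set g3 : Fin d → ℕ → ℕ → ℝ := fun c n j => ((U c n j).length : ℝ) with hg3
  set CF := ∑ c, Ch c with hCF
  set Acr := ∑ c, ∑ n ∈ Finset.range (N + 1), ∑ j ∈ Finset.range (L + 2), g1 c n j with hAcr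
  set Mc := ∑ c, ∑ n ∈ Finset.range (N + 1), ∑ j ∈ Finset.range (L + 2), g2 c n j with hMc
  set A := ∑ c, ∑ n ∈ Finset.range (N + 1), ∑ j ∈ Finset.range (L + 2), g3 c n j with hA
  have hMc0 : 0 ≤ Mc := by positivity
  have hA0 : 0 ≤ A := by positivity
  have hAcr0 : 0 ≤ Acr := Finset.sum_nonneg fun c _ => Finset.sum_nonneg fun n _ =>
    Finset.sum_nonneg fun j _ => hg10 c n j
  refine ⟨CF, Acr, Mc, A, Finset.sum_nonneg fun c _ => hCh0 c, hAcr0, hMc0, hA0, ?_⟩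
  intro f hf hχ δ hδ k hA1 hAk y hy0 hy s0 s1 T hs0 hs01 hs1 hT κ σ lam Γ0 Bc K E hκ0 hκ1 hσ hδσ hlam hK
    hΓ0 hδΓ hBc hκB hrB hr1 net hnet hE hW hys0 hys1 c
  have hδi : 0 < δ⁻¹ := inv_pos.2 hδ
  have hG : ∀ p x, HasFDerivAt (Gs f p)
      (∑ l, Gs f (Dx l p) x • (EuclideanSpace.proj l : Eu d →L[ℝ] ℝ)) x :=
    fun p x => Gs_hasFDerivAt f hf (hA1.trans_lt ENNReal.ofReal_lt_top) p x
  have cG := G_cont (Gs f) Dx hG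
  have hfb : ∀ x, ‖x‖ ≤ 3 * T → ‖f x‖ ≤ Γ0 := by
    intro x hx
    have h1 : ‖f x‖ ≤ ∑ c, |f x c| := by
      have := norm_sum_le Finset.univ fun i => (f x i) • (EuclideanSpace.single i (1:ℝ) : Eu d)
      rw [← eu_sum_single (f x)] at this
      refine this.trans (Finset.sum_le_sum fun i _ => ?_)
      rw [norm_smul]
      simp
    refine h1.trans (le_trans ?_ hΓ0)
    rw [hCF, Finset.sum_mul]
    refine Finset.sum_le_sum fun c _ => ?_
    rw [hχ]
    refine (hCh c k f hf δ⁻¹ hδi.le hAk lam hlam x).trans ?_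
    have := hCh0 c
    gcongr
  have hyb := y_bound v hv f y δ T Γ0 hδ (by linarith) hy0 hy (fun x hx => hfb x (by linarith)) hδΓ
  have hyT : ∀ s ∈ Icc s0 s1, ‖y s‖ ≤ T := fun s hs =>
    (hyb s ⟨by linarith [hs.1], by linarith [hs.2]⟩).trans (by linarith [hs.2])
  have hsv : ∀ s ∈ Icc s0 s1, ‖s • v‖ ≤ T := by
    intro s hs
    rw [norm_smul, hv, mul_one, Real.norm_of_nonneg (by linarith [hs.1])]
    linarith [hs.2]
  have hcr : ∀ c, ∀ n ≤ N, ∀ j ≤ L + 1, ∀ s ∈ Icc s0 s1, ∀ z : Eu d, ‖z‖ ≤ 2 * T →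
      absJ (Gs f) v s0 (U c n j) s z ≤ Bc := by
    intro c n hn j hj s hs z hz
    refine (absJ_crude (Gs f) v s0 (U c n j) (n + 1) (hUl c n j) Cb ((1 + 3 * T) ^ (d + 1) * δ⁻¹) hCb0
      (by positivity) s1 hs01 z (fun p r hr => ?_) s hs).trans (le_trans ?_ (hBc n hn))
    · refine (hCb p f hf δ⁻¹ hδi.le hA1 _).trans ?_
      rw [mul_assoc]
      have := hCb0 p
      gcongr
      have := norm_add_le z (r • v)
      have := hsv r hr
      linarith
    · have h1 : 0 ≤ s1 - s0 := by linarith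
      exact mul_le_mul_of_nonneg_right (sum3_le g1 hg10 c n j hn hj) (by positivity)
  have hmem : ∀ c, ∀ n ≤ N, ∀ j ≤ L + 1, ∀ w ∈ U c n j, w ∈ allW χ N L := fun c n hn j hj w hw =>
    (mem_allW χ N L w).2 ⟨c, n, j, hn, hj, hw⟩
  refine det_main (Gs f) Dx e v s0 hG f hχ δ hδ y s1 hs01 (fun s hs => hy s (by linarith [hs.1])) N L
    κ σ A Bc E Mc hκ0 hκ1 hσ hA0 hMc0 hys0 hys1 ?_ ?_ hκB ?_ hδσ ?_ c
  · intro c n hn j hj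
    refine (absJ_le_len (Gs f) v s0 s1 0 (σ ^ (n + 1)) (U c n j) fun w hw => ?_).trans ?_
    · have := (hW w (hmem c n hn j (by omega) w hw)).1
      rwa [hUl c n j w hw] at this
    · exact mul_le_mul_of_nonneg_right (sum3_le g3 (fun c n j => by positivity) c n j hn (by omega))
        (by positivity)
  · intro c n hn j hj z hz
    refine hcr c n hn j hj s1 ⟨hs01, le_rfl⟩ z ?_
    have : ‖z‖ ≤ κ := by simpa using hz
    linarith
  · intro c
    have rem := det_rem (Gs f) Dx e v s0 hG y s1 hs01 (Uw Dx e c N) L Γ0 (d * δ) Bc hr1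
      ((norm_nonneg _).trans (hfb 0 (by simp; linarith))) (fun s hs l => by
        rw [← hχ]
        refine (PiLp.norm_apply_le _ l).trans (hfb _ ?_)
        have := norm_add_le (y s) (s • v)
        have := hsv s hs
        have := hyT s hs
        linarith) net (fun s hs => hnet _ (hyT s hs)) (fun s hs z hz => by
        refine hcr c N le_rfl (L + 1) le_rfl s hs z ?_
        have h1 := norm_add_le (z - y s) (y s)
        rw [sub_add_cancel] at h1
        have := hyT s hs
        linarith) hrB
    refine le_trans (mul_le_mul_of_nonneg_left (rem.trans ?_) (by positivity)) hE
    have hΓ00 : 0 ≤ Γ0 := (norm_nonneg _).trans (hfb 0 (by simp; linarith))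
    have i1 : ∀ m j, IntervalIntegrable (fun s => absJ (Gs f) v s0 ((dAll Dx)^[j] (dAll Dx (Uw Dx e c N))) s m)
        volume s0 s1 := fun m j => ((absJ_cont (Gs f) v s0 cG _).comp
        (by fun_prop : Continuous fun s : ℝ => (s, m))).intervalIntegrable _ _
    have i2 : ∫ s in s0..s1, ∑ m ∈ net, ∑ j ∈ Finset.range L,
        absJ (Gs f) v s0 ((dAll Dx)^[j] (dAll Dx (Uw Dx e c N))) s m
        ≤ net.card * (L * (A * (K * σ ^ (N + 1)))) := by
      rw [intervalIntegral.integral_finsetSum fun m _ => Continuous.intervalIntegrable (u := fun s => ∑ j ∈ Finset.range L,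
        absJ (Gs f) v s0 ((dAll Dx)^[j] (dAll Dx (Uw Dx e c N))) s m)
        (continuous_finsetSum _ fun j _ => (absJ_cont (Gs f) v s0 cG _).comp
        (by fun_prop : Continuous fun s : ℝ => (s, m))) _ _]
      have : ∀ m ∈ net, ∫ s in s0..s1, ∑ j ∈ Finset.range L,
          absJ (Gs f) v s0 ((dAll Dx)^[j] (dAll Dx (Uw Dx e c N))) s m ≤ L * (A * (K * σ ^ (N + 1))) := by
        intro m hm
        rw [intervalIntegral.integral_finsetSum fun j _ => i1 m j]
        have : ∀ j ∈ Finset.range L, ∫ s in s0..s1,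
            absJ (Gs f) v s0 ((dAll Dx)^[j] (dAll Dx (Uw Dx e c N))) s m ≤ A * (K * σ ^ (N + 1)) := by
          intro j hj
          have hj' := Finset.mem_range.1 hj
          change ∫ s in s0..s1, absJ (Gs f) v s0 (U c N (j + 1)) s m ≤ _
          refine (int_absJ_le_len (Gs f) cG v s0 s1 m (K * σ ^ (N + 1)) (U c N (j + 1))
            fun w hw => ?_).trans ?_
          · have := (hW w (hmem c N le_rfl (j + 1) (by omega) w hw)).2 m hm
            rwa [hUl c N (j + 1) w hw] at this
          · exact mul_le_mul_of_nonneg_right (sum3_le g3 (fun c n j => by positivity) c N (j + 1) le_rfl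
              (by omega)) (by positivity)
        refine (Finset.sum_le_sum this).trans ?_
        rw [Finset.sum_const, Finset.card_range, nsmul_eq_mul]
      refine (Finset.sum_le_sum this).trans ?_
      rw [Finset.sum_const, nsmul_eq_mul]
    have hcw : (cW Dx L (dAll Dx (Uw Dx e c N)) : ℝ) ≤ Mc :=
      sum3_le g2 (fun c n j => by positivity) c N 1 le_rfl (by omega)
    have p1 : 0 ≤ ∫ s in s0..s1, ∑ m ∈ net, ∑ j ∈ Finset.range L,
        absJ (Gs f) v s0 ((dAll Dx)^[j] (dAll Dx (Uw Dx e c N))) s m :=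
      intervalIntegral.integral_nonneg hs01 fun s _ => Finset.sum_nonneg fun m _ =>
        Finset.sum_nonneg fun j _ => absJ_nonneg _ _ _ _ _ _
    refine mul_le_mul (mul_le_mul_of_nonneg_left hcw hΓ00) (by linarith) (by linarith) (by positivity)
  · intro c n hn j hj
    exact sum3_le g2 (fun c n j => by positivity) c n j hn (by omega)

end KP


namespace KP

theorem ev (c ε : ℝ) (hε : 0 < ε) : ∀ᶠ δ : ℝ in nhdsWithin 0 (Ioi 0), c * δ ^ ε < 1 := by
  have h1 : Tendsto (fun δ : ℝ => c * δ ^ ε) (nhdsWithin 0 (Ioi 0)) (nhds (c * 0 ^ ε)) := by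
    refine Tendsto.const_mul c ?_
    exact (Real.continuousAt_rpow_const 0 ε (Or.inr hε.le)).tendsto.mono_left nhdsWithin_le_nhds
  rw [Real.zero_rpow hε.ne', mul_zero] at h1
  exact h1.eventually (gt_mem_nhds one_pos)

theorem ev' (c p q : ℝ) (h : q < p) : ∀ᶠ δ : ℝ in nhdsWithin 0 (Ioi 0), c * δ ^ p ≤ δ ^ q := by
  filter_upwards [ev c (p - q) (by linarith), self_mem_nhdsWithin] with δ h1 h2
  have h2 : 0 < δ := h2
  have : δ ^ p = δ ^ (p - q) * δ ^ q := by rw [← Real.rpow_add h2]; ring_nf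
  rw [this, ← mul_assoc]
  have := Real.rpow_pos_of_pos h2 q
  nlinarith

theorem ev01 : ∀ᶠ δ : ℝ in nhdsWithin 0 (Ioi 0), 0 < δ ∧ δ < 1 := 
  Ioo_mem_nhdsGT one_pos

theorem ev_log (θ : ℝ) (h0 : 0 < θ) (h1 : θ ≤ 1 / 16) : ∀ᶠ δ : ℝ in nhdsWithin 0 (Ioi 0),
    1 + Real.log (δ ^ (-2 + 8 * θ)) ≤ δ ^ (-(θ / 4)) := by
  filter_upwards [ev01, ev' (1 + 16 / θ) (-(θ / 8)) (-(θ / 4)) (by linarith)] with δ ⟨hδ, hδ1⟩ h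
  refine le_trans ?_ h
  rw [Real.log_rpow hδ]
  have h2 := Real.log_le_rpow_div (inv_pos.2 hδ).le (show 0 < θ / 8 by linarith)
  rw [Real.log_inv, Real.inv_rpow hδ.le, ← Real.rpow_neg hδ.le] at h2
  have h3 : 1 ≤ δ ^ (-(θ / 8)) := Real.one_le_rpow_of_pos_of_le_one_of_nonpos hδ hδ1.le (by linarith)
  have h4 : Real.log δ < 0 := Real.log_neg hδ hδ1
  have h5 : δ ^ (-(θ / 8)) / (θ / 8) = 8 / θ * δ ^ (-(θ / 8)) := by field_simp
  rw [h5] at h2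
  have h6 : (16 : ℝ) / θ = 2 * (8 / θ) := by ring
  rw [h6]
  nlinarith

theorem rpe {δ : ℝ} (h0 : 0 < δ) (h1 : δ < 1) {p q : ℝ} (h : q ≤ p) : δ ^ p ≤ δ ^ q :=
  Real.rpow_le_rpow_of_exponent_ge h0 h1.le h

theorem ev_T (t : ℝ) (ht : 0 < t) : ∀ᶠ δ : ℝ in nhdsWithin 0 (Ioi 0),
    2 ≤ t * δ ^ (-2 : ℝ) ∧ 2 * (t * δ ^ (-2 : ℝ) / δ) + 3 ≤ δ ^ (-4 : ℝ) ∧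
      1 + 3 * (t * δ ^ (-2 : ℝ)) ≤ δ ^ (-3 : ℝ) := by
  filter_upwards [ev01, ev' (2 / t) 0 (-2) (by norm_num), ev' (2 * t + 3) (-3) (-4) (by norm_num),
    ev' (1 + 3 * t) (-2) (-3) (by norm_num)] with δ ⟨hδ, hδ1⟩ h1 h2 h3
  have e3 : δ ^ (-2 : ℝ) / δ = δ ^ (-3 : ℝ) := by
    rw [div_eq_mul_inv, ← Real.rpow_neg_one δ, ← Real.rpow_add hδ]; norm_num
  have a2 : 1 ≤ δ ^ (-2 : ℝ) :=
    Real.one_le_rpow_of_pos_of_le_one_of_nonpos hδ hδ1.le (by norm_num)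
  have a3 : 1 ≤ δ ^ (-3 : ℝ) :=
    Real.one_le_rpow_of_pos_of_le_one_of_nonpos hδ hδ1.le (by norm_num)
  refine ⟨?_, ?_, ?_⟩
  · rw [Real.rpow_zero, mul_one, div_le_iff₀ ht] at h1; linarith
  · rw [mul_div_assoc, e3]; linarith
  · linarith

theorem ev_g (CF : ℝ) (d : ℕ) (hCF : 0 ≤ CF) : ∀ᶠ δ : ℝ in nhdsWithin 0 (Ioi 0), 
    ∀ T : ℝ, 0 ≤ T → 1 + 3 * T ≤ δ ^ (-3 : ℝ) →
    CF * (δ ^ (-(1 / 4) : ℝ) + ((δ ^ (-(1 / 4) : ℝ)) ^ (12 * d + 16))⁻¹ * (1 + 3 * T) ^ (d + 1) * δ⁻¹)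
      ≤ δ ^ (-(1 / 2) : ℝ) := by
  filter_upwards [ev01, ev' (2 * CF) (-(1 / 4)) (-(1 / 2)) (by norm_num)] with δ ⟨hδ, hδ1⟩ h1 T hT h
  have e1 : ((δ ^ (-(1 / 4) : ℝ)) ^ (12 * d + 16))⁻¹ = δ ^ (3 * d + 4 : ℝ) := by
    rw [← Real.rpow_mul_natCast hδ.le, ← Real.rpow_neg hδ.le]; congr 1; push_cast; ring
  have e2 : (1 + 3 * T) ^ (d + 1) ≤ δ ^ (-3 * (d + 1) : ℝ) := by
    refine (pow_le_pow_left₀ (by linarith) h _).trans_eq ?_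
    rw [← Real.rpow_mul_natCast hδ.le]; push_cast; rfl
  have e3 : δ ^ (3 * d + 4 : ℝ) * δ ^ (-3 * (d + 1) : ℝ) * δ⁻¹ = 1 := by
    rw [← Real.rpow_neg_one δ, ← Real.rpow_add hδ, ← Real.rpow_add hδ]
    ring_nf; simp
  have e4 : δ ^ (3 * d + 4 : ℝ) * (1 + 3 * T) ^ (d + 1) * δ⁻¹ ≤ 1 := by
    refine le_trans ?_ e3.le; gcongr
  have a3 : 1 ≤ δ ^ (-(1 / 4) : ℝ) :=
    Real.one_le_rpow_of_pos_of_le_one_of_nonpos hδ hδ1.le (by norm_num)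
  rw [e1]
  refine le_trans ?_ h1
  nlinarith

theorem ev_h (d N : ℕ) (Acr θ : ℝ) (hA : 0 ≤ Acr) (h0 : 0 < θ) : 
    ∀ᶠ δ : ℝ in nhdsWithin 0 (Ioi 0), 
    ∀ T : ℝ, 0 ≤ T → 1 + 3 * T ≤ δ ^ (-3 : ℝ) → ∀ n ≤ N,
     Acr * (δ ^ (-2 + 8 * θ) * ((1 + 3 * T) ^ (d + 1) * δ⁻¹)) ^ (n + 1) ≤ 
      Acr * δ ^ (-((3 * d + 6) * (N + 1)) : ℝ) := by
  filter_upwards [ev01] with δ ⟨hδ, hδ1⟩ T hT h n hn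
  refine mul_le_mul_of_nonneg_left ?_ hA
  have e2 : (1 + 3 * T) ^ (d + 1) ≤ δ ^ (-3 * (d + 1) : ℝ) := by
    refine (pow_le_pow_left₀ (by linarith) h _).trans_eq ?_
    rw [← Real.rpow_mul_natCast hδ.le]; push_cast; rfl
  have e3 : δ ^ (-2 + 8 * θ) * ((1 + 3 * T) ^ (d + 1) * δ⁻¹) ≤ δ ^ (-(3 * d + 6) : ℝ) := by
    calc _ ≤ δ ^ (-2 : ℝ) * (δ ^ (-3 * (d + 1) : ℝ) * δ⁻¹) := by
          refine mul_le_mul (rpe hδ hδ1 (by linarith)) ?_ (by positivity) (by positivity)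
          exact mul_le_mul_of_nonneg_right e2 (by positivity)
      _ = _ := by 
        rw [← Real.rpow_neg_one δ, ← Real.rpow_add hδ, ← Real.rpow_add hδ]; ring_nf
  refine (pow_le_pow_left₀ (by positivity) e3 _).trans ?_
  rw [← Real.rpow_mul_natCast hδ.le]
  refine rpe hδ hδ1 ?_
  have : (n : ℝ) ≤ N := by exact_mod_cast hn
  push_cast
  nlinarith [(Nat.cast_nonneg d : (0:ℝ) ≤ d)]

theorem ev_i (d N L : ℕ) (Acr θ : ℝ) (h0 : 0 < θ)
    (hL1 : (3 * d + 6) * (N + 1) < 6 * θ * L) (hL2 : (3 * d + 6) * (N + 1) < (L : ℝ)) :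
    ∀ᶠ δ : ℝ in nhdsWithin 0 (Ioi 0), 
    (δ ^ (6 * θ)) ^ L * (Acr * δ ^ (-((3 * d + 6) * (N + 1)) : ℝ)) ≤ 1 ∧
    (d * δ) ^ L * (Acr * δ ^ (-((3 * d + 6) * (N + 1)) : ℝ)) ≤ 1 ∧ d * δ ≤ 1 := by
  filter_upwards [ev01, ev Acr (6 * θ * L - (3 * d + 6) * (N + 1)) (by linarith),
    ev (d ^ L * Acr) (L - (3 * d + 6) * (N + 1)) (by linarith), ev d 1 one_pos]
    with δ ⟨hδ, hδ1⟩ h1 h2 h3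
  refine ⟨?_, ?_, by simpa using h3.le⟩
  · refine le_trans (le_of_eq ?_) h1.le
    rw [← Real.rpow_mul_natCast hδ.le, sub_eq_add_neg, Real.rpow_add hδ]; ring
  · refine le_trans (le_of_eq ?_) h2.le
    rw [mul_pow, sub_eq_add_neg, Real.rpow_add hδ, Real.rpow_natCast]; ring

theorem ev_j (d N L : ℕ) (Mc A θ : ℝ) (hMc : 0 ≤ Mc) (hA : 0 ≤ A) (h0 : 0 < θ) (h1 : θ ≤ 1 / 16)
    (hN : 1 ≤ N) (hN2 : 8 * d + 3 + 6 * θ < 3 * θ * (N + 1)) :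
    ∀ᶠ δ : ℝ in nhdsWithin 0 (Ioi 0), ∀ n : ℝ, 0 ≤ n → n ≤ δ ^ (-(4 * d) : ℝ) →
    δ ^ (N + 2) * (δ ^ (-(1 / 2) : ℝ) * Mc * (n * (L * (A * (δ ^ (-(4 * d) - 3 : ℝ) *
      (δ ^ (-1 + 3 * θ)) ^ (N + 1)))) + δ ^ (-2 + 8 * θ))) ≤ δ ^ (6 * θ) := by
  have hN' : (1 : ℝ) ≤ N := by exact_mod_cast hN
  filter_upwards [ev01, ev' (2 * (Mc * L * A)) (-5 / 2 - 8 * d + 3 * θ * (N + 1)) (6 * θ) (by linarith),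
    ev' (2 * Mc) (N - 1 / 2) (6 * θ) (by linarith)] with δ ⟨hδ, hδ1⟩ h2 h3 n hn hn2
  have e1 : δ ^ (N + 2) = δ ^ ((N : ℝ) + 2) := by
    rw [← Real.rpow_natCast]; push_cast; rfl
  have e2 : (δ ^ (-1 + 3 * θ)) ^ (N + 1) = δ ^ ((-1 + 3 * θ) * (N + 1)) := by
    rw [← Real.rpow_mul_natCast hδ.le]; push_cast; rfl
  rw [e1, e2]
  calc _ ≤ δ ^ ((N : ℝ) + 2) * (δ ^ (-(1 / 2) : ℝ) * Mc * (δ ^ (-(4 * d) : ℝ) *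
        (L * (A * (δ ^ (-(4 * d) - 3 : ℝ) *
          δ ^ ((-1 + 3 * θ) * (N + 1))))) + δ ^ (-2 : ℝ))) := by
        refine mul_le_mul_of_nonneg_left ?_ (by positivity)
        refine mul_le_mul_of_nonneg_left ?_ (by positivity)
        refine add_le_add ?_ (rpe hδ hδ1 (by linarith))
        exact mul_le_mul_of_nonneg_right hn2 (by positivity)
    _ = (Mc * L * A) * δ ^ (-5 / 2 - 8 * d + 3 * θ * (N + 1)) + Mc * δ ^ ((N : ℝ) - 1 / 2) := by
        have a1 : δ ^ (-5 / 2 - 8 * d + 3 * θ * (N + 1)) = δ ^ ((N : ℝ) + 2) * δ ^ (-(1 / 2) : ℝ) *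
            δ ^ (-(4 * d) : ℝ) * δ ^ (-(4 * d) - 3 : ℝ) * δ ^ ((-1 + 3 * θ) * (N + 1)) := by
          simp only [← Real.rpow_add hδ]; ring_nf
        have a2 : δ ^ ((N : ℝ) - 1 / 2) = δ ^ ((N : ℝ) + 2) * δ ^ (-(1 / 2) : ℝ) * δ ^ (-2 : ℝ) := by
          simp only [← Real.rpow_add hδ]; ring_nf
        rw [a1, a2]; ring
    _ ≤ _ := by linarith

theorem ev_e (d : ℕ) (Cw θ : ℝ) (hCw : 0 ≤ Cw) (h0 : 0 < θ) (h1 : θ ≤ 1 / 16) :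
    ∀ᶠ δ : ℝ in nhdsWithin 0 (Ioi 0), ∀ n : ℝ, 0 ≤ n → n ≤ δ ^ (-(4 * d) : ℝ) →
    Cw * (δ ^ θ + n * δ ^ (-2 + 8 * θ) / δ ^ (-(4 * d) - 3 : ℝ)) ≤ 2 * Cw * δ ^ θ := by
  filter_upwards [ev01] with δ ⟨hδ, hδ1⟩ n hn hn2
  have : n * δ ^ (-2 + 8 * θ) / δ ^ (-(4 * d) - 3 : ℝ) ≤ δ ^ θ := by
    rw [div_le_iff₀ (by positivity)]
    calc _ ≤ δ ^ (-(4 * d) : ℝ) * δ ^ (-2 + 8 * θ) := by gcongr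
      _ ≤ _ := by 
        rw [← Real.rpow_add hδ, ← Real.rpow_add hδ]
        exact rpe hδ hδ1 (by linarith)
  nlinarith

theorem ev_k (d N : ℕ) (Q c θ : ℝ) (hQ : 0 ≤ Q) (hc : 0 < c) (h0 : 0 < θ) :
    ∀ᶠ δ : ℝ in nhdsWithin 0 (Ioi 0), ∀ Z : ℝ,
      δ * |Z| ≤ d * (2 * δ ^ (6 * θ) + δ ^ (6 * θ) + Q * δ ^ (6 * θ) * (δ * δ ^ (-1 + 3 * θ)) + 
        N * Q * (δ * δ ^ (-1 + 3 * θ)) ^ 2) →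
      Z ^ 2 ≤ c * δ ^ (-2 + 8 * θ) / 4 := by
  filter_upwards [ev01, ev' (4 / c * (d * (3 + Q + N * Q)) ^ 2) (-2 + 12 * θ) (-2 + 8 * θ)
    (by linarith)] with δ ⟨hδ, hδ1⟩ h Z hZ
  have e1 : δ * δ ^ (-1 + 3 * θ) = δ ^ (3 * θ) := by
    nth_rw 1 [← Real.rpow_one δ]
    rw [← Real.rpow_add hδ]; ring_nf
  have e2 : (δ ^ (3 * θ)) ^ 2 = δ ^ (6 * θ) := by
    rw [← Real.rpow_mul_natCast hδ.le]; congr 1; push_cast; ring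
  have e3 : δ ^ (3 * θ) ≤ 1 := Real.rpow_le_one hδ.le hδ1.le (by linarith)
  rw [e1, e2] at hZ
  have p6 : 0 < δ ^ (6 * θ) := Real.rpow_pos_of_pos hδ _
  have h3 : δ * |Z| ≤ d * (3 + Q + N * Q) * δ ^ (6 * θ) := by
    refine hZ.trans ?_
    rw [mul_assoc (d : ℝ)]
    refine mul_le_mul_of_nonneg_left ?_ (Nat.cast_nonneg d : (0:ℝ) ≤ d)
    have := mul_le_mul_of_nonneg_left e3 (mul_nonneg hQ p6.le)
    linarith
  have h4 : (δ * |Z|) ^ 2 ≤ (d * (3 + Q + N * Q)) ^ 2 * δ ^ (12 * θ) := by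
    refine (pow_le_pow_left₀ (by positivity) h3 2).trans_eq ?_
    rw [mul_pow, ← Real.rpow_mul_natCast hδ.le]
    congr 2; push_cast; ring
  have h5 : Z ^ 2 ≤ (d * (3 + Q + N * Q)) ^ 2 * δ ^ (-2 + 12 * θ) := by
    have e4 : δ ^ (12 * θ) = δ ^ 2 * δ ^ (-2 + 12 * θ) := by
      rw [← Real.rpow_natCast, ← Real.rpow_add hδ]; congr 1; push_cast; ring
    rw [mul_pow, sq_abs, e4] at h4
    have : 0 < δ ^ 2 := by positivity
    refine le_of_mul_le_mul_left ?_ this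
    linarith
  refine h5.trans ?_
  have h6 : (d * (3 + Q + N * Q)) ^ 2 * δ ^ (-2 + 12 * θ) = 
     c / 4 * (4 / c * (d * (3 + Q + N * Q)) ^ 2 * δ ^ (-2 + 12 * θ)) := by
    field_simp
  rw [h6]
  have := mul_le_mul_of_nonneg_left h (show 0 ≤ c / 4 by positivity)
  linarith

end KP


namespace KP
section
variable {Ω : Type*} [MeasurableSpace Ω] {P : Measure Ω} [IsProbabilityMeasure P] {d : ℕ}
  {F : Ω → Eu d → Eu d} {R : Eu d → Fin d → Fin d → ℝ}

theorem sq_prob (y : Ω → Eu d) (hi : Integrable (fun ω => ‖y ω‖ ^ 2) P) (E κ : ℝ) (hκ : 0 < κ)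
    (h : ∫ ω, ‖y ω‖ ^ 2 ∂P ≤ E) : P {ω | κ < ‖y ω‖} ≤ ENNReal.ofReal (E / κ ^ 2) := by
  have := markov (P := P) (fun ω => ENNReal.ofReal (‖y ω‖ ^ 2)) hi.aemeasurable.ennreal_ofReal E (κ ^ 2)
    (by positivity) (by
      rw [← ofReal_integral_eq_lintegral_ofReal hi (ae_of_all _ fun ω => by positivity)]
      exact ENNReal.ofReal_le_ofReal h)
  refine le_trans (measure_mono fun ω hω => ?_) this
  have hω : κ < ‖y ω‖ := hω
  exact (ENNReal.ofReal_lt_ofReal_iff (by have := hκ.trans hω; positivity)).2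
    (pow_lt_pow_left₀ hω hκ.le two_ne_zero)

theorem GF.core (h : GF P F R) (v : Eu d) (hv : ‖v‖ = 1) (C : ℝ) (hC : 0 ≤ C)
    (hL : LineBound R v C) (χ : SchwartzMap (Eu d) ℝ)
    (hχ : ∀ᵐ ω ∂P, ∀ x c, F ω x c = Gs (F ω) (χ, c) x)
    (c τ0 : ℝ) (hc : 0 < c) (hτ0 : 1 ≤ τ0)
    (hlow : ∀ s0 s1, τ0 ≤ s1 - s0 → c * (s1 - s0) ≤ ∫ z, (∑ i, ∑ j, v i * v j *
      R ((z.1 - z.2) • v) i j) ∂((volume.restrict (Ioc s0 s1)).prod (volume.restrict (Ioc s0 s1))))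
    (t : ℝ) (ht : 0 < t) (θ : ℝ) (h0 : 0 < θ) (h1 : θ ≤ 1 / 16) (M : ℝ) (hM : 0 ≤ M) :
    ∀ᶠ δ : ℝ in nhdsWithin 0 (Ioi 0), ∀ y : Ω → ℝ → Eu d,
      (∀ᵐ ω ∂P, y ω 0 = 0 ∧ ∀ s, 0 ≤ s → HasDerivAt (y ω) (δ • F ω (y ω s + s • v)) s) →
      (∀ s, Integrable (fun ω => ‖y ω s‖ ^ 2) P) →
      ∀ s0 s1, 0 ≤ s0 → s1 - s0 = δ ^ (-2 + 8 * θ) → s1 ≤ t * δ ^ (-2 : ℝ) →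
      ∫ ω, ‖y ω s0‖ ^ 2 ∂P ≤ M * δ ^ (16 * θ) → ∫ ω, ‖y ω s1‖ ^ 2 ∂P ≤ M * δ ^ (16 * θ) → False := by
  obtain ⟨N, hN⟩ := exists_nat_gt (max 1 ((8 * d + 3 + 6 * θ) / (3 * θ)))
  have hN1 : 1 ≤ N := by
    have := (le_max_left _ _).trans_lt hN
    exact_mod_cast this.le
  have hN2 : 8 * d + 3 + 6 * θ < 3 * θ * (N + 1) := by
    have := (le_max_right _ _).trans_lt hN
    rw [div_lt_iff₀ (by positivity)] at this
    nlinarith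
  obtain ⟨L, hLL⟩ := exists_nat_gt (max (((3 * d + 6) * (N + 1) : ℝ)) 
    (((3 * d + 6) * (N + 1) : ℝ) / (6 * θ)))
  have hL2 : (3 * d + 6) * (N + 1) < (L : ℝ) := (le_max_left _ _).trans_lt hLL
  have hL1 : (3 * d + 6) * (N + 1) < 6 * θ * L := by
    have := (le_max_right _ _).trans_lt hLL
    rw [div_lt_iff₀ (by positivity)] at this
    linarith
  obtain ⟨CF, Acr, Mc, A, hCF, hAcr, hMc, hA, hdet⟩ := det_all v hv χ N L
  obtain ⟨Cw, hCw, hwords⟩ := h.words_prob v C hC hL (allW χ N L) (fun w hw => allW_ne χ N L w hw)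
  obtain ⟨C1, hC1, hA1⟩ := h.Aw_prob 1
  obtain ⟨C2, hC2, hA2⟩ := h.Aw_prob (12 * d + 16 + 1)
  obtain ⟨C', hC', hanti⟩ := h.anticonc v hv C hC hL χ hχ c τ0 hc hτ0 hlow
  set Ct : ℝ := M + (M + (C1 + (C2 + 2 * Cw))) with hCt
  have hQ : 0 ≤ Mc * (L * A + 1) := by positivity
  filter_upwards [ev01, ev' τ0 0 (-2 + 8 * θ) (by linarith), ev_log θ h0 h1, ev_T t ht,
    ev_g CF d hCF, ev_h d N Acr θ hAcr h0, ev_i d N L Acr θ h0 hL1 hL2,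
    ev_j d N L Mc A θ hMc hA h0 h1 hN1 hN2, ev_e d Cw θ hCw h0 h1,
    ev_k d N (Mc * (L * A + 1)) c θ hQ hc h0, ev (C' * Ct) (θ / 2) (by linarith)]
    with δ ⟨hδ, hδ1⟩ hτ hlog ⟨hT2, hnet, hT3⟩ hg hh ⟨hi1, hi2, hi3⟩ hj he hk hfin
    y hy hyi s0 s1 hs0 hs1 hsT hE0 hE1
  rw [Real.rpow_zero, mul_one] at hτ
  have hT0 : 0 ≤ t * δ ^ (-2 : ℝ) := by linarith
  obtain ⟨net, hcard, hcov⟩ := exists_net d (t * δ ^ (-2 : ℝ)) δ hT0 hδ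
  have hcard2 : (net.card : ℝ) ≤ δ ^ (-(4 * d) : ℝ) := by
    refine hcard.trans ((pow_le_pow_left₀ (by positivity) hnet d).trans_eq ?_)
    rw [← Real.rpow_mul_natCast hδ.le]; congr 1; ring
  have hσ1 : 1 ≤ δ ^ (-1 + 3 * θ) :=
    Real.one_le_rpow_of_pos_of_le_one_of_nonpos hδ hδ1.le (by linarith)
  have hτ1 : 1 ≤ s1 - s0 := by rw [hs1]; linarith
  have hwl : (s1 - s0) * (1 + Real.log (s1 - s0)) ≤ δ ^ θ * (δ ^ (-1 + 3 * θ)) ^ 2 := by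
    rw [hs1]
    calc _ ≤ δ ^ (-2 + 8 * θ) * δ ^ (-(θ / 4)) :=
          mul_le_mul_of_nonneg_left hlog (by positivity)
      _ ≤ _ := by
        rw [← Real.rpow_mul_natCast hδ.le, ← Real.rpow_add hδ, ← Real.rpow_add hδ]
        refine rpe hδ hδ1 ?_
        push_cast; linarith
  obtain ⟨Bw, hBw, hBw2⟩ := hwords s0 s1 hτ1 (δ ^ (-1 + 3 * θ)) (δ ^ (-(4 * d) - 3 : ℝ)) (δ ^ θ)
    (by positivity) (by positivity) (by positivity) (Real.rpow_le_one hδ.le hδ1.le h0.le) hwl net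
  have hθ1 : δ ≤ δ ^ θ := by
    nth_rw 1 [← Real.rpow_one δ]; exact rpe hδ hδ1 (by linarith)
  have hy2 : ∀ s, ∫ ω, ‖y ω s‖ ^ 2 ∂P ≤ M * δ ^ (16 * θ) →
      P {ω | δ ^ (6 * θ) < ‖y ω s‖} ≤ ENNReal.ofReal (M * δ ^ θ) := fun s hs => by
    refine (sq_prob (fun ω => y ω s) (hyi s) _ _ (by positivity) hs).trans (ENNReal.ofReal_le_ofReal ?_)
    rw [mul_div_assoc]
    refine mul_le_mul_of_nonneg_left ?_ hM
    rw [div_le_iff₀ (by positivity), ← Real.rpow_mul_natCast hδ.le, ← Real.rpow_add hδ]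
    refine rpe hδ hδ1 ?_
    push_cast; linarith
  set B1 := {ω | δ ^ (6 * θ) < ‖y ω s0‖}
  set B2 := {ω | δ ^ (6 * θ) < ‖y ω s1‖}
  set B3 := {ω | ENNReal.ofReal δ⁻¹ < Aw 1 (F ω)}
  set B4 := {ω | ENNReal.ofReal δ⁻¹ < Aw (12 * d + 16 + 1) (F ω)}
  have hb3 : P B3 ≤ ENNReal.ofReal (C1 * δ ^ θ) := by
    refine (hA1 δ⁻¹ (inv_pos.2 hδ)).trans (ENNReal.ofReal_le_ofReal ?_)
    rw [div_inv_eq_mul]; exact mul_le_mul_of_nonneg_left hθ1 hC1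
  have hb4 : P B4 ≤ ENNReal.ofReal (C2 * δ ^ θ) := by
    refine (hA2 δ⁻¹ (inv_pos.2 hδ)).trans (ENNReal.ofReal_le_ofReal ?_)
    rw [div_inv_eq_mul]; exact mul_le_mul_of_nonneg_left hθ1 hC2
  have hb5 : P Bw ≤ ENNReal.ofReal (2 * Cw * δ ^ θ) := by
    refine hBw.trans (ENNReal.ofReal_le_ofReal ?_)
    rw [hs1]; exact he _ (Nat.cast_nonneg _) hcard2
  have hp : 0 < δ ^ θ := Real.rpow_pos_of_pos hδ _
  have hB : P (B1 ∪ (B2 ∪ (B3 ∪ (B4 ∪ Bw)))) ≤ ENNReal.ofReal (Ct * δ ^ θ) := by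
    have e : Ct * δ ^ θ = M * δ ^ θ + (M * δ ^ θ + (C1 * δ ^ θ + (C2 * δ ^ θ + 2 * Cw * δ ^ θ))) := by
      rw [hCt]; ring
    rw [e, ENNReal.ofReal_add (by positivity) (by positivity),
      ENNReal.ofReal_add (by positivity) (by positivity),
      ENNReal.ofReal_add (by positivity) (by positivity),
      ENNReal.ofReal_add (by positivity) (by positivity)]
    refine (measure_union_le _ _).trans (add_le_add (hy2 s0 hE0) ?_)
    refine (measure_union_le _ _).trans (add_le_add (hy2 s1 hE1) ?_)
    refine (measure_union_le _ _).trans (add_le_add hb3 ?_)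
    exact (measure_union_le _ _).trans (add_le_add hb4 hb5)
  have hlast := hanti s0 s1 (by rw [hs1]; exact hτ) (Ct * δ ^ θ) (by positivity) _ hB (by
    filter_upwards [hy, hBw2, hχ] with ω ⟨hy0, hyd⟩ hw hχω hωB
    simp only [mem_union, not_or] at hωB
    obtain ⟨n1, n2, n3, n4, n5⟩ := hωB
    rw [hs1]
    refine hk _ ?_
    have hJ := hdet (F ω) (h.F_meas ω) hχω δ hδ (12 * d + 16) (not_lt.1 n3) (not_lt.1 n4) (y ω) hy0 hyd
      s0 s1 (t * δ ^ (-2 : ℝ)) hs0 (by linarith) hsT hT2 (δ ^ (6 * θ)) (δ ^ (-1 + 3 * θ))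
      (δ ^ (-(1 / 4) : ℝ)) (δ ^ (-(1 / 2) : ℝ)) (Acr * δ ^ (-((3 * d + 6) * (N + 1)) : ℝ))
      (δ ^ (-(4 * d) - 3 : ℝ)) (δ ^ (6 * θ)) (by positivity)
      (Real.rpow_le_one hδ.le hδ1.le (by positivity)) hσ1 (by
        nth_rw 1 [← Real.rpow_one δ]
        rw [← Real.rpow_add hδ]
        exact Real.rpow_le_one hδ.le hδ1.le (by linarith)) (by positivity) (by positivity)
      (hg _ hT0 hT3) (by
        nth_rw 1 [← Real.rpow_one δ]
        rw [← Real.rpow_add hδ]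
        exact Real.rpow_lt_one hδ.le hδ1 (by norm_num))
      (by rw [hs1]; exact hh _ hT0 hT3) hi1 hi2 hi3 net hcov
      (by rw [hs1]; exact hj _ (Nat.cast_nonneg _) hcard2) (hw n5) (not_lt.1 n1) (not_lt.1 n2)
    have hvc : ∀ c, |v c| ≤ 1 := fun c => by
      rw [← hv, ← Real.norm_eq_abs]; exact PiLp.norm_apply_le v c
    unfold Zf
    calc _ ≤ δ * ∑ c, |v c * Jw (Gs (F ω)) v s0 [(χ, c)] s1 0| :=
          mul_le_mul_of_nonneg_left (Finset.abs_sum_le_sum_abs _ _) hδ.le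
      _ ≤ ∑ c : Fin d, (δ * |Jw (Gs (F ω)) v s0 [(χ, c)] s1 0|) := by
          rw [Finset.mul_sum]
          refine Finset.sum_le_sum fun c _ => ?_
          rw [abs_mul]
          refine mul_le_mul_of_nonneg_left ?_ hδ.le
          exact mul_le_of_le_one_left (abs_nonneg _) (hvc c)
      _ ≤ ∑ c : Fin d, _ := Finset.sum_le_sum fun c _ => hJ c
      _ = _ := by rw [Finset.sum_const, Finset.card_univ, Fintype.card_fin, nsmul_eq_mul])
  rw [hs1] at hlast
  have hl0 : 0 ≤ 1 + Real.log (δ ^ (-2 + 8 * θ)) := by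
    have := Real.log_nonneg (hs1 ▸ hτ1); linarith
  have : C' * (1 + Real.log (δ ^ (-2 + 8 * θ))) ^ 2 * (Ct * δ ^ θ) ≤ C' * Ct * δ ^ (θ / 2) := by
    have e : δ ^ (θ / 2) = (δ ^ (-(θ / 4))) ^ 2 * δ ^ θ := by
      rw [← Real.rpow_mul_natCast hδ.le, ← Real.rpow_add hδ]; congr 1; push_cast; ring
    have hCt0 : 0 ≤ Ct := by positivity
    calc _ = C' * Ct * ((1 + Real.log (δ ^ (-2 + 8 * θ))) ^ 2 * δ ^ θ) := by ring
      _ ≤ _ := by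
        rw [e]
        refine mul_le_mul_of_nonneg_left ?_ (by positivity)
        exact mul_le_mul_of_nonneg_right (pow_le_pow_left₀ hl0 hlog 2) hp.le
  linarith

end
end KP


namespace KP

theorem averaging (g : ℝ → ℝ) (hg : ∀ s, 0 ≤ g s) (T τ m : ℝ) (hT : 0 ≤ T) (hτ0 : 0 ≤ τ)
    (hτ : τ ≤ T / 2) (hi : IntegrableOn g (Icc 0 T)) 
    (hY : 2 * (∫ s in (0:ℝ)..T, g s) < m * (T / 2)) :
    ∃ s0, 0 ≤ s0 ∧ s0 ≤ T / 2 ∧ g s0 ≤ m ∧ g (s0 + τ) ≤ m := by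
  by_contra hcon
  push Not at hcon
  have hii : IntervalIntegrable g volume 0 T := by
    rw [intervalIntegrable_iff_integrableOn_Icc_of_le hT]; exact hi
  have hsub : ∀ p q, 0 ≤ p → p ≤ q → q ≤ T → IntervalIntegrable g volume p q := fun p q h1 h2 h3 =>
    hii.mono_set (by rw [uIcc_of_le h2, uIcc_of_le hT]; exact Icc_subset_Icc h1 h3)
  have hle : ∀ p q, 0 ≤ p → p ≤ q → q ≤ T → ∫ s in p..q, g s ≤ ∫ s in (0:ℝ)..T, g s := 
    fun p q h1 h2 h3 => intervalIntegral.integral_mono_interval h1 h2 h3 (ae_of_all _ hg) hii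
  have i1 := hsub 0 (T / 2) le_rfl (by linarith) (by linarith)
  have i2 : IntervalIntegrable (fun s => g (s + τ)) volume 0 (T / 2) := by
    have := (hsub (0 + τ) (T / 2 + τ) (by linarith) (by linarith) (by linarith)).comp_add_right τ
    simpa using this
  have h1 : ∫ s in (0:ℝ)..(T / 2), m ≤ ∫ s in (0:ℝ)..(T / 2), (g s + g (s + τ)) := by
    refine intervalIntegral.integral_mono_on (by linarith) (by simp) (i1.add i2) fun s hs => ?_
    by_cases h : g s ≤ m
    · have := hcon s hs.1 hs.2 h
      linarith [hg s]
    · linarith [hg (s + τ)]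
  rw [intervalIntegral.integral_add i1 i2, intervalIntegral.integral_comp_add_right] at h1
  have h2 := hle 0 (T / 2) le_rfl (by linarith) (by linarith)
  have h3 := hle (0 + τ) (T / 2 + τ) (by linarith) (by linarith) (by linarith)
  rw [intervalIntegral.integral_const, smul_eq_mul] at h1
  linarith

end KP

theorem stmt2 (d : ℕ) (hd : 2 ≤ d)
    (α : ℝ) (hα1 : α < 1) (hα2 : α < 1 / 2)
    (K : ℝ) (hK : 0 < K)
    (a : ℝ → ℝ)
    (ha_nonneg : ∀ r : ℝ, 0 ≤ r → 0 ≤ a r)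
    (ha_bdd : ∃ M : ℝ, ∀ r : ℝ, 0 ≤ r → a r ≤ M)
    (ha_meas : Measurable a)
    (ha_supp : ∀ r : ℝ, K < r → a r = 0)
    (ha_cont : ContinuousAt a 0)
    (ha_one : a 0 = 1)
    (v : EuclideanSpace ℝ (Fin d)) (hv : ‖v‖ = 1)
    (Ω : Type*) [MeasurableSpace Ω] (P : Measure Ω) [IsProbabilityMeasure P]
    (F : Ω → EuclideanSpace ℝ (Fin d) → EuclideanSpace ℝ (Fin d))
    (hF_meas : Measurable (Function.uncurry F))
    (hF_reg : ∀ᵐ ω ∂P, ContDiff ℝ 1 (F ω) ∧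
      ∀ x : EuclideanSpace ℝ (Fin d),
        ∑ i : Fin d, fderiv ℝ (F ω) x (EuclideanSpace.single i 1) i = 0)
    (hF_gauss : ∀ (N : ℕ) (x c : Fin N → EuclideanSpace ℝ (Fin d)),
      Measure.map (fun ω => ∑ j : Fin N, ⟪c j, F ω (x j)⟫) P =
        gaussianReal 0 (Real.toNNReal (∑ j : Fin N, ∑ l : Fin N,
          ∑ i : Fin d, ∑ i' : Fin d,
            c j i * covEntry d α a (x j - x l) i i' * c l i')))
    (X : ℝ → Ω → ℝ → EuclideanSpace ℝ (Fin d))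
    (hX_meas : ∀ δ ∈ Ioc (0:ℝ) 1, Measurable (Function.uncurry (X δ)))
    (hX_sol : ∀ δ ∈ Ioc (0:ℝ) 1, ∀ᵐ ω ∂P, X δ ω 0 = 0 ∧
      ∀ s : ℝ, 0 ≤ s → HasDerivAt (X δ ω) (v + δ • F ω (X δ ω s)) s)
    (hy_int : ∀ δ ∈ Ioc (0:ℝ) 1, ∀ s : ℝ,
      Integrable (fun ω => ‖X δ ω s - s • v‖ ^ 2) P)
    (hy_loc : ∀ δ ∈ Ioc (0:ℝ) 1, ∀ T : ℝ,
      IntegrableOn (fun s => ∫ ω, ‖X δ ω s - s • v‖ ^ 2 ∂P) (Icc 0 T) volume)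
    (t ρ : ℝ) (ht : 0 < t) (hρ : 0 < ρ) :
    Tendsto (fun δ : ℝ =>
        δ ^ (-ρ) *
          ((∫ s in (0:ℝ)..(t * δ ^ (-2 : ℝ)),
              ∫ ω, ‖X δ ω s - s • v‖ ^ 2 ∂P) /
            (t * δ ^ (-2 : ℝ))))
      (nhdsWithin 0 (Ioi 0)) atTop := by
  have sp : KP.SP d α K a := ⟨hd, hα2, hK, ha_nonneg, ha_bdd, ha_meas, ha_supp, ha_cont, ha_one⟩
  have gf := sp.mkGF (P := P) F hF_meas hF_gauss
  obtain ⟨C, hC, hL⟩ := sp.lineBound v hv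
  obtain ⟨χ, hχ0⟩ := KP.exists_filter (d := d) K hK
  have hχ := gf.filter_ae χ (fun x i j => by
    have := KP.conv_R χ K hχ0 (fun k => KP.mm d α a k * KP.pp i j k) (sp.hk_integrable i j)
      (fun k hk => by rw [sp.mm_supp k hk, zero_mul]) x
    exact this) (hF_reg.mono fun ω h => h.1.continuous)
  obtain ⟨c, hc, τ0, hτ0, hlow⟩ := sp.lower v hv
  set θ : ℝ := min ρ 1 / 16 with hθ
  have hθ0 : 0 < θ := by have := lt_min hρ one_pos; positivity
  have hθ1 : θ ≤ 1 / 16 := by have := min_le_right ρ 1; rw [hθ]; linarith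
  have hθρ : 16 * θ ≤ ρ := by have := min_le_left ρ 1; rw [hθ]; linarith
  rw [tendsto_atTop]
  intro b
  have hb' : 0 ≤ max b 0 := le_max_right _ _
  filter_upwards [KP.ev01, KP.ev' (2 / t) (-2 + 8 * θ) (-2) (by linarith),
    gf.core v hv C hC hL χ hχ c τ0 hc hτ0 hlow t ht θ hθ0 hθ1 (4 * max b 0 + 4) (by positivity)]
    with δ ⟨hδ, hδ1⟩ hτ hcore
  by_contra hcon
  rw [not_le] at hcon
  have hδm : δ ∈ Ioc (0:ℝ) 1 := ⟨hδ, hδ1.le⟩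
  set T := t * δ ^ (-2 : ℝ) with hT
  have hT0 : 0 < T := by positivity
  set Y := ∫ s in (0:ℝ)..T, ∫ ω, ‖X δ ω s - s • v‖ ^ 2 ∂P with hY
  have hYlt : Y < b * T * δ ^ ρ := by
    have p := Real.rpow_pos_of_pos hδ ρ
    rw [Real.rpow_neg hδ.le, inv_mul_lt_iff₀ p, div_lt_iff₀ hT0] at hcon
    linarith
  have hYle : Y ≤ max b 0 * T * δ ^ (16 * θ) := by
    refine hYlt.le.trans ?_
    have := KP.rpe hδ hδ1 hθρ
    have p := Real.rpow_pos_of_pos hδ ρ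
    exact mul_le_mul (mul_le_mul_of_nonneg_right (le_max_left _ _) hT0.le) this p.le (by positivity)
  have p16 : 0 < δ ^ (16 * θ) := Real.rpow_pos_of_pos hδ _
  obtain ⟨s0, hs0, hs0T, hg0, hg1⟩ := KP.averaging (fun s => ∫ ω, ‖X δ ω s - s • v‖ ^ 2 ∂P)
    (fun s => integral_nonneg fun ω => by positivity) T (δ ^ (-2 + 8 * θ))
    ((4 * max b 0 + 4) * δ ^ (16 * θ)) hT0.le (by positivity) (by
      rw [hT]
      rw [div_mul_eq_mul_div, div_le_iff₀ ht] at hτ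
      linarith) (hy_loc δ hδm T) (by
      rw [← hY]
      have := mul_pos hT0 p16
      nlinarith)
  refine hcore (fun ω s => X δ ω s - s • v) ?_ (fun s => hy_int δ hδm s) s0 (s0 + δ ^ (-2 + 8 * θ)) hs0
    (by ring) ?_ hg0 hg1
  · filter_upwards [hX_sol δ hδm] with ω ⟨h0, hd⟩
    refine ⟨by simp [h0], fun s hs => ?_⟩
    have h2 : HasDerivAt (fun s : ℝ => s • v) v s := by
      simpa using (hasDerivAt_id s).smul_const v
    have h3 := (hd s hs).sub h2
    rw [add_sub_cancel_left] at h3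
    rw [sub_add_cancel]
    exact h3
  · rw [div_mul_eq_mul_div, div_le_iff₀ ht] at hτ
    linarith
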